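/- Let q = p^k be a prime power and let G = PSp_4(F_q) be the quotient of the symplectic group Sp_4(F_q) by its center. Then G contains a proper subgroup H with exp(H) = exp(G) if and only if p ≠ 3. -/

import Mathlib

namespace SymplecticFour

open LinearMap (BilinForm)

section Basic

variable {F V : Type*} [Field F] [AddCommGroup V] [Module F V]

/-- A nondegenerate alternating form on a four-dimensional space. -/
structure IsSymplecticFour (ω : BilinForm F V) : Prop where
  alt : ω.IsAlt
  nondegenerate : ω.Nondegenerate
  finrank_eq : Module.finrank F V = 4

/-- `H` contains the transvection `x ↦ x + α ω(x, v) v`. -/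
def HasTransvection (ω : BilinForm F V) (H : Subgroup (V ≃ₗ[F] V)) (v : V) (α : F) : Prop :=
  ∃ h ∈ H, ∀ x, h x = x + (α * ω x v) • v

/-- `H` contains the Siegel transformation with centre `y` and direction `b`. -/
def HasSiegel (ω : BilinForm F V) (H : Subgroup (V ≃ₗ[F] V)) (y b : V) (α : F) : Prop :=
  ∃ h ∈ H, ∀ x, h x = x + ω x y • b + ω x b • y + (α * ω x y) • y

/-- `H` preserves `ω`. -/
def Preserves (ω : BilinForm F V) (H : Subgroup (V ≃ₗ[F] V)) : Prop :=
  ∀ h ∈ H, ∀ x y, ω (h x) (h y) = ω x y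

variable {ω : BilinForm F V} {H : Subgroup (V ≃ₗ[F] V)}

namespace IsSymplecticFour

theorem finiteDimensional (hω : IsSymplecticFour ω) : FiniteDimensional F V :=
  FiniteDimensional.of_finrank_pos (by rw [hω.finrank_eq]; norm_num)

theorem self_eq_zero (hω : IsSymplecticFour ω) (x : V) : ω x x = 0 := hω.alt x

theorem swap (hω : IsSymplecticFour ω) (x y : V) : ω y x = -ω x y := (hω.alt.neg_eq x y).symm

theorem swap_eq_zero (hω : IsSymplecticFour ω) {x y : V} (h : ω x y = 0) : ω y x = 0 := by
  rw [hω.swap, h, neg_zero]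

theorem exists_ne_zero (hω : IsSymplecticFour ω) {x : V} (hx : x ≠ 0) : ∃ y, ω x y ≠ 0 := by
  by_contra! h
  exact hx (hω.nondegenerate.1 x h)

theorem mem_span_pair_of_orthogonal (hω : IsSymplecticFour ω) {x y z : V}
    (hxy : LinearIndependent F ![x, y]) (hyx : ω y x = 0) (hx : ω z x = 0) (hy : ω z y = 0) :
    ∃ a b : F, z = a • x + b • y := by
  have := hω.finiteDimensional
  set W : Submodule F V := Submodule.span F {x, y} with hW
  have hW2 : Module.finrank F W = 2 := by
    have := finrank_span_eq_card hxy
    rw [Matrix.range_cons_cons_empty] at this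
    simpa using this
  have hle : W ≤ ω.orthogonal W := by
    intro a ha
    rw [LinearMap.BilinForm.mem_orthogonal_iff]
    intro b hb
    rw [hW, Submodule.mem_span_pair] at ha hb
    obtain ⟨a1, a2, rfl⟩ := ha
    obtain ⟨b1, b2, rfl⟩ := hb
    simp [hω.self_eq_zero, hyx, hω.swap_eq_zero hyx]
  have hWo : Module.finrank F (ω.orthogonal W) = 2 := by
    rw [LinearMap.BilinForm.finrank_orthogonal hω.nondegenerate, hW2, hω.finrank_eq]
  have heq : W = ω.orthogonal W := Submodule.eq_of_le_of_finrank_eq hle (by rw [hW2, hWo])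
  have hz : z ∈ W := by
    rw [heq, LinearMap.BilinForm.mem_orthogonal_iff]
    intro b hb
    rw [hW, Submodule.mem_span_pair] at hb
    obtain ⟨b1, b2, rfl⟩ := hb
    simp [hω.swap_eq_zero hx, hω.swap_eq_zero hy]
  rw [hW, Submodule.mem_span_pair] at hz
  obtain ⟨a, b, h⟩ := hz
  exact ⟨a, b, h.symm⟩

theorem linearIndependent_pair (hω : IsSymplecticFour ω) {y x₁ x₂ : V} (hy : y ≠ 0)
    (h : ω x₁ x₂ ≠ 0) (h₂ : ω x₂ y = 0) :
    LinearIndependent F ![y, x₁] := by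
  rw [LinearIndependent.pair_iff]
  intro s t hst
  have ht : t = 0 := by
    have := congrArg (fun z => ω z x₂) hst
    simpa [hω.swap_eq_zero h₂, h] using this
  subst ht
  simpa [hy] using hst

theorem mem_span_of_orthogonal (hω : IsSymplecticFour ω) {y x₁ x₂ z : V} (hy : y ≠ 0)
    (h₁ : ω x₁ y = 0) (h : ω x₁ x₂ ≠ 0) (h₂ : ω x₂ y = 0) (hzy : ω z y = 0)
    (hz₁ : ω z x₁ = 0) (hz₂ : ω z x₂ = 0) : ∃ a : F, z = a • y := by
  obtain ⟨a, b, rfl⟩ := hω.mem_span_pair_of_orthogonal (hω.linearIndependent_pair hy h h₂)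
    h₁ hzy hz₁
  have hb : b = 0 := by simpa [hω.swap_eq_zero h₂, h] using hz₂
  exact ⟨a, by simp [hb]⟩

end IsSymplecticFour

namespace HasTransvection

theorem zero (v : V) : HasTransvection ω H v 0 := ⟨1, H.one_mem, fun x => by simp⟩

theorem add (hω : IsSymplecticFour ω) {v : V} {α β : F} (hα : HasTransvection ω H v α)
    (hβ : HasTransvection ω H v β) : HasTransvection ω H v (α + β) := by
  obtain ⟨g, hg, hg'⟩ := hα
  obtain ⟨h, hh, hh'⟩ := hβ
  refine ⟨g * h, H.mul_mem hg hh, fun x => ?_⟩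
  rw [LinearEquiv.mul_apply, hh', hg']
  simp only [map_add, map_smul, LinearMap.add_apply, LinearMap.smul_apply, hω.self_eq_zero,
    smul_eq_mul]
  module

theorem neg (hω : IsSymplecticFour ω) {v : V} {α : F} (hα : HasTransvection ω H v α) :
    HasTransvection ω H v (-α) := by
  obtain ⟨g, hg, hg'⟩ := hα
  refine ⟨g⁻¹, H.inv_mem hg, fun x => ?_⟩
  apply g.injective
  rw [show g (g⁻¹ x) = x from g.apply_symm_apply x, hg']
  simp only [map_add, map_smul, LinearMap.add_apply, LinearMap.smul_apply, hω.self_eq_zero,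
    smul_eq_mul]
  module

theorem smul {v : V} {c α : F} (hα : HasTransvection ω H v (α * c ^ 2)) :
    HasTransvection ω H (c • v) α := by
  obtain ⟨g, hg, hg'⟩ := hα
  refine ⟨g, hg, fun x => ?_⟩
  rw [hg']
  simp only [map_smul, smul_eq_mul]
  module

theorem conj (hH : Preserves ω H) {v : V} {α : F} (hα : HasTransvection ω H v α)
    {h : V ≃ₗ[F] V} (hh : h ∈ H) : HasTransvection ω H (h v) α := by
  obtain ⟨g, hg, hg'⟩ := hα
  refine ⟨h * g * h⁻¹, H.mul_mem (H.mul_mem hh hg) (H.inv_mem hh), fun x => ?_⟩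
  obtain ⟨x, rfl⟩ := h.surjective x
  have : h⁻¹ (h x) = x := h.symm_apply_apply x
  rw [LinearEquiv.mul_apply, LinearEquiv.mul_apply, this, hg', map_add, map_smul, hH h hh]

end HasTransvection

namespace HasSiegel

theorem add (hω : IsSymplecticFour ω) {y b b' : V} {α α' : F} (hb : ω b y = 0) (hb' : ω b' y = 0)
    (h₁ : HasSiegel ω H y b α) (h₂ : HasSiegel ω H y b' α') :
    HasSiegel ω H y (b + b') (α + α' + ω b' b) := by
  obtain ⟨g, hg, hg'⟩ := h₁
  obtain ⟨h, hh, hh'⟩ := h₂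
  refine ⟨g * h, H.mul_mem hg hh, fun x => ?_⟩
  rw [LinearEquiv.mul_apply, hh', hg']
  simp only [map_add, map_smul, LinearMap.add_apply, LinearMap.smul_apply, hω.self_eq_zero,
    smul_eq_mul, hb', hω.swap_eq_zero hb]
  module

theorem neg (hω : IsSymplecticFour ω) {y b : V} {α : F} (hb : ω b y = 0)
    (h₁ : HasSiegel ω H y b α) : HasSiegel ω H y (-b) (-α) := by
  obtain ⟨g, hg, hg'⟩ := h₁
  refine ⟨g⁻¹, H.inv_mem hg, fun x => ?_⟩
  apply g.injective
  rw [show g (g⁻¹ x) = x from g.apply_symm_apply x, hg']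
  simp only [map_add, map_smul, map_neg, LinearMap.add_apply, LinearMap.smul_apply,
    LinearMap.neg_apply, hω.self_eq_zero, smul_eq_mul, hb, hω.swap_eq_zero hb]
  module

theorem conj (hH : Preserves ω H) {y b : V} {α : F} (hα : HasSiegel ω H y b α)
    {h : V ≃ₗ[F] V} (hh : h ∈ H) : HasSiegel ω H (h y) (h b) α := by
  obtain ⟨g, hg, hg'⟩ := hα
  refine ⟨h * g * h⁻¹, H.mul_mem (H.mul_mem hh hg) (H.inv_mem hh), fun x => ?_⟩
  obtain ⟨x, rfl⟩ := h.surjective x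
  have : h⁻¹ (h x) = x := h.symm_apply_apply x
  rw [LinearEquiv.mul_apply, LinearEquiv.mul_apply, this, hg']
  simp only [map_add, map_smul, hH h hh]

theorem transvection_of_span {y : V} {κ α : F} (h : HasSiegel ω H y (κ • y) α) :
    HasTransvection ω H y (2 * κ + α) := by
  obtain ⟨g, hg, hg'⟩ := h
  refine ⟨g, hg, fun x => ?_⟩
  rw [hg']
  simp only [map_smul, smul_eq_mul]
  module

theorem of_transvection {y : V} {κ α : F} (h : HasTransvection ω H y (2 * κ + α)) :
    HasSiegel ω H y (κ • y) α := by
  obtain ⟨g, hg, hg'⟩ := h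
  refine ⟨g, hg, fun x => ?_⟩
  rw [hg']
  simp only [map_smul, smul_eq_mul]
  module

theorem commutator (hω : IsSymplecticFour ω) {y b b' : V} {α α' : F} (hb : ω b y = 0)
    (hb' : ω b' y = 0) (h₁ : HasSiegel ω H y b α) (h₂ : HasSiegel ω H y b' α') :
    HasTransvection ω H y (2 * ω b' b) := by
  have h := (h₁.add hω hb hb' h₂)
  have h' := (h₂.add hω hb' hb h₁).neg hω (by simp [hb, hb'])
  have h3 := h.add hω (by simp [hb, hb']) (by simp [hb, hb']) h'
  have e : b + b' + -(b' + b) = (0 : F) • y := by simp; abel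
  rw [e] at h3
  have h4 := h3.transvection_of_span
  convert h4 using 1
  simp only [map_add, map_neg, LinearMap.add_apply, LinearMap.neg_apply, hω.self_eq_zero]
  rw [hω.swap b b']
  ring

theorem of_transvections {x y : V} {α c : F} (hω : IsSymplecticFour ω)
    (hxy : ω x y = 0) (h : HasTransvection ω H (x + c • y) α) (h' : HasTransvection ω H x α) :
    HasSiegel ω H y ((α * c) • x) (α * c ^ 2) := by
  obtain ⟨g, hg, hg'⟩ := h
  obtain ⟨k, hk, hk'⟩ := h'.neg hω
  refine ⟨g * k, H.mul_mem hg hk, fun z => ?_⟩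
  rw [LinearEquiv.mul_apply, hk', hg']
  simp only [map_add, map_smul, LinearMap.add_apply, LinearMap.smul_apply, hω.self_eq_zero,
    smul_eq_mul, hxy]
  module

/-- Conjugating by a transvection moves the direction of a Siegel transformation. -/
theorem conj_transvection (hH : Preserves ω H) {y b x : V} {α β : F}
    (hy : ω y x = 0) (h : HasSiegel ω H y b α) (hx : HasTransvection ω H x β) :
    HasSiegel ω H y (b + (β * ω b x) • x) α := by
  obtain ⟨g, hg, hg'⟩ := hx
  have := h.conj hH hg
  rwa [hg', hg', hy, mul_zero, zero_smul, add_zero] at this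

end HasSiegel

end Basic

end SymplecticFour

namespace SymplecticFour

open LinearMap (BilinForm)

section Counting

open Finset

open scoped Classical in
theorem card_modEq_card_filter_fixed {α : Type*} (X : Finset α) (f : α → α)
    (hf : ∀ x ∈ X, f x ∈ X) {p n : ℕ} [Fact p.Prime] (h : ∀ x ∈ X, f^[p ^ n] x = x) :
    #X ≡ #{x ∈ X | f x = x} [MOD p] := by
  let g : Function.End X := fun x => ⟨f x, hf x x.2⟩
  have hg : ∀ (k : ℕ) (x : X), ((g ^ k : Function.End X) x : α) = f^[k] x := by
    intro k
    induction k with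
    | zero => intro x; rfl
    | succ k ih =>
      intro x
      rw [pow_succ, Function.iterate_succ_apply]
      exact ih (g x)
  have key := Equiv.Perm.card_fixedPoints_modEq (f := g) (p := p) (n := n)
    (by funext x; exact Subtype.ext ((hg _ x).trans (h x x.2)))
  rw [Fintype.card_coe] at key
  refine key.trans (congrArg (· % p) ?_)
  rw [← Fintype.card_coe]
  refine Fintype.card_congr ⟨fun x => ⟨x.1.1, ?_⟩, fun x => ⟨⟨x.1, (mem_filter.1 x.2).1⟩, ?_⟩,
    fun x => ?_, fun x => ?_⟩
  · exact mem_filter.2 ⟨x.1.2, congrArg Subtype.val x.2⟩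
  · exact Subtype.ext (mem_filter.1 x.2).2
  · rfl
  · rfl

theorem natCard_dvd_card_of_stabilizer_eq_bot {G α : Type*} [Group G] [Finite G] [MulAction G α]
    (X : Finset α) (hX : ∀ g : G, ∀ x ∈ X, g • x ∈ X)
    (hstab : ∀ g : G, ∀ x ∈ X, g • x = x → g = 1) : Nat.card G ∣ #X := by
  let Y : SubMulAction G α :=
    { carrier := X
      smul_mem' := fun g x hx => hX g x hx }
  have hst : ∀ b : Y, MulAction.stabilizer G b = ⊥ := fun b =>
    eq_bot_iff.2 fun g hg => hstab g b.1 b.2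
      (congrArg Subtype.val (MulAction.mem_stabilizer_iff.1 hg))
  have hcard : Nat.card Y = #X := by
    change Nat.card X = #X
    simp
  rw [← hcard, Nat.card_congr (MulAction.selfEquivOrbitsQuotientProd hst), Nat.card_prod]
  exact dvd_mul_left _ _

theorem dvd_card_of_free {G α : Type*} [Group G] [Finite G] [MulAction G α] (X : Finset α) {t : G}
    {r f : ℕ} (hr : r.Prime) (ht : orderOf t = r ^ f) (htX : ∀ x ∈ X, t • x ∈ X)
    (hfree : ∀ g ∈ Subgroup.zpowers t, orderOf g = r → ∀ x ∈ X, g • x ≠ x) : r ^ f ∣ #X := by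
  have hpow : ∀ (k : ℕ), ∀ x ∈ X, t ^ k • x ∈ X := by
    intro k
    induction k with
    | zero => simp
    | succ k ih => intro x hx; rw [pow_succ, mul_smul]; exact ih _ (htX x hx)
  rw [← ht, ← Nat.card_zpowers]
  refine natCard_dvd_card_of_stabilizer_eq_bot X ?_ ?_
  · rintro ⟨c, hc⟩ x hx
    obtain ⟨k, rfl⟩ := mem_powers_iff_mem_zpowers.2 hc
    exact hpow k x hx
  · rintro ⟨g, hg⟩ x hx hgx
    by_contra hne
    have hdvd : orderOf g ∣ r ^ f := ht ▸ orderOf_dvd_of_mem_zpowers hg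
    obtain ⟨e, -, he⟩ := (Nat.dvd_prime_pow hr).1 hdvd
    have he0 : e ≠ 0 := by
      rintro rfl
      rw [pow_zero, orderOf_eq_one_iff] at he
      exact hne (Subtype.ext he)
    have hord : orderOf (g ^ r ^ (e - 1)) = r := by
      rw [orderOf_pow_of_dvd (pow_ne_zero _ hr.ne_zero) (he ▸ pow_dvd_pow r (Nat.sub_le e 1)), he,
        Nat.pow_div (Nat.sub_le e 1) hr.pos, Nat.sub_sub_self (Nat.one_le_iff_ne_zero.2 he0),
        pow_one]
    refine hfree _ (Subgroup.pow_mem _ hg _) hord x hx ?_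
    exact Subgroup.pow_mem (MulAction.stabilizer G x) (MulAction.mem_stabilizer_iff.2 hgx) _

/-- A prime dividing `q ^ 2 + 1`, other than two, divides none of `q - 1`, `q ^ 2 - 1`,
`q ^ 3 - 1`. -/
theorem not_pow_modEq_one {q r d : ℕ} (hr : r.Prime) (hr2 : r ≠ 2) (h : r ∣ q ^ 2 + 1)
    (hd : d = 1 ∨ d = 2 ∨ d = 3) : ¬ q ^ d ≡ 1 [MOD r] := by
  have := Fact.mk hr
  have h' : (q : ZMod r) ^ 2 + 1 = 0 := by
    have := (ZMod.natCast_eq_zero_iff _ _).2 h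
    exact_mod_cast this
  have h2 : (2 : ZMod r) ≠ 0 := by
    intro h2
    have : r ∣ 2 := (ZMod.natCast_eq_zero_iff _ _).1 (by exact_mod_cast h2)
    exact hr2 ((Nat.prime_dvd_prime_iff_eq hr Nat.prime_two).1 this)
  intro hmod
  have hm : (q : ZMod r) ^ d = 1 := by
    have := (ZMod.natCast_eq_natCast_iff _ _ _).2 hmod
    exact_mod_cast this
  apply h2
  rcases hd with rfl | rfl | rfl
  · rw [pow_one] at hm; rw [hm] at h'; linear_combination h'
  · linear_combination h' - hm
  · linear_combination (1 - (q : ZMod r) * (q - 1)) * h' + ((q : ZMod r) - 1) * hm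

theorem iterate_orderOf {F V : Type*} [Field F] [AddCommGroup V] [Module F V]
    (g : V ≃ₗ[F] V) (x : V) : (fun y => g y)^[orderOf g] x = x := by
  have : ∀ k : ℕ, (fun y => g y)^[k] x = (g ^ k) x := by
    intro k
    induction k with
    | zero => rfl
    | succ k ih => rw [Function.iterate_succ_apply', ih, pow_succ', LinearEquiv.mul_apply]
  rw [this, pow_orderOf_eq_one]
  rfl

variable {F V : Type*} [Field F] [AddCommGroup V] [Module F V] [Fintype F] [Fintype V]
variable {ω : BilinForm F V}

open scoped Classical in
theorem card_filter_mem (W : Submodule F V) :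
    #{x : V | x ∈ W} = Fintype.card F ^ Module.finrank F W := by
  rw [← Module.card_eq_pow_finrank (K := F) (V := W), ← Fintype.card_subtype]

theorem card_eq_of_finrank (h : Module.finrank F V = 4) :
    Fintype.card V = Fintype.card F ^ 4 := by
  rw [Module.card_eq_pow_finrank (K := F) (V := V), h]

section

variable {r : ℕ} {g : V ≃ₗ[F] V}

theorem apply_ne_self_of_orderOf (h4 : Module.finrank F V = 4) (hr : r.Prime) (hr2 : r ≠ 2)
    (h : r ∣ Fintype.card F ^ 2 + 1) (hg : orderOf g = r) {x : V} (hx : x ≠ 0) : g x ≠ x := by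
  classical
  intro hgx
  have := Fact.mk hr
  have := FiniteDimensional.of_finrank_pos (K := F) (V := V) (by rw [h4]; norm_num)
  let W : Submodule F V := LinearMap.eqLocus (g : V →ₗ[F] V) LinearMap.id
  have hmem : ∀ y, y ∈ W ↔ g y = y := fun y => Iff.rfl
  have key := card_modEq_card_filter_fixed (univ : Finset V) (fun y => g y) (by simp) (p := r)
    (n := 1) (by intro y _; rw [pow_one, ← hg]; exact iterate_orderOf g y)
  simp only [← hmem, card_filter_mem, Finset.card_univ, card_eq_of_finrank h4] at key
  have hd0 : Module.finrank F W ≠ 0 := by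
    intro h0
    rw [Submodule.finrank_eq_zero] at h0
    have : x ∈ W := hgx
    rw [h0] at this
    exact hx ((Submodule.mem_bot F).1 this)
  have hd4 : Module.finrank F W ≠ 4 := by
    intro h0
    have htop : W = ⊤ := Submodule.eq_top_of_finrank_eq (h0.trans h4.symm)
    have : g = 1 := by
      ext y
      have : y ∈ W := htop ▸ Submodule.mem_top
      exact this
    rw [this, orderOf_one] at hg
    exact hr.one_lt.ne hg
  have hle : Module.finrank F W ≤ 4 := h4 ▸ Submodule.finrank_le W
  have hcop : Nat.Coprime r (Fintype.card F ^ Module.finrank F W) := by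
    rw [Nat.Prime.coprime_iff_not_dvd hr]
    intro hd
    have h1 := hr.dvd_of_dvd_pow hd
    have h2 : r ∣ Fintype.card F ^ 2 := dvd_pow h1 two_ne_zero
    exact hr.one_lt.ne' (Nat.dvd_one.1 ((Nat.dvd_add_right h2).1 h))
  refine not_pow_modEq_one (d := 4 - Module.finrank F W) hr hr2 h (by omega) ?_
  have e : Fintype.card F ^ 4 =
      Fintype.card F ^ (Module.finrank F W) * Fintype.card F ^ (4 - Module.finrank F W) := by
    rw [← pow_add]; congr 1; omega
  rw [e] at key
  exact Nat.ModEq.cancel_left_of_coprime (c := Fintype.card F ^ (Module.finrank F W)) hcop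
    (by simpa using key)

open scoped Pointwise in
theorem smul_submodule_ne_self_of_orderOf (h4 : Module.finrank F V = 4) (hr : r.Prime)
    (hr2 : r ≠ 2) (h : r ∣ Fintype.card F ^ 2 + 1) (hg : orderOf g = r) {W : Submodule F V}
    (hbot : W ≠ ⊥) (htop : W ≠ ⊤) : g • W ≠ W := by
  classical
  intro hgW
  have := Fact.mk hr
  have := FiniteDimensional.of_finrank_pos (K := F) (V := V) (by rw [h4]; norm_num)
  have hst : ∀ y ∈ W, g y ∈ W := by
    intro y hy
    have : g • y ∈ g • W := Submodule.smul_mem_pointwise_smul _ _ _ hy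
    rwa [hgW] at this
  have key := card_modEq_card_filter_fixed ({x : V | x ∈ W} : Finset V) (fun y => g y)
    (by simpa using hst) (p := r)
    (n := 1) (by intro y _; rw [pow_one, ← hg]; exact iterate_orderOf g y)
  have h1 : ({x ∈ ({x : V | x ∈ W} : Finset V) | g x = x} : Finset V) = {0} := by
    ext y
    simp only [mem_filter, mem_univ, true_and, mem_singleton]
    constructor
    · rintro ⟨-, hy⟩
      by_contra hy0
      exact apply_ne_self_of_orderOf h4 hr hr2 h hg hy0 hy
    · rintro rfl
      simp
  rw [h1, card_filter_mem, card_singleton] at key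
  have hd0 : Module.finrank F W ≠ 0 := by rwa [Ne, Submodule.finrank_eq_zero]
  have hlt : Module.finrank F W < 4 := h4 ▸ Submodule.finrank_lt htop
  exact not_pow_modEq_one hr hr2 h (by omega) key

end

end Counting

end SymplecticFour

namespace SymplecticFour

open LinearMap (BilinForm)

section LineCounting

open Finset

variable {F V : Type*} [Field F] [AddCommGroup V] [Module F V] [Fintype F] [Fintype V]
variable {ω : BilinForm F V}

open scoped Classical in
theorem card_filter_perp (hω : IsSymplecticFour ω) {y : V} (hy : y ≠ 0) :
    #{p : V | ω p y = 0} = Fintype.card F ^ 3 := by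
  have := hω.finiteDimensional
  have hne : ω.flip y ≠ 0 := by
    intro h
    obtain ⟨z, hz⟩ := hω.exists_ne_zero hy
    apply hz
    rw [hω.swap]
    have := LinearMap.congr_fun h z
    simpa using this
  have hsurj : Function.Surjective (ω.flip y) := LinearMap.surjective hne
  have h1 := LinearMap.finrank_range_add_finrank_ker (ω.flip y)
  rw [LinearMap.range_eq_top.2 hsurj, finrank_top, Module.finrank_self, hω.finrank_eq] at h1
  have h2 : Module.finrank F (LinearMap.ker (ω.flip y)) = 3 := by omega
  have h3 := card_filter_mem (LinearMap.ker (ω.flip y))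
  rw [h2] at h3
  rw [← h3]
  rfl

open scoped Classical in
theorem card_filter_smul {y : V} (hy : y ≠ 0) :
    #{p : V | ∃ c : F, p = c • y} = Fintype.card F := by
  have : ({p : V | ∃ c : F, p = c • y} : Finset V) = univ.image (fun c : F => c • y) := by
    ext p; simp [eq_comm]
  rw [this, card_image_of_injective _ (smul_left_injective F hy), Finset.card_univ]

open scoped Classical in
theorem card_filter_perp_sdiff (hω : IsSymplecticFour ω) {y : V} (hy : y ≠ 0) :
    #{p : V | ω p y = 0 ∧ ¬ ∃ c : F, p = c • y} = Fintype.card F ^ 3 - Fintype.card F := by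
  rw [← card_filter_perp hω hy, ← card_filter_smul (F := F) hy, ← card_sdiff_of_subset]
  · congr 1
    ext p
    simp
  · intro p
    simp only [mem_filter, mem_univ, true_and]
    rintro ⟨c, rfl⟩
    simp [hω.self_eq_zero]

/-- If each point of `S` lies on many totally isotropic lines which meet `S` in that point only,
then `S` is small. -/
theorem card_mul_le_of_tangent (hω : IsSymplecticFour ω) (S : Finset V)
    (h0 : (0 : V) ∉ S) (bad : V → Finset V) (B : ℕ) (hB : ∀ y ∈ S, B ≤ #(bad y))
    (hperp : ∀ y ∈ S, ∀ p ∈ bad y, ω p y = 0)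
    (hspan : ∀ y ∈ S, ∀ p ∈ bad y, ¬ ∃ c : F, p = c • y)
    (hbad : ∀ y ∈ S, ∀ p ∈ bad y, ∀ a b : F, a • y + b • p ∈ S → b = 0) :
    #S * B * (Fintype.card F + 1) ≤
      (Fintype.card F ^ 4 - 1) * (Fintype.card F ^ 3 - Fintype.card F) := by
  classical
  let X : Finset ((_ : V) × V) := (univ.erase (0 : V)).sigma
    fun y => ({p : V | ω p y = 0 ∧ ¬ ∃ c : F, p = c • y} : Finset V)
  have hX : #X = (Fintype.card F ^ 4 - 1) * (Fintype.card F ^ 3 - Fintype.card F) := by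
    rw [card_sigma, sum_congr rfl (g := fun _ => Fintype.card F ^ 3 - Fintype.card F), sum_const,
      card_erase_of_mem (mem_univ _), Finset.card_univ, card_eq_of_finrank hω.finrank_eq,
      smul_eq_mul]
    intro y hy
    exact card_filter_perp_sdiff hω (mem_erase.1 hy).1
  let D : Finset ((_ : V) × V) := S.sigma bad
  have hD : #S * B ≤ #D := by
    rw [card_sigma, ← smul_eq_mul]
    exact card_nsmul_le_sum _ _ _ hB
  let f : ((_ : V) × V) × Option F → (_ : V) × V := fun z =>
    match z with
    | (⟨y, p⟩, none) => ⟨p, y⟩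
    | (⟨y, p⟩, some μ) => ⟨y - μ • p, p⟩
  have hmaps : ∀ z ∈ D ×ˢ (univ : Finset (Option F)), f z ∈ X := by
    rintro ⟨⟨y, p⟩, o⟩ hz
    simp only [mem_product, mem_univ, and_true, D, mem_sigma] at hz
    obtain ⟨hy, hp⟩ := hz
    have hy0 : y ≠ 0 := by rintro rfl; exact h0 hy
    have hp1 := hperp y hy p hp
    have hp2 := hspan y hy p hp
    have hp0 : p ≠ 0 := by rintro rfl; exact hp2 ⟨0, by simp⟩
    rcases o with _ | μ
    · simp only [f, X, mem_sigma, mem_erase, mem_univ, and_true, mem_filter, true_and]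
      refine ⟨hp0, hω.swap_eq_zero hp1, ?_⟩
      rintro ⟨c, hc⟩
      have hc0 : c ≠ 0 := by rintro rfl; exact hy0 (by simpa using hc)
      exact hp2 ⟨c⁻¹, by rw [hc, inv_smul_smul₀ hc0]⟩
    · simp only [f, X, mem_sigma, mem_erase, mem_univ, and_true, mem_filter, true_and]
      refine ⟨?_, by simp [hp1, hω.self_eq_zero], ?_⟩
      · intro h
        have hy' : y = μ • p := sub_eq_zero.1 h
        have hμ : μ ≠ 0 := by rintro rfl; exact hy0 (by simpa using hy')
        exact hp2 ⟨μ⁻¹, by rw [hy', inv_smul_smul₀ hμ]⟩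
      · rintro ⟨c, hc⟩
        have h1 : (1 + c * μ) • p = c • y := by
          rw [add_smul, one_smul, mul_smul]
          nth_rewrite 1 [hc]
          rw [smul_sub]
          abel
        have h2 : 1 + c * μ ≠ 0 := by
          intro h2
          rw [h2, zero_smul] at h1
          rcases smul_eq_zero.1 h1.symm with hc0 | h3
          · simp [hc0] at h2
          · exact hy0 h3
        exact hp2 ⟨(1 + c * μ)⁻¹ * c, by rw [mul_smul, ← h1, inv_smul_smul₀ h2]⟩
  have hinj : Set.InjOn f (D ×ˢ (univ : Finset (Option F)) : Finset _) := by
    rintro ⟨⟨y, p⟩, o⟩ hz ⟨⟨y', p'⟩, o'⟩ hz' heq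
    simp only [coe_product, Set.mem_prod, mem_coe, mem_univ, and_true, D, mem_sigma] at hz hz'
    obtain ⟨hy, hp⟩ := hz
    obtain ⟨hy', hp'⟩ := hz'
    have hp2 := hspan y hy p hp
    have hp2' := hspan y' hy' p' hp'
    rcases o with _ | μ <;> rcases o' with _ | μ' <;>
      simp only [f, Sigma.mk.injEq, heq_eq_eq] at heq <;> obtain ⟨e1, e2⟩ := heq
    · subst e1 e2; rfl
    · subst e2
      exfalso
      have hb := hbad y' hy' y hp' 0 1 (by simpa using hy)
      exact one_ne_zero hb
    · subst e2
      exfalso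
      have hb := hbad y hy p hp 0 1 (by simpa using hy')
      exact one_ne_zero hb
    · subst e2
      have h1 : y' = (1 : F) • y + (μ' - μ) • p := by
        rw [one_smul, sub_smul]
        have := sub_eq_iff_eq_add.1 e1
        rw [this]; abel
      have h2 := hbad y hy p hp 1 (μ' - μ) (h1 ▸ hy')
      rw [h2, zero_smul, add_zero, one_smul] at h1
      rw [sub_eq_zero] at h2
      subst h1 h2
      rfl
  have := card_le_card_of_injOn f hmaps hinj
  rw [hX, card_product, Finset.card_univ, Fintype.card_option] at this
  exact (Nat.mul_le_mul_right _ hD).trans this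

end LineCounting

end SymplecticFour

namespace SymplecticFour

open LinearMap (BilinForm)

section Cone

open Finset
open scoped Pointwise

variable {F V : Type*} [Field F] [AddCommGroup V] [Module F V] [Fintype F] [Fintype V]
variable {ω : BilinForm F V} {H : Subgroup (V ≃ₗ[F] V)} {v u₀ : V} {u : V ≃ₗ[F] V}

instance finite_linearEquiv : Finite (V ≃ₗ[F] V) :=
  Finite.of_injective (fun g : V ≃ₗ[F] V => (g : V → V)) DFunLike.coe_injective

/-- A group of isometries containing a regular unipotent element `u` with fixed vector `v`, and
enough elements of order prime to three. -/
structure RegularUnipotentData (ω : BilinForm F V) (H : Subgroup (V ≃ₗ[F] V)) (u : V ≃ₗ[F] V)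
    (v : V) : Prop where
  symp : IsSymplecticFour ω
  preserves : Preserves ω H
  ne_zero : v ≠ 0
  exists_transvection : ∃ α ≠ 0, HasTransvection ω H v α
  mem : u ∈ H
  exists_pow : ∃ n, u ^ 3 ^ n = 1
  apply_self : u v = v
  fixed : ∀ x, u x = x → ∃ c : F, x = c • v
  exists_orderOf : ∀ r f : ℕ, r.Prime → r ^ f ∣ (Fintype.card F ^ 2 + 1) / 2 →
    ∃ t ∈ H, orderOf t = r ^ f

open scoped Classical in
/-- The nonzero vectors proportional to a vector in the orbit of `v`. -/
noncomputable def cone (H : Subgroup (V ≃ₗ[F] V)) (v : V) : Finset V :=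
  {x | x ≠ 0 ∧ ∃ h ∈ H, ∃ c : F, x = c • h v}

omit [Fintype F] in
theorem mem_cone {x : V} : x ∈ cone H v ↔ x ≠ 0 ∧ ∃ h ∈ H, ∃ c : F, x = c • h v := by
  simp [cone]

omit [Fintype F] in
theorem self_mem_cone (hv : v ≠ 0) : v ∈ cone H v :=
  mem_cone.2 ⟨hv, 1, H.one_mem, 1, by simp⟩

omit [Fintype F] in
theorem zero_notMem_cone : (0 : V) ∉ cone H v := fun h => (mem_cone.1 h).1 rfl

omit [Fintype F] in
theorem smul_mem_cone {x : V} (hx : x ∈ cone H v) {c : F} (hc : c ≠ 0) : c • x ∈ cone H v := by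
  obtain ⟨h0, h, hh, d, rfl⟩ := mem_cone.1 hx
  exact mem_cone.2 ⟨smul_ne_zero hc h0, h, hh, c * d, by rw [mul_smul]⟩

omit [Fintype F] in
theorem apply_mem_cone {x : V} (hx : x ∈ cone H v) {g : V ≃ₗ[F] V} (hg : g ∈ H) :
    g x ∈ cone H v := by
  obtain ⟨h0, h, hh, d, rfl⟩ := mem_cone.1 hx
  exact mem_cone.2 ⟨by simpa using h0, g * h, H.mul_mem hg hh, d, by simp⟩

omit [Fintype F] in
theorem apply_mem_cone_iff {x : V} {g : V ≃ₗ[F] V} (hg : g ∈ H) :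
    g x ∈ cone H v ↔ x ∈ cone H v := by
  refine ⟨fun h => ?_, fun h => apply_mem_cone h hg⟩
  have := apply_mem_cone h (H.inv_mem hg)
  rwa [show g⁻¹ (g x) = x from g.symm_apply_apply x] at this

/-- The points of `y^⊥` spanning with `y` a line which meets the cone in `⟨y⟩` only. -/
def IsTangent (ω : BilinForm F V) (H : Subgroup (V ≃ₗ[F] V)) (v y p : V) : Prop :=
  ω p y = 0 ∧ ∀ a b : F, a • y + b • p ∈ cone H v → b = 0

omit [Fintype F] in
theorem isTangent_apply (hH : Preserves ω H) {h : V ≃ₗ[F] V} (hh : h ∈ H) {c : F} (hc : c ≠ 0)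
    {y p : V} : IsTangent ω H v (c • h y) (h p) ↔ IsTangent ω H v y p := by
  have key : ∀ a b : F, a • c • h y + b • h p = h ((a * c) • y + b • p) := by
    intro a b
    simp only [map_add, map_smul, mul_smul]
  unfold IsTangent
  refine and_congr ?_ ⟨fun H1 a b hab => ?_, fun H1 a b hab => ?_⟩
  · rw [map_smul, hH h hh]; simp [hc]
  · refine H1 (a * c⁻¹) b ?_
    rw [key, apply_mem_cone_iff hh, inv_mul_cancel_right₀ hc]
    exact hab
  · rw [key, apply_mem_cone_iff hh] at hab
    exact H1 _ _ hab

open scoped Classical in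
theorem card_cone_mul_le (hω : IsSymplecticFour ω) (hH : Preserves ω H) {B : ℕ}
    (hB : B ≤ #{p : V | IsTangent ω H v v p}) :
    #(cone H v) * B * (Fintype.card F + 1) ≤
      (Fintype.card F ^ 4 - 1) * (Fintype.card F ^ 3 - Fintype.card F) := by
  refine card_mul_le_of_tangent hω (cone H v) zero_notMem_cone
    (fun y => {p : V | IsTangent ω H v y p}) B ?_ ?_ ?_ ?_
  · intro y hy
    obtain ⟨h0, h, hh, c, rfl⟩ := mem_cone.1 hy
    have hc : c ≠ 0 := by rintro rfl; simp at h0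
    refine hB.trans (card_le_card_of_injOn h ?_ h.injective.injOn)
    intro p hp
    simpa [isTangent_apply hH hh hc] using hp
  · intro y _ p hp
    exact (mem_filter.1 hp).2.1
  · rintro y hy p hp ⟨c, rfl⟩
    have hp := (mem_filter.1 hp).2.2
    by_cases hc : c = 0
    · exact one_ne_zero (hp 1 1 (by simpa [hc] using hy))
    · exact one_ne_zero (hp 0 1 (by simpa using smul_mem_cone hy hc))
  · intro y _ p hp
    exact (mem_filter.1 hp).2.2

end Cone

section Divisibility

open Finset
open scoped Pointwise

variable {F V : Type*} [Field F] [AddCommGroup V] [Module F V] [Fintype F] [Fintype V]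
variable {ω : BilinForm F V} {H : Subgroup (V ≃ₗ[F] V)} {v : V} {u : V ≃ₗ[F] V}

theorem card_mod_four [CharP F 3] : Fintype.card F ^ 2 % 4 = 1 ∧ 3 ∣ Fintype.card F := by
  obtain ⟨n, -, hn⟩ := FiniteField.card F 3
  constructor
  · have : Odd (Fintype.card F) := by
      rw [hn]; exact Odd.pow (by decide)
    obtain ⟨k, hk⟩ := this
    rw [hk, show (2 * k + 1) ^ 2 = 4 * (k ^ 2 + k) + 1 by ring]
    omega
  · rw [hn]
    exact dvd_pow_self 3 n.ne_zero

/-- A prime power dividing `(q ^ 2 + 1) / 2` is odd. -/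
theorem ne_two_of_dvd [CharP F 3] {r : ℕ} (h : r ∣ (Fintype.card F ^ 2 + 1) / 2) : r ≠ 2 := by
  rintro rfl
  have := (card_mod_four (F := F)).1
  omega

theorem dvd_card_sq_add_one [CharP F 3] {r : ℕ} (h : r ∣ (Fintype.card F ^ 2 + 1) / 2) :
    r ∣ Fintype.card F ^ 2 + 1 := by
  have := (card_mod_four (F := F)).1
  exact h.trans ⟨2, by omega⟩

variable [CharP F 3]

namespace RegularUnipotentData

theorem dvd_of_free (D : RegularUnipotentData ω H u v) {α : Type*} [MulAction (V ≃ₗ[F] V) α]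
    (X : Finset α) (hX : ∀ h ∈ H, ∀ x ∈ X, h • x ∈ X)
    (hfree : ∀ r : ℕ, r.Prime → r ≠ 2 → r ∣ Fintype.card F ^ 2 + 1 → ∀ g : V ≃ₗ[F] V,
      orderOf g = r → ∀ x ∈ X, g • x ≠ x) : (Fintype.card F ^ 2 + 1) / 2 ∣ #X := by
  rw [Nat.dvd_iff_prime_pow_dvd_dvd]
  intro r f hr hd
  rcases f with _ | f
  · simp
  have hr' : r ∣ (Fintype.card F ^ 2 + 1) / 2 := (dvd_pow_self r (Nat.succ_ne_zero f)).trans hd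
  obtain ⟨t, ht, hto⟩ := D.exists_orderOf r (f + 1) hr hd
  exact dvd_card_of_free X hr hto (hX t ht) fun g _ hg x hx =>
    hfree r hr (ne_two_of_dvd hr') (dvd_card_sq_add_one hr') g hg x hx

theorem dvd_card_cone (D : RegularUnipotentData ω H u v) :
    (Fintype.card F ^ 2 + 1) / 2 ∣ #(cone H v) :=
  D.dvd_of_free _ (fun _ hh _ hx => apply_mem_cone hx hh) fun _ hr hr2 h _ hg _ hx =>
    apply_ne_self_of_orderOf D.symp.finrank_eq hr hr2 h hg (mem_cone.1 hx).1

omit [CharP F 3] in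
theorem card_units_dvd_card_cone :
    Fintype.card F - 1 ∣ #(cone H v) := by
  rw [← Nat.card_eq_fintype_card, ← Nat.card_units]
  refine natCard_dvd_card_of_stabilizer_eq_bot (cone H v) ?_ ?_
  · intro c x hx
    exact smul_mem_cone hx c.ne_zero
  · intro c x hx hcx
    have h1 : (c : F) • x = (1 : F) • x := by rw [one_smul]; exact hcx
    exact Units.ext (smul_left_injective F (mem_cone.1 hx).1 h1)

theorem exists_card_cone_eq (D : RegularUnipotentData ω H u v) :
    ∃ j, #(cone H v) = (Fintype.card F ^ 2 + 1) / 2 * (Fintype.card F - 1) * j := by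
  refine Nat.Coprime.mul_dvd_of_dvd_of_dvd ?_ D.dvd_card_cone card_units_dvd_card_cone
  refine Nat.coprime_of_dvd fun r hr h1 h2 => ?_
  have h3 := dvd_card_sq_add_one h1
  refine not_pow_modEq_one (d := 1) hr (ne_two_of_dvd h1) h3 (by simp) ?_
  rw [pow_one]
  exact ((Nat.modEq_iff_dvd' Fintype.card_pos).2 h2).symm

theorem card_cone_mod_three (D : RegularUnipotentData ω H u v) : #(cone H v) % 3 = 2 := by
  classical
  obtain ⟨n, hn⟩ := D.exists_pow
  have := Fact.mk Nat.prime_three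
  have h1 := card_modEq_card_filter_fixed (cone H v) (fun x => u • x)
    (fun x hx => apply_mem_cone hx D.mem) (p := 3) (n := n)
    (fun x _ => by rw [smul_iterate, hn]; exact one_smul _ x)
  have h2 : ({x ∈ cone H v | u • x = x} : Finset V) =
      (univ.erase (0 : F)).image fun c => c • v := by
    ext x
    simp only [mem_filter, mem_image, mem_erase, mem_univ, and_true]
    constructor
    · rintro ⟨hx, hux⟩
      obtain ⟨c, rfl⟩ := D.fixed x hux
      refine ⟨c, ?_, rfl⟩
      rintro rfl
      simp [zero_notMem_cone] at hx
    · rintro ⟨c, hc, rfl⟩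
      refine ⟨smul_mem_cone (self_mem_cone D.ne_zero) hc, ?_⟩
      change u (c • v) = _
      rw [map_smul, D.apply_self]
  rw [h2, card_image_of_injective _ (smul_left_injective F D.ne_zero), card_erase_of_mem
    (mem_univ _), Finset.card_univ] at h1
  obtain ⟨k, hk⟩ := (card_mod_four (F := F)).2
  have := Fintype.card_pos (α := F)
  rw [Nat.ModEq] at h1
  omega

omit [CharP F 3] in
theorem exists_transvection_of_mem_cone (D : RegularUnipotentData ω H u v) {x : V}
    (hx : x ∈ cone H v) : ∃ α ≠ 0, HasTransvection ω H x α := by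
  obtain ⟨α, hα, h1⟩ := D.exists_transvection
  obtain ⟨h0, h, hh, c, rfl⟩ := mem_cone.1 hx
  have hc : c ≠ 0 := by rintro rfl; simp at h0
  refine ⟨α / c ^ 2, div_ne_zero hα (pow_ne_zero _ hc), HasTransvection.smul ?_⟩
  rw [div_mul_cancel₀ _ (pow_ne_zero _ hc)]
  exact h1.conj D.preserves hh

end RegularUnipotentData

end Divisibility

end SymplecticFour

namespace SymplecticFour

open LinearMap (BilinForm)

section PerpPoint

open Finset
open scoped Pointwise

variable {F V : Type*} [Field F] [AddCommGroup V] [Module F V] [Fintype F] [Fintype V]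
variable {ω : BilinForm F V} {H : Subgroup (V ≃ₗ[F] V)} {v : V} {u : V ≃ₗ[F] V}

open scoped Classical in
theorem card_filter_perp_pair (hω : IsSymplecticFour ω) {x y : V} (hxy : ω x y ≠ 0) :
    #{p : V | ω p x = 0 ∧ ω p y = 0} = Fintype.card F ^ 2 := by
  have := hω.finiteDimensional
  have hli : LinearIndependent F ![x, y] := by
    rw [LinearIndependent.pair_iff]
    intro s t h
    have h1 := congrArg (fun z => ω z y) h
    have h2 := congrArg (fun z => ω x z) h
    simp [hω.self_eq_zero, hxy] at h1 h2
    exact ⟨h1, h2⟩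
  set W : Submodule F V := Submodule.span F {x, y} with hW
  have hW2 : Module.finrank F W = 2 := by
    have := finrank_span_eq_card hli
    rw [Matrix.range_cons_cons_empty] at this
    simpa using this
  have hWo : Module.finrank F (ω.orthogonal W) = 2 := by
    rw [LinearMap.BilinForm.finrank_orthogonal hω.nondegenerate, hW2, hω.finrank_eq]
  rw [← hWo, ← card_filter_mem]
  congr 1
  ext p
  simp only [mem_filter, mem_univ, true_and, LinearMap.BilinForm.mem_orthogonal_iff]
  constructor
  · rintro ⟨h1, h2⟩ n hn
    rw [hW, Submodule.mem_span_pair] at hn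
    obtain ⟨a, b, rfl⟩ := hn
    simp [hω.swap_eq_zero h1, hω.swap_eq_zero h2]
  · intro h
    exact ⟨hω.swap_eq_zero (h x (Submodule.subset_span (by simp))),
      hω.swap_eq_zero (h y (Submodule.subset_span (by simp)))⟩

/-- A set of pairwise non-perpendicular points meeting a hyperbolic line in `e` points has at
most `e + (q + 1 - e) (q + 1)` points. -/
theorem card_le_of_pairwise_not_perp (hω : IsSymplecticFour ω) {S : Finset V} (h0 : (0 : V) ∉ S)
    {v w : V} (hvw : ω v w = 1)
    (hS : ∀ x ∈ S, ∀ y ∈ S, ω y x = 0 → ∃ c : F, y = c • x)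
    {E : Finset (F × F)} (hE : ∀ z : F × F, z ∈ E ↔ z.1 • v + z.2 • w ∈ S) (hv : v ∈ S) :
    (#S - #E) * (Fintype.card F - 1) ≤
      (Fintype.card F ^ 2 - 1 - #E) * (Fintype.card F ^ 2 - 1) := by
  classical
  have hwv : ω w v = -1 := by rw [hω.swap, hvw]
  set P : V → V := fun x => ω x w • v - ω x v • w with hP
  have hPmul : ∀ (c : F) (x : V), P (c • x) = c • P x := by
    intro c x
    simp only [hP, map_smul, LinearMap.smul_apply, smul_eq_mul]
    module
  have hPP : ∀ a b : F, P (a • v + b • w) = a • v + b • w := by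
    intro a b
    simp [hP, hω.self_eq_zero, hvw, hwv]
  have hpv : ∀ x, ω (x - P x) v = 0 := by
    intro x; simp [hP, hω.self_eq_zero, hwv]
  have hpw : ∀ x, ω (x - P x) w = 0 := by
    intro x; simp [hP, hω.self_eq_zero, hvw]
  have hpP : ∀ x y, ω (x - P x) (P y) = 0 := by
    intro x y
    rw [show P y = ω y w • v - ω y v • w from rfl, map_sub, map_smul, map_smul, hpv, hpw]
    simp
  have hsub : ∀ x, ∀ y, ω x y = ω (P x) (P y) + ω (x - P x) (y - P y) := by
    intro x y
    have h1 := hpP x y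
    have h2 := hω.swap_eq_zero (hpP y x)
    nth_rewrite 1 [← add_sub_cancel (P x) x, ← add_sub_cancel (P y) y]
    simp only [map_add, LinearMap.add_apply, h1, h2, add_zero, zero_add]
  let S' := {x ∈ S | P x ≠ x}
  have hinjE : Function.Injective (fun z : F × F => z.1 • v + z.2 • w) := by
    rintro ⟨a, b⟩ ⟨a', b'⟩ h
    have h1 := congrArg (fun z => ω z w) h
    have h2 := congrArg (fun z => ω v z) h
    simp [hω.self_eq_zero, hvw] at h1 h2
    rw [h1, h2]
  have hcard : #S = #S' + #E := by
    rw [add_comm, ← card_filter_add_card_filter_not (s := S) (fun x => P x = x)]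
    congr 1
    rw [← card_image_of_injective E hinjE]
    congr 1
    ext x
    simp only [mem_filter, mem_image, Prod.exists, hE]
    constructor
    · rintro ⟨hx, hPx⟩
      refine ⟨ω x w, - ω x v, ?_⟩
      have : x = ω x w • v + (-ω x v) • w := by
        nth_rewrite 1 [← hPx]
        simp only [hP]; module
      rw [← this]
      exact ⟨hx, rfl⟩
    · rintro ⟨a, b, h, rfl⟩
      exact ⟨h, hPP a b⟩
  let C : Finset (F × F) := (univ.erase (0, 0)) \ E
  let K : Finset V := ({p : V | ω p v = 0 ∧ ω p w = 0} : Finset V).erase 0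
  have hE0 : E ⊆ univ.erase (0, 0) := by
    rintro ⟨a, b⟩ h
    refine mem_erase.2 ⟨?_, mem_univ _⟩
    rintro h'
    rw [h', hE] at h
    exact h0 (by simpa using h)
  have hC : #C = Fintype.card F ^ 2 - 1 - #E := by
    rw [card_sdiff_of_subset hE0, card_erase_of_mem (mem_univ _), Finset.card_univ,
      Fintype.card_prod, sq]
  have hK : #K = Fintype.card F ^ 2 - 1 := by
    rw [card_erase_of_mem (by simp), card_filter_perp_pair hω (by rw [hvw]; exact one_ne_zero)]
  have hle := card_le_card_of_injOn (s := S' ×ˢ (univ.erase (0 : F))) (t := C ×ˢ K)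
    (fun z => ((ω z.1 w, -ω z.1 v), z.2 • (z.1 - P z.1))) ?_ ?_
  · rw [card_product, card_product, hC, hK, card_erase_of_mem (mem_univ _), Finset.card_univ] at hle
    rwa [hcard, Nat.add_sub_cancel]
  · rintro ⟨x, c⟩ hx
    simp only [coe_product, Set.mem_prod, mem_coe, mem_filter, S', mem_erase, mem_univ,
      and_true] at hx
    obtain ⟨⟨hx, hPx⟩, hc⟩ := hx
    have hPx' : ω x w • v + (-ω x v) • w = P x := by simp only [hP]; module
    simp only [coe_product, Set.mem_prod, mem_coe, C, K, mem_sdiff, mem_erase, mem_univ, mem_filter,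
      and_true, hE, hPx', map_smul, LinearMap.smul_apply, hpv, hpw, smul_zero,
      and_self]
    refine ⟨⟨?_, ?_⟩, smul_ne_zero hc (sub_ne_zero.2 (Ne.symm hPx))⟩
    · intro h
      have hxv : ω x v = 0 := by simpa using congrArg Prod.snd h
      obtain ⟨d, rfl⟩ := hS v hv x hx hxv
      apply hPx
      have := hPP d 0
      simpa using this
    · intro h
      have h1 : ω (P x) x = 0 := by
        rw [hsub, show P (P x) = P x by rw [← hPx', hPP]]
        simp [hω.self_eq_zero]
      obtain ⟨d, hd⟩ := hS x hx (P x) h h1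
      apply hPx
      have h2 : P (P x) = P x := by rw [← hPx', hPP]
      rw [hd, hPmul, hd, smul_smul] at h2
      have hx0 : x ≠ 0 := by rintro rfl; exact h0 hx
      have h3 := smul_left_injective F hx0 h2
      have hd0 : d ≠ 0 := by
        rintro rfl
        rw [hd, zero_smul] at h
        exact h0 h
      have h4 : d = 1 := by
        have h3 : d * d = d := h3
        exact mul_left_cancel₀ hd0 (by rw [h3, mul_one])
      rw [hd, h4, one_smul]
  · rintro ⟨x, c⟩ hx ⟨x', c'⟩ hx' h
    simp only [coe_product, Set.mem_prod, mem_coe, mem_filter, S', mem_erase, mem_univ,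
      and_true] at hx hx'
    obtain ⟨⟨hx, hPx⟩, hc⟩ := hx
    obtain ⟨⟨hx', hPx'⟩, hc'⟩ := hx'
    simp only [Prod.mk.injEq, neg_inj] at h
    obtain ⟨⟨e1, e2⟩, e3⟩ := h
    have hPe : P x = P x' := by simp only [hP, e1, e2]
    have hk : x - P x = (c⁻¹ * c') • (x' - P x') := by
      rw [mul_smul, ← e3, inv_smul_smul₀ hc]
    have hperp : ω x' x = 0 := by
      rw [hsub, hk, hPe]
      simp [hω.self_eq_zero, -map_sub, -LinearMap.sub_apply]
    obtain ⟨d, rfl⟩ := hS x hx x' hx' hperp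
    have hPx0 : P x ≠ 0 := by
      intro hz
      have h1 : ω x v = 0 := by
        have := hpv x
        rwa [hz, sub_zero] at this
      obtain ⟨f, rfl⟩ := hS v hv x hx h1
      apply hPx
      have := hPP f 0
      simpa using this
    have hd : d = 1 := by
      rw [hPmul] at hPe
      have : (1 : F) • P x = d • P x := by rw [one_smul]; exact hPe
      exact (smul_left_injective F hPx0 this).symm
    subst hd
    rw [one_smul] at e3 ⊢
    have : c = c' := smul_left_injective F (sub_ne_zero.2 (Ne.symm hPx)) e3
    rw [this]

variable [CharP F 3]

namespace RegularUnipotentData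

theorem two_mul_card_cone (D : RegularUnipotentData ω H u v) :
    ∃ j, j % 3 = 2 ∧
      2 * #(cone H v) = (Fintype.card F ^ 2 + 1) * (Fintype.card F - 1) * j := by
  obtain ⟨j, hj⟩ := D.exists_card_cone_eq
  have h3 := D.card_cone_mod_three
  obtain ⟨h4, k, hk⟩ := card_mod_four (F := F)
  have hpos := Fintype.card_pos (α := F)
  have e : 2 * ((Fintype.card F ^ 2 + 1) / 2) = Fintype.card F ^ 2 + 1 := by omega
  have h2 : 2 * #(cone H v) = (Fintype.card F ^ 2 + 1) * (Fintype.card F - 1) * j := by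
    calc _ = 2 * ((Fintype.card F ^ 2 + 1) / 2) * (Fintype.card F - 1) * j := by rw [hj]; ring
      _ = _ := by rw [e]
  refine ⟨j, ?_, h2⟩
  obtain ⟨l, rfl⟩ : ∃ l, k = l + 1 := ⟨k - 1, by omega⟩
  rw [hk, show 3 * (l + 1) - 1 = 3 * l + 2 by omega, show
    ((3 * (l + 1)) ^ 2 + 1) * (3 * l + 2) * j =
      3 * ((3 * l ^ 2 + 6 * l + 3) * (3 * l + 2) * j + l * j) + 2 * j by ring] at h2
  omega

theorem three_le_card : 3 ≤ Fintype.card F := by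
  obtain ⟨k, hk⟩ := (card_mod_four (F := F)).2
  have hpos := Fintype.card_pos (α := F)
  omega

theorem le_card_cone (D : RegularUnipotentData ω H u v) :
    (Fintype.card F ^ 2 + 1) * (Fintype.card F - 1) ≤ #(cone H v) := by
  obtain ⟨j, hj, h⟩ := D.two_mul_card_cone
  have : (Fintype.card F ^ 2 + 1) * (Fintype.card F - 1) * 2 ≤
    (Fintype.card F ^ 2 + 1) * (Fintype.card F - 1) * j := Nat.mul_le_mul_left _ (by omega)
  omega

/-- The cone contains two distinct perpendicular points. -/
theorem exists_mem_cone_perp (D : RegularUnipotentData ω H u v) :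
    ∃ x ∈ cone H v, ω x v = 0 ∧ ¬ ∃ c : F, x = c • v := by
  classical
  by_contra! hno
  have hS : ∀ x ∈ cone H v, ∀ y ∈ cone H v, ω y x = 0 → ∃ c : F, y = c • x := by
    intro x hx y hy hyx
    obtain ⟨h0, h, hh, d, rfl⟩ := mem_cone.1 hx
    have hd : d ≠ 0 := by rintro rfl; simp at h0
    obtain ⟨y, rfl⟩ := h.surjective y
    rw [apply_mem_cone_iff hh] at hy
    rw [map_smul, D.preserves h hh] at hyx
    obtain ⟨c, rfl⟩ := hno y hy (by simpa [hd] using hyx)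
    exact ⟨c * d⁻¹, by rw [map_smul, mul_smul, inv_smul_smul₀ hd]⟩
  have h3 := three_le_card (F := F)
  have hN := D.le_card_cone
  have hv := self_mem_cone (H := H) D.ne_zero
  obtain ⟨q, hq⟩ : ∃ q, Fintype.card F = q + 1 := ⟨Fintype.card F - 1, by omega⟩
  obtain ⟨w, hw, hvw⟩ : ∃ w ∈ cone H v, ω v w = 1 := by
    by_contra! hall
    have hsub : cone H v ⊆ univ.image fun c : F => c • v := by
      intro x hx
      have hxv : ω x v = 0 := by
        by_contra hne
        refine hall ((ω v x)⁻¹ • x) (smul_mem_cone hx (inv_ne_zero ?_)) ?_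
        · rw [D.symp.swap]; simpa using hne
        · rw [map_smul, smul_eq_mul, inv_mul_cancel₀]
          rw [D.symp.swap]; simpa using hne
      obtain ⟨c, rfl⟩ := hno x hx hxv
      simp
    have := (card_le_card hsub).trans card_image_le
    rw [Finset.card_univ] at this
    rw [hq, Nat.add_sub_cancel] at hN
    rw [hq] at this h3
    nlinarith
  obtain ⟨α, hα, h, hh, hh'⟩ := D.exists_transvection
  have hwv : ω w v = -1 := by rw [D.symp.swap, hvw]
  have hcone : ∀ x ∈ cone H v, x + (α * ω x v) • v ∈ cone H v := by
    intro x hx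
    rw [← hh']
    exact apply_mem_cone hx hh
  have hw1 : w + (-α) • v ∈ cone H v := by simpa [hwv] using hcone w hw
  have hw2 : w + α • v ∈ cone H v := by
    have := hcone _ hw1
    simp only [map_add, map_smul, LinearMap.add_apply, LinearMap.smul_apply, hwv,
      D.symp.self_eq_zero] at this
    convert this using 1
    have h3 : (3 : F) = 0 := CharP.ofNat_eq_zero F 3
    rw [add_assoc, ← add_smul]
    congr 2
    linear_combination α * h3
  let E : Finset (F × F) := {z | z.1 • v + z.2 • w ∈ cone H v}
  have hE : ∀ z : F × F, z ∈ E ↔ z.1 • v + z.2 • w ∈ cone H v := by simp [E]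
  have key := card_le_of_pairwise_not_perp D.symp zero_notMem_cone hvw hS hE hv
  let E' : Finset F := univ.erase 0
  have hE' : #E' = q := by
    rw [card_erase_of_mem (mem_univ _), Finset.card_univ, hq, Nat.add_sub_cancel]
  have hle := card_le_card_of_injOn (s := E' ×ˢ (univ : Finset (Option (Fin 3)))) (t := E)
    (fun z => match z.2 with
      | none => (z.1, 0)
      | some i => (![0, z.1 * α, -(z.1 * α)] i, z.1)) ?_ ?_
  · rw [card_product, hE', Finset.card_univ, Fintype.card_option, Fintype.card_fin] at hle
    rw [hq, Nat.add_sub_cancel] at key hN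
    have hq2 : (q + 1) ^ 2 - 1 = q * (q + 2) := by
      rw [show (q + 1) ^ 2 = q * (q + 2) + 1 by ring, Nat.add_sub_cancel]
    have hqpos : 0 < q := by omega
    rw [hq2] at key
    have key' : #(cone H v) - #E ≤ (q * (q + 2) - #E) * (q + 2) := by
      apply Nat.le_of_mul_le_mul_right (c := q) _ hqpos
      refine key.trans (le_of_eq ?_)
      ring
    have hE2 : #E ≤ q * (q + 2) := by
      have : E ⊆ univ.erase (0, 0) := by
        intro z hz
        refine mem_erase.2 ⟨?_, mem_univ _⟩
        rintro rfl
        rw [hE] at hz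
        simp [zero_notMem_cone] at hz
      have := card_le_card this
      rwa [card_erase_of_mem (mem_univ _), Finset.card_univ, Fintype.card_prod, hq, ← sq, hq2]
        at this
    have h5 := tsub_le_iff_right.1 key'
    zify [hE2] at h5 hle hN hqpos
    nlinarith
  · rintro ⟨c, o⟩ hz
    simp only [coe_product, Set.mem_prod, mem_coe, E', mem_erase, mem_univ, and_true] at hz
    rcases o with _ | i
    · simpa [hE] using smul_mem_cone hv hz
    · have h1 := smul_mem_cone hw hz
      have h2 := smul_mem_cone hw2 hz
      have h3 := smul_mem_cone hw1 hz
      rw [mem_coe, hE]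
      fin_cases i
      · simpa using h1
      · simpa [smul_smul, add_comm] using h2
      · simpa [smul_smul, add_comm] using h3
  · have h2 : (2 : F) ≠ 0 := by
      intro h2
      have h3 : (3 : F) = 0 := CharP.ofNat_eq_zero F 3
      exact one_ne_zero (α := F) (by linear_combination h3 - h2)
    rintro ⟨c, o⟩ hz ⟨c', o'⟩ hz' heq
    simp only [coe_product, Set.mem_prod, mem_coe, E', mem_erase, mem_univ, and_true] at hz hz'
    have hc := hz
    have hc' := hz'
    have hne : ∀ d : F, d ≠ 0 → d * α ≠ - (d * α) := by
      intro d hd h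
      have : 2 * (d * α) = 0 := by linear_combination h
      simp [h2, hd, hα] at this
    rcases o with _ | i <;> rcases o' with _ | i'
    · simp only [Prod.mk.injEq, and_true] at heq; rw [heq]
    · simp only [Prod.mk.injEq] at heq; exact absurd heq.2.symm hc'
    · simp only [Prod.mk.injEq] at heq; exact absurd heq.2 hc
    · simp only [Prod.mk.injEq] at heq
      obtain ⟨e1, rfl⟩ := heq
      have := hne c hc
      have := this.symm
      fin_cases i <;> fin_cases i' <;> simp_all

end RegularUnipotentData

end PerpPoint

end SymplecticFour

namespace SymplecticFour

open LinearMap (BilinForm)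

section GoodLine

open Finset
open scoped Pointwise

variable {F V : Type*} [Field F] [AddCommGroup V] [Module F V]
variable {ω : BilinForm F V} {H : Subgroup (V ≃ₗ[F] V)} {v : V} {u : V ≃ₗ[F] V}

theorem smul_span_pair (h : V ≃ₗ[F] V) (x y : V) :
    h • Submodule.span F {x, y} = Submodule.span F {h x, h y} := by
  rw [Submodule.smul_span]
  congr 1
  exact Set.image_pair _ _ _

theorem span_pair_eq_of_mem {v x z : V} (hz : z ∈ Submodule.span F {v, x})
    (hzv : ¬ ∃ c : F, z = c • v) : Submodule.span F {v, z} = Submodule.span F {v, x} := by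
  apply le_antisymm
  · rw [Submodule.span_le]
    rintro y (rfl | rfl)
    · exact Submodule.subset_span (by simp)
    · exact hz
  · rw [Submodule.mem_span_pair] at hz
    obtain ⟨a, b, rfl⟩ := hz
    have hb : b ≠ 0 := by
      rintro rfl
      exact hzv ⟨a, by simp⟩
    rw [Submodule.span_le]
    rintro y (rfl | rfl)
    · exact Submodule.subset_span (by simp)
    · refine Submodule.mem_span_pair.2 ⟨-(b⁻¹ * a), b⁻¹, ?_⟩
      rw [smul_add, smul_smul b⁻¹ b, inv_mul_cancel₀ hb]
      module

theorem linearIndependent_of_not_smul {v x : V} (hv : v ≠ 0) (hx : ¬ ∃ c : F, x = c • v) :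
    LinearIndependent F ![v, x] := by
  rw [LinearIndependent.pair_iff]
  intro s t h
  have ht : t = 0 := by
    by_contra ht
    refine hx ⟨-(t⁻¹ * s), ?_⟩
    have : x = t⁻¹ • (t • x) := by rw [inv_smul_smul₀ ht]
    rw [this, eq_neg_of_add_eq_zero_right h]
    module
  subst ht
  simpa [hv] using h

theorem finrank_span_pair {v x : V} (hv : v ≠ 0) (hx : ¬ ∃ c : F, x = c • v) :
    Module.finrank F (Submodule.span F {v, x}) = 2 := by
  have := finrank_span_eq_card (linearIndependent_of_not_smul hv hx)
  rw [Matrix.range_cons_cons_empty] at this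
  simpa using this

open scoped Classical in
theorem three_mul_le_card_filter_mem_span [Fintype F] {S : Finset V} {x : V} {b : F} (hv0 : v ≠ 0)
    (hxn : ¬ ∃ c : F, x = c • v) (hb : b ≠ 0) (hS : ∀ y ∈ S, ∀ c : F, c ≠ 0 → c • y ∈ S)
    (hv : v ∈ S) (hx : x ∈ S) (hy : x + b • v ∈ S) :
    3 * (Fintype.card F - 1) ≤ #{y ∈ S | y ∈ Submodule.span F {v, x}} := by
  have hli := LinearIndependent.pair_iff.1 (linearIndependent_of_not_smul hv0 hxn)
  let f : Fin 3 × F → V := fun z => (z.2 * ![1, 0, b] z.1) • v + (z.2 * ![0, 1, 1] z.1) • x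
  have hle := card_le_card_of_injOn (s := (univ : Finset (Fin 3)) ×ˢ univ.erase (0 : F))
    (t := {y ∈ S | y ∈ Submodule.span F {v, x}}) f ?_ ?_
  · rwa [card_product, card_erase_of_mem (mem_univ _), Finset.card_univ, Finset.card_univ,
      Fintype.card_fin] at hle
  · rintro ⟨i, c⟩ hc
    simp only [coe_product, Set.mem_prod, mem_coe, mem_erase, mem_univ, and_true, true_and] at hc
    refine mem_coe.2 (mem_filter.2 ⟨?_, Submodule.mem_span_pair.2 ⟨_, _, rfl⟩⟩)
    fin_cases i
    · simpa [f] using hS v hv c hc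
    · simpa [f] using hS x hx c hc
    · convert hS _ hy c hc using 1
      simp only [f, Fin.reduceFinMk, Matrix.cons_val]
      module
  · rintro ⟨i, c⟩ hc ⟨i', c'⟩ hc' heq
    simp only [coe_product, Set.mem_prod, mem_coe, mem_erase, mem_univ, and_true, true_and]
      at hc hc'
    obtain ⟨h1, h2⟩ := hli (c * ![1, 0, b] i - c' * ![1, 0, b] i')
      (c * ![0, 1, 1] i - c' * ![0, 1, 1] i') (by
        rw [sub_smul, sub_smul, sub_add_sub_comm]
        exact sub_eq_zero.2 heq)
    fin_cases i <;> fin_cases i' <;>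
      simp [hb, hc, hc', sub_eq_zero] at h1 h2 ⊢ <;> assumption

theorem orbit_count_arith {q N n : ℕ} (h3 : 3 ≤ q) (h4 : q ^ 2 % 4 = 1)
    (hup : N * (q ^ 3 - q ^ 2) * (q + 1) ≤ (q ^ 4 - 1) * (q ^ 3 - q))
    (hn : (q ^ 2 + 1) / 2 ≤ n) (hlow : n * (3 * (q - 1)) ≤ N) : False := by
  obtain ⟨s, rfl⟩ : ∃ s, q = s + 1 := ⟨q - 1, by omega⟩
  have hs : 0 < s := by omega
  have e1 : (s + 1) ^ 3 - (s + 1) ^ 2 = (s + 1) ^ 2 * s := by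
    rw [show (s + 1) ^ 3 = (s + 1) ^ 2 * s + (s + 1) ^ 2 by ring, Nat.add_sub_cancel]
  have e2 : (s + 1) ^ 4 - 1 = ((s + 1) ^ 2 + 1) * (s * (s + 2)) := by
    rw [show (s + 1) ^ 4 = ((s + 1) ^ 2 + 1) * (s * (s + 2)) + 1 by ring, Nat.add_sub_cancel]
  have e3 : (s + 1) ^ 3 - (s + 1) = (s + 1) * (s * (s + 2)) := by
    rw [show (s + 1) ^ 3 = (s + 1) * (s * (s + 2)) + (s + 1) by ring, Nat.add_sub_cancel]
  rw [e1, e2, e3] at hup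
  rw [Nat.add_sub_cancel] at hlow
  have h5 : (s + 1) ^ 2 + 1 ≤ 2 * n := by omega
  have h6 : N * (s + 1) ≤ ((s + 1) ^ 2 + 1) * (s * (s + 2)) := by
    refine Nat.le_of_mul_le_mul_right (c := (s + 1) * (s * (s + 2))) ?_ (by positivity)
    refine le_trans (le_of_eq ?_) hup
    ring
  have h7 : ((s + 1) ^ 2 + 1) * (3 * s) ≤ 2 * N := by
    have := Nat.mul_le_mul_right (3 * s) h5
    linarith
  have h8 : ((s + 1) ^ 2 + 1) * (3 * s) * (s + 1) ≤ 2 * (((s + 1) ^ 2 + 1) * (s * (s + 2))) := by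
    have := Nat.mul_le_mul_right (s + 1) h7
    linarith
  have h9 : 3 * (s + 1) ≤ 2 * (s + 2) := by
    refine Nat.le_of_mul_le_mul_right (c := ((s + 1) ^ 2 + 1) * s) ?_ (by positivity)
    refine le_trans (le_of_eq ?_) (h8.trans (le_of_eq ?_)) <;> ring
  omega

variable [Fintype F] [Fintype V] [CharP F 3]

namespace RegularUnipotentData

theorem exists_mem_cone_fixed_line (D : RegularUnipotentData ω H u v) :
    ∃ x ∈ cone H v, ω x v = 0 ∧ (¬ ∃ c : F, x = c • v) ∧
      u • Submodule.span F {v, x} = Submodule.span F {v, x} := by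
  classical
  have hH := D.preserves
  let G : Finset V := {x ∈ cone H v | ω x v = 0 ∧ ¬ ∃ c : F, x = c • v}
  let X : Finset (Submodule F V) := G.image fun x => Submodule.span F {v, x}
  have hmap : ∀ h ∈ H, h v = v → ∀ W ∈ X, h • W ∈ X := by
    intro h hh hv W hW
    obtain ⟨x, hx, rfl⟩ := mem_image.1 hW
    obtain ⟨hx, hxv, hxn⟩ := mem_filter.1 hx
    refine mem_image.2 ⟨h x, mem_filter.2 ⟨apply_mem_cone hx hh, ?_, ?_⟩, ?_⟩
    · nth_rewrite 1 [← hv]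
      rw [hH h hh, hxv]
    · rintro ⟨c, hc⟩
      refine hxn ⟨c, h.injective ?_⟩
      rw [hc, map_smul, hv]
    · rw [smul_span_pair, hv]
  have := Fact.mk Nat.prime_three
  have hcount : ∀ h ∈ H, h v = v → (∃ n, h ^ 3 ^ n = 1) →
      #X ≡ #{W ∈ X | h • W = W} [MOD 3] := by
    rintro h hh hv ⟨n, hn⟩
    exact card_modEq_card_filter_fixed X (fun W => h • W) (hmap h hh hv) (n := n)
      fun W _ => by rw [smul_iterate, hn]; exact one_smul _ W
  obtain ⟨x, hx, hxv, hxn⟩ := D.exists_mem_cone_perp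
  obtain ⟨α, hα, h, hh, hh'⟩ := D.exists_transvection_of_mem_cone hx
  have hvx := D.symp.swap_eq_zero hxv
  have hhv : h v = v := by rw [hh', hvx]; simp
  have hh3 : h ^ 3 ^ 1 = 1 := by
    ext z
    have h3 : (3 : F) = 0 := CharP.ofNat_eq_zero F 3
    rw [pow_one, pow_succ, pow_two]
    simp only [LinearEquiv.mul_apply, hh', map_add, map_smul, LinearMap.add_apply,
      LinearMap.smul_apply, D.symp.self_eq_zero, smul_eq_mul, mul_zero, zero_smul, add_zero]
    rw [add_assoc, add_assoc, ← add_smul, ← add_smul,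
      show α * ω z x + (α * ω z x + α * ω z x) = 0 by linear_combination (α * ω z x) * h3]
    simp
  have hone : ({W ∈ X | h • W = W} : Finset _) = {Submodule.span F {v, x}} := by
    ext W
    simp only [mem_filter, mem_singleton]
    constructor
    · rintro ⟨hW, hfix⟩
      obtain ⟨z, hz, rfl⟩ := mem_image.1 hW
      obtain ⟨hz, hzv, hzn⟩ := mem_filter.1 hz
      have hzx : ω z x = 0 := by
        by_contra hne
        have h1 : h z ∈ Submodule.span F {v, z} := by
          rw [smul_span_pair, hhv] at hfix
          rw [← hfix]
          exact Submodule.subset_span (by simp)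
        rw [hh', Submodule.mem_span_pair] at h1
        obtain ⟨a, b, hab⟩ := h1
        have h2 := congrArg (fun y => ω z y) hab
        simp [D.symp.self_eq_zero, hzv, hα, hne] at h2
      obtain ⟨a, b, hab⟩ := D.symp.mem_span_pair_of_orthogonal
        (linearIndependent_of_not_smul D.ne_zero hxn) hxv hzv hzx
      exact span_pair_eq_of_mem (Submodule.mem_span_pair.2 ⟨a, b, hab.symm⟩) hzn
    · rintro rfl
      refine ⟨mem_image.2 ⟨x, mem_filter.2 ⟨hx, hxv, hxn⟩, rfl⟩, ?_⟩
      rw [smul_span_pair, hhv, hh', D.symp.self_eq_zero]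
      simp
  have h1 := hcount h hh hhv ⟨1, hh3⟩
  have h2 := hcount u D.mem D.apply_self D.exists_pow
  rw [hone, card_singleton] at h1
  have h3 : #{W ∈ X | u • W = W} ≠ 0 := by
    intro h3
    rw [h3] at h2
    have := h1.symm.trans h2
    simp [Nat.ModEq] at this
  obtain ⟨W, hW⟩ := card_ne_zero.1 h3
  obtain ⟨hW, hfix⟩ := mem_filter.1 hW
  obtain ⟨z, hz, rfl⟩ := mem_image.1 hW
  obtain ⟨hz, hzv, hzn⟩ := mem_filter.1 hz
  exact ⟨z, hz, hzv, hzn, hfix⟩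

theorem exists_mem_cone_translate (D : RegularUnipotentData ω H u v) :
    ∃ x ∈ cone H v, ω x v = 0 ∧ (¬ ∃ c : F, x = c • v) ∧ ∃ b ≠ (0 : F), u x = x + b • v := by
  obtain ⟨x, hx, hxv, hxn, hfix⟩ := D.exists_mem_cone_fixed_line
  refine ⟨x, hx, hxv, hxn, ?_⟩
  have h1 : u x ∈ Submodule.span F {v, x} := by
    rw [smul_span_pair, D.apply_self] at hfix
    rw [← hfix]
    exact Submodule.subset_span (by simp)
  obtain ⟨a, c, hac⟩ := Submodule.mem_span_pair.1 h1
  obtain ⟨n, hn⟩ := D.exists_pow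
  have hpow : ∀ k : ℕ, ∃ d : F, (u ^ k) x = d • v + c ^ k • x := by
    intro k
    induction k with
    | zero => exact ⟨0, by simp⟩
    | succ k ih =>
      obtain ⟨d, hd⟩ := ih
      refine ⟨d + c ^ k * a, ?_⟩
      rw [pow_succ', LinearEquiv.mul_apply, hd, map_add, map_smul, map_smul, D.apply_self, ← hac]
      module
  obtain ⟨d, hd⟩ := hpow (3 ^ n)
  rw [hn, show (1 : V ≃ₗ[F] V) x = x from rfl] at hd
  have hli := LinearIndependent.pair_iff.1 (linearIndependent_of_not_smul D.ne_zero hxn)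
    d (c ^ 3 ^ n - 1) (by rw [sub_smul, one_smul, ← add_sub_assoc, ← hd, sub_self])
  have := Fact.mk Nat.prime_three
  have hc : c = 1 := by
    have h2 : (c - 1) ^ 3 ^ n = 0 := by rw [sub_pow_char_pow, one_pow, hli.2]
    exact sub_eq_zero.1 (eq_zero_of_pow_eq_zero h2)
  rw [hc, one_smul] at hac
  refine ⟨a, ?_, by rw [← hac, add_comm]⟩
  rintro rfl
  refine hxn (D.fixed x ?_)
  rw [← hac, zero_smul, zero_add]

omit [CharP F 3] in
/-- A point `x₂` of the cone for which some Siegel transformation `R(v, b x₂)` lies in `H`. -/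
theorem exists_siegel (D : RegularUnipotentData ω H u v) {x : V} (hx : x ∈ cone H v)
    (hxv : ω x v = 0) {b : F} (hb : b ≠ 0) (hux : u x = x + b • v) :
    ∃ c ≠ (0 : F), ∃ β, HasSiegel ω H v (c • x) β := by
  obtain ⟨α, hα, hT⟩ := D.exists_transvection_of_mem_cone hx
  have h1 := hT.conj D.preserves D.mem
  rw [hux] at h1
  exact ⟨α * b, mul_ne_zero hα hb, _, HasSiegel.of_transvections D.symp hxv h1 hT⟩

theorem exists_mem_cone_not_perp (D : RegularUnipotentData ω H u v) {x : V} (hx : x ∈ cone H v)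
    (hxv : ω x v = 0) (hxn : ¬ ∃ c : F, x = c • v) {b : F} (hb : b ≠ 0) (hux : u x = x + b • v) :
    ∃ z ∈ cone H v, ω z v = 0 ∧ ω z x ≠ 0 := by
  classical
  by_contra! hno
  have hH := D.preserves
  have hv := self_mem_cone (H := H) D.ne_zero
  have hvx := D.symp.swap_eq_zero hxv
  set ℓ : Submodule F V := Submodule.span F {v, x} with hℓ
  have hmem : ∀ z ∈ cone H v, ω z v = 0 → z ∈ ℓ := by
    intro z hz hzv
    obtain ⟨a, c, hac⟩ := D.symp.mem_span_pair_of_orthogonal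
      (linearIndependent_of_not_smul D.ne_zero hxn) hxv hzv (hno z hz hzv)
    exact Submodule.mem_span_pair.2 ⟨a, c, hac.symm⟩
  have hℓ2 : Module.finrank F ℓ = 2 := finrank_span_pair D.ne_zero hxn
  have hℓv : ∀ p ∈ ℓ, ω p v = 0 := by
    intro p hp
    obtain ⟨a, c, rfl⟩ := Submodule.mem_span_pair.1 hp
    simp [hxv, D.symp.self_eq_zero]
  -- the upper bound for the cone
  have hB : Fintype.card F ^ 3 - Fintype.card F ^ 2 ≤ #{p : V | IsTangent ω H v v p} := by
    rw [← card_filter_perp D.symp D.ne_zero, ← hℓ2, ← card_filter_mem, ← card_sdiff_of_subset]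
    · refine card_le_card fun p hp => ?_
      simp only [mem_sdiff, mem_filter, mem_univ, true_and] at hp ⊢
      refine ⟨hp.1, fun a c hac => ?_⟩
      by_contra hc
      have h1 := hmem _ hac (by simp [hp.1, D.symp.self_eq_zero])
      have h2 : c • p ∈ ℓ := by
        refine (Submodule.add_mem_iff_right _ ?_).1 h1
        exact ℓ.smul_mem _ (Submodule.subset_span (by simp))
      exact hp.2 ((Submodule.smul_mem_iff _ hc).1 h2)
    · intro p hp
      simp only [mem_filter, mem_univ, true_and] at hp ⊢
      exact hℓv p hp
  have hup := card_cone_mul_le D.symp hH hB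
  -- the lower bound, by counting the lines in the orbit of `ℓ`
  let X : Finset (Submodule F V) := (Set.toFinite {W | ∃ h ∈ H, W = h • ℓ}).toFinset
  have hX : ∀ W, W ∈ X ↔ ∃ h ∈ H, W = h • ℓ := by simp [X]
  have hXfin : ∀ W ∈ X, Module.finrank F W = 2 := by
    intro W hW
    obtain ⟨h, hh, rfl⟩ := (hX W).1 hW
    rw [← hℓ2]
    exact LinearEquiv.finrank_map_eq h ℓ
  have hdvd : (Fintype.card F ^ 2 + 1) / 2 ∣ #X := by
    refine D.dvd_of_free X ?_ ?_
    · intro h hh W hW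
      obtain ⟨k, hk, rfl⟩ := (hX W).1 hW
      exact (hX _).2 ⟨h * k, H.mul_mem hh hk, by rw [mul_smul]⟩
    · intro r hr hr2 hrd g hg W hW
      have h2 := hXfin W hW
      refine smul_submodule_ne_self_of_orderOf D.symp.finrank_eq hr hr2 hrd hg ?_ ?_
      · rintro rfl; simp at h2
      · rintro rfl; simp [D.symp.finrank_eq] at h2
  have hXne : X.Nonempty := ⟨ℓ, (hX _).2 ⟨1, H.one_mem, by simp⟩⟩
  have hXcard : (Fintype.card F ^ 2 + 1) / 2 ≤ #X :=
    Nat.le_of_dvd (card_pos.2 hXne) hdvd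
  let T : Submodule F V → Finset V := fun W => {y ∈ cone H v | y ∈ W}
  have hTℓ : 3 * (Fintype.card F - 1) ≤ #(T ℓ) :=
    three_mul_le_card_filter_mem_span D.ne_zero hxn hb (fun y hy c hc => smul_mem_cone hy hc) hv hx
      (hux ▸ apply_mem_cone hx D.mem)
  have hTle : ∀ W ∈ X, 3 * (Fintype.card F - 1) ≤ #(T W) := by
    intro W hW
    obtain ⟨h, hh, rfl⟩ := (hX W).1 hW
    refine hTℓ.trans (card_le_card_of_injOn h ?_ h.injective.injOn)
    intro y hy
    obtain ⟨hy, hyℓ⟩ := mem_filter.1 hy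
    exact mem_coe.2 (mem_filter.2
      ⟨apply_mem_cone hy hh, Submodule.smul_mem_pointwise_smul _ h _ hyℓ⟩)
  have hdet : ∀ W ∈ X, ∀ y ∈ T W, W = Submodule.span F {z | z ∈ cone H v ∧ ω z y = 0} := by
    intro W hW y hy
    have := D.symp.finiteDimensional
    obtain ⟨hy, hyW⟩ := mem_filter.1 hy
    refine Submodule.eq_of_le_of_finrank_le ?_ ?_
    · obtain ⟨h, hh, rfl⟩ := (hX W).1 hW
      obtain ⟨y, rfl⟩ := h.surjective y
      have hyℓ : y ∈ ℓ := by
        obtain ⟨y', hy', e⟩ := hyW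
        rw [← h.injective e]
        exact hy'
      rw [hℓ, smul_span_pair, Submodule.span_le]
      obtain ⟨a, c, rfl⟩ := Submodule.mem_span_pair.1 hyℓ
      rintro z (rfl | rfl)
      · refine Submodule.subset_span ⟨apply_mem_cone hv hh, ?_⟩
        rw [hH h hh]
        simp [hvx, D.symp.self_eq_zero]
      · refine Submodule.subset_span ⟨apply_mem_cone hx hh, ?_⟩
        rw [hH h hh]
        simp [hxv, D.symp.self_eq_zero]
    · rw [hXfin W hW]
      obtain ⟨h0, k, hk, c, rfl⟩ := mem_cone.1 hy
      have hc : c ≠ 0 := by rintro rfl; simp at h0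
      calc _ ≤ Module.finrank F (k • ℓ : Submodule F V) := by
            refine Submodule.finrank_mono (Submodule.span_le.2 ?_)
            rintro z ⟨hz, hzk⟩
            obtain ⟨z, rfl⟩ := k.surjective z
            rw [apply_mem_cone_iff hk] at hz
            rw [map_smul, hH k hk] at hzk
            refine Submodule.smul_mem_pointwise_smul _ k _ (hmem z hz (by simpa [hc] using hzk))
        _ = 2 := hXfin _ ((hX _).2 ⟨k, hk, rfl⟩)
  have hlow : #X * (3 * (Fintype.card F - 1)) ≤ #(cone H v) := by
    calc _ ≤ ∑ W ∈ X, #(T W) := by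
          rw [← smul_eq_mul]
          exact card_nsmul_le_sum _ _ _ hTle
      _ = #(X.biUnion T) := by
          rw [card_biUnion]
          intro W hW W' hW' hne
          rw [Function.onFun, disjoint_left]
          intro y hy hy'
          exact hne ((hdet W hW y hy).trans (hdet W' hW' y hy').symm)
      _ ≤ _ := card_le_card (biUnion_subset.2 fun W _ => filter_subset _ _)
  exact orbit_count_arith three_le_card (card_mod_four (F := F)).1 hup hXcard hlow

end RegularUnipotentData

end GoodLine

end SymplecticFour

namespace SymplecticFour

open LinearMap (BilinForm)

section Multiplier

open Finset
open scoped Pointwise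

variable {F V : Type*} [Field F] [AddCommGroup V] [Module F V]
variable {ω : BilinForm F V} {H : Subgroup (V ≃ₗ[F] V)} {v : V} {u : V ≃ₗ[F] V}

/-- The multipliers of the additive group of all `α` such that `H` contains the transvection
with centre `v` and parameter `α`. -/
def multiplierField [Fintype F] (hω : IsSymplecticFour ω) (H : Subgroup (V ≃ₗ[F] V)) (v : V) :
    Subfield F where
  carrier := {κ | ∀ α, HasTransvection ω H v α → HasTransvection ω H v (κ * α)}
  mul_mem' := fun {a b} ha hb α hα => by rw [mul_assoc]; exact ha _ (hb _ hα)
  one_mem' := fun α hα => by rwa [one_mul]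
  add_mem' := fun {a b} ha hb α hα => by rw [add_mul]; exact (ha _ hα).add hω (hb _ hα)
  zero_mem' := fun α _ => by rw [zero_mul]; exact HasTransvection.zero v
  neg_mem' := fun {a} ha α hα => by rw [neg_mul]; exact (ha _ hα).neg hω
  inv_mem' := fun a ha => by
    have hpow : ∀ n : ℕ, ∀ α, HasTransvection ω H v α → HasTransvection ω H v (a ^ n * α) := by
      intro n
      induction n with
      | zero => intro α hα; simpa using hα
      | succ n ih => intro α hα; rw [pow_succ, mul_assoc]; exact ih _ (ha _ hα)
    by_cases h0 : a = 0
    · simpa [h0] using ha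
    have h2 : 2 ≤ Fintype.card F := Fintype.one_lt_card
    have : a⁻¹ = a ^ (Fintype.card F - 2) := by
      rw [eq_comm, ← mul_eq_one_iff_eq_inv₀ h0, ← pow_succ,
        show Fintype.card F - 2 + 1 = Fintype.card F - 1 by omega,
        FiniteField.pow_card_sub_one_eq_one a h0]
    change ∀ α, HasTransvection ω H v α → HasTransvection ω H v (a⁻¹ * α)
    rw [this]
    exact hpow _

theorem mem_multiplierField [Fintype F] {hω : IsSymplecticFour ω} {κ : F} :
    κ ∈ multiplierField hω H v ↔
      ∀ α, HasTransvection ω H v α → HasTransvection ω H v (κ * α) := Iff.rfl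

/-- Some Siegel transformation with centre `v` and direction `b` lies in `H`. -/
def IsDirection (ω : BilinForm F V) (H : Subgroup (V ≃ₗ[F] V)) (v b : V) : Prop :=
  ω b v = 0 ∧ ∃ α, HasSiegel ω H v b α

theorem neg_two_eq_one [CharP F 3] : (-2 : F) = 1 := by
  have h3 : (3 : F) = 0 := CharP.ofNat_eq_zero F 3
  linear_combination -h3

namespace IsDirection

theorem add (hω : IsSymplecticFour ω) {b b' : V} (hb : IsDirection ω H v b)
    (hb' : IsDirection ω H v b') : IsDirection ω H v (b + b') := by
  obtain ⟨h1, α, h2⟩ := hb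
  obtain ⟨h1', α', h2'⟩ := hb'
  exact ⟨by simp [h1, h1'], _, h2.add hω h1 h1' h2'⟩

theorem neg (hω : IsSymplecticFour ω) {b : V} (hb : IsDirection ω H v b) :
    IsDirection ω H v (-b) := by
  obtain ⟨h1, α, h2⟩ := hb
  exact ⟨by simp [h1], _, h2.neg hω h1⟩

theorem transvection [CharP F 3] (hω : IsSymplecticFour ω) {b b' : V}
    (hb : IsDirection ω H v b) (hb' : IsDirection ω H v b') : HasTransvection ω H v (ω b b') := by
  obtain ⟨h1, α, h2⟩ := hb
  obtain ⟨h1', α', h2'⟩ := hb'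
  have := h2.commutator hω h1 h1' h2'
  rwa [hω.swap, mul_neg, ← neg_mul, neg_two_eq_one, one_mul] at this

theorem of_transvection (hω : IsSymplecticFour ω) (hH : Preserves ω H) {b x : V} {α : F}
    (hb : IsDirection ω H v b) (hx : ω x v = 0) (hT : HasTransvection ω H x α) :
    IsDirection ω H v ((α * ω b x) • x) := by
  have h := hb
  obtain ⟨h1, β, h2⟩ := h
  have h3 : IsDirection ω H v (b + (α * ω b x) • x) :=
    ⟨by simp [h1, hx], β, h2.conj_transvection hH (hω.swap_eq_zero hx) hT⟩
  have h4 := h3.add hω (hb.neg hω)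
  rwa [add_neg_cancel_comm] at h4

theorem of_orbit (hω : IsSymplecticFour ω) (hH : Preserves ω H) {b : V} {α : F}
    {h : V ≃ₗ[F] V} (hh : h ∈ H) (hb : IsDirection ω H v b) (hx : ω (h v) v = 0)
    (hT : HasTransvection ω H v α) : IsDirection ω H v ((α * ω b (h v)) • h v) :=
  hb.of_transvection hω hH hx (hT.conj hH hh)

theorem mul_mem_multiplierField [CharP F 3] [Fintype F] (hω : IsSymplecticFour ω)
    (hH : Preserves ω H) {b b' : V} {h : V ≃ₗ[F] V} (hh : h ∈ H) (hb : IsDirection ω H v b)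
    (hb' : IsDirection ω H v b') (hx : ω (h v) v = 0) :
    ω b (h v) * ω b' (h v) ∈ multiplierField hω H v := by
  rw [mem_multiplierField]
  intro α hα
  have h1 := ((hb.of_orbit hω hH hh hx hα).transvection hω hb').neg hω
  convert h1 using 1
  rw [map_smul, LinearMap.smul_apply, hω.swap b' (h v), smul_eq_mul]
  ring

end IsDirection

/-- Two points of the orbit of `v` perpendicular to `v`, but not to each other, one of which is the
direction of some Siegel transformation with centre `v` in `H`. -/
structure IsFrame (ω : BilinForm F V) (H : Subgroup (V ≃ₗ[F] V)) (v x₁ x₂ : V) (c : F) : Prop where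
  ne_zero : v ≠ 0
  fst_mem : ∃ h ∈ H, x₁ = h v
  snd_mem : ∃ h ∈ H, x₂ = h v
  fst_perp : ω x₁ v = 0
  snd_perp : ω x₂ v = 0
  not_perp : ω x₂ x₁ ≠ 0
  scalar_ne_zero : c ≠ 0
  isDirection : IsDirection ω H v (c • x₂)
  exists_transvection : ∃ α ≠ 0, HasTransvection ω H v α

theorem exists_orbit_of_mem_cone [Fintype F] [Fintype V] {x : V} (hx : x ∈ cone H v) :
    ∃ c ≠ (0 : F), ∃ h ∈ H, x = c • h v := by
  obtain ⟨h0, h, hh, c, rfl⟩ := mem_cone.1 hx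
  exact ⟨c, by rintro rfl; simp at h0, h, hh, rfl⟩

theorem RegularUnipotentData.exists_isFrame [CharP F 3] [Fintype F] [Fintype V]
    (D : RegularUnipotentData ω H u v) : ∃ x₁ x₂ c, IsFrame ω H v x₁ x₂ c := by
  obtain ⟨x₂, h₂, hv₂, hn₂, b, hb, hu⟩ := D.exists_mem_cone_translate
  obtain ⟨x₁, h₁, hv₁, h₁₂⟩ := D.exists_mem_cone_not_perp h₂ hv₂ hn₂ hb hu
  obtain ⟨c, hc, β, hβ⟩ := D.exists_siegel h₂ hv₂ hb hu
  obtain ⟨a₁, ha₁, g₁, hg₁, rfl⟩ := exists_orbit_of_mem_cone h₁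
  obtain ⟨a₂, ha₂, g₂, hg₂, rfl⟩ := exists_orbit_of_mem_cone h₂
  simp only [map_smul, LinearMap.smul_apply, smul_eq_mul, mul_eq_zero, ha₁, ha₂, false_or,
    ne_eq] at hv₁ hv₂ h₁₂
  exact ⟨g₁ v, g₂ v, c * a₂, D.ne_zero, ⟨g₁, hg₁, rfl⟩, ⟨g₂, hg₂, rfl⟩, hv₁, hv₂,
    fun h => h₁₂ (D.symp.swap_eq_zero h), mul_ne_zero hc ha₂,
    ⟨by simp [hv₂], β, by rwa [mul_smul]⟩, D.exists_transvection⟩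

namespace IsFrame

variable [CharP F 3] [Fintype F] {x₁ x₂ : V} {c : F}

omit [CharP F 3] [Fintype F] in
theorem isDirection_fst (hω : IsSymplecticFour ω) (hH : Preserves ω H)
    (hF : IsFrame ω H v x₁ x₂ c) {α : F} (hα : HasTransvection ω H v α) :
    IsDirection ω H v ((α * (c * ω x₂ x₁)) • x₁) := by
  obtain ⟨h, hh, e⟩ := hF.fst_mem
  have := hF.isDirection.of_orbit hω hH hh (e ▸ hF.fst_perp) hα
  rwa [← e, map_smul, LinearMap.smul_apply, smul_eq_mul] at this

omit [CharP F 3] [Fintype F] in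
theorem isDirection_snd (hω : IsSymplecticFour ω) (hH : Preserves ω H)
    (hF : IsFrame ω H v x₁ x₂ c) {α β : F} (hα : HasTransvection ω H v α)
    (hβ : HasTransvection ω H v β) :
    IsDirection ω H v ((α * β * c * ω x₂ x₁ ^ 2) • x₂) := by
  obtain ⟨h, hh, e⟩ := hF.snd_mem
  have := ((hF.isDirection_fst hω hH hα).of_orbit hω hH hh (e ▸ hF.snd_perp) hβ).neg hω
  rw [← e, map_smul, LinearMap.smul_apply, smul_eq_mul, hω.swap x₂ x₁, ← neg_smul] at this
  convert this using 2
  ring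

theorem sq_mem (hω : IsSymplecticFour ω) (hH : Preserves ω H)
    (hF : IsFrame ω H v x₁ x₂ c) : (c * ω x₂ x₁) ^ 2 ∈ multiplierField hω H v := by
  obtain ⟨h, hh, e⟩ := hF.fst_mem
  have := hF.isDirection.mul_mem_multiplierField hω hH hh hF.isDirection (e ▸ hF.fst_perp)
  rwa [← e, map_smul, LinearMap.smul_apply, smul_eq_mul, ← sq] at this

theorem mul_mem (hω : IsSymplecticFour ω) (hH : Preserves ω H)
    (hF : IsFrame ω H v x₁ x₂ c) {α β : F} (hα : HasTransvection ω H v α)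
    (hβ : HasTransvection ω H v β) :
    α * β * ω x₂ x₁ ^ 2 ∈ multiplierField hω H v := by
  have h1 : α * β * ω x₂ x₁ ^ 2 * (c * ω x₂ x₁) ^ 2 ∈ multiplierField hω H v := by
    rw [mem_multiplierField]
    intro δ hδ
    have := (hF.isDirection_snd hω hH hα hβ).transvection hω (hF.isDirection_fst hω hH hδ)
    simp only [map_smul, LinearMap.smul_apply, smul_eq_mul] at this
    convert this using 1
    ring
  have h2 := (multiplierField hω H v).mul_mem h1
    ((multiplierField hω H v).inv_mem (hF.sq_mem hω hH))
  rwa [mul_inv_cancel_right₀] at h2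
  exact pow_ne_zero _ (mul_ne_zero hF.scalar_ne_zero hF.not_perp)

/-- The good lines through `v` correspond to few values of `ω(x₁, x) / ω(x₂, x)`. -/
theorem ratio_mem (hω : IsSymplecticFour ω) (hH : Preserves ω H)
    (hF : IsFrame ω H v x₁ x₂ c) {α : F} (hα0 : α ≠ 0) (hα : HasTransvection ω H v α)
    {h : V ≃ₗ[F] V} (hh : h ∈ H) (hv : ω (h v) v = 0) (h0 : ω x₂ (h v) ≠ 0) :
    ω x₁ (h v) / ω x₂ (h v) / (α * ω x₂ x₁) ∈ multiplierField hω H v := by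
  have h1 := (hF.isDirection_snd hω hH hα hα).mul_mem_multiplierField hω hH hh
    (hF.isDirection_snd hω hH hα hα) hv
  have h2 := (hF.isDirection_fst hω hH hα).mul_mem_multiplierField hω hH hh
    (hF.isDirection_snd hω hH hα hα) hv
  have h3 := (multiplierField hω H v).div_mem h2 h1
  have := hF.not_perp
  have hc := hF.scalar_ne_zero
  simp only [map_smul, LinearMap.smul_apply, smul_eq_mul] at h3
  convert h3 using 1
  field_simp

open scoped Classical in
theorem card_isTangent_ge [Fintype V] (hω : IsSymplecticFour ω) (hH : Preserves ω H)
    (hF : IsFrame ω H v x₁ x₂ c) :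
    Fintype.card F * ((Fintype.card F - 1) *
      (Fintype.card F - Nat.card (multiplierField hω H v))) ≤ #{p : V | IsTangent ω H v v p} := by
  obtain ⟨α, hα0, hα⟩ := hF.exists_transvection
  set K := multiplierField hω H v
  set γ := ω x₂ x₁ with hγ
  have hγ0 : γ ≠ 0 := hF.not_perp
  have h12 : ω x₁ x₂ = -γ := hω.swap _ _
  have hv1 := hω.swap_eq_zero hF.fst_perp
  have hv2 := hω.swap_eq_zero hF.snd_perp
  have hle := card_le_card_of_injOn
    (s := (univ : Finset F) ×ˢ ((univ.erase (0 : F)) ×ˢ ({t : F | t ∉ K} : Finset F)))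
    (t := ({p : V | IsTangent ω H v v p} : Finset V))
    (fun z => z.1 • v + z.2.1 • x₁ - (z.2.1 * (α * γ * z.2.2)) • x₂) ?_ ?_
  · have hK : #({t : F | t ∉ K} : Finset F) = Fintype.card F - Nat.card K := by
      rw [filter_not, card_sdiff_of_subset (filter_subset _ _), Finset.card_univ]
      congr 1
      rw [← Fintype.card_subtype, ← Nat.card_eq_fintype_card]
    rwa [card_product, card_product, hK, card_erase_of_mem (mem_univ _), Finset.card_univ] at hle
  · rintro ⟨s, a, t⟩ hz
    simp only [coe_product, Set.mem_prod, mem_coe, mem_erase, mem_univ, and_true, true_and,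
      mem_filter] at hz
    obtain ⟨ha, ht⟩ := hz
    simp only [mem_coe, mem_filter, mem_univ, true_and]
    set p := s • v + a • x₁ - (a * (α * γ * t)) • x₂ with hp
    have hp1 : ω x₁ p = a * γ * (α * γ * t) := by
      simp [hp, hω.self_eq_zero, hF.fst_perp, h12]; ring
    have hp2 : ω x₂ p = a * γ := by
      simp [hp, hω.self_eq_zero, hF.snd_perp, ← hγ]
    have hpv : ω p v = 0 := by
      simp [hp, hω.self_eq_zero, hF.snd_perp, hF.fst_perp]
    refine ⟨hpv, fun r b hrb => ?_⟩
    by_contra hb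
    obtain ⟨d, hd, h, hh, e⟩ := exists_orbit_of_mem_cone hrb
    have e' : h v = d⁻¹ • (r • v + b • p) := by rw [e, inv_smul_smul₀ hd]
    have hh1 : ω x₁ (h v) = d⁻¹ * (b * (a * γ * (α * γ * t))) := by
      rw [e']; simp [hF.fst_perp, hp1]
    have hh2 : ω x₂ (h v) = d⁻¹ * (b * (a * γ)) := by
      rw [e']; simp [hF.snd_perp, hp2]
    have hhv : ω (h v) v = 0 := by
      rw [e']; simp [hω.self_eq_zero, hpv]
    have hne : ω x₂ (h v) ≠ 0 := by
      rw [hh2]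
      exact mul_ne_zero (inv_ne_zero hd) (mul_ne_zero hb (mul_ne_zero ha hγ0))
    have := hF.ratio_mem hω hH hα0 hα hh hhv hne
    rw [hh1, hh2, ← hγ] at this
    apply ht
    convert this using 1
    field_simp
  · rintro ⟨s, a, t⟩ hz ⟨s', a', t'⟩ hz' heq
    simp only [coe_product, Set.mem_prod, mem_coe, mem_erase, mem_univ, and_true, true_and,
      mem_filter] at hz hz'
    have h1 := congrArg (ω x₁) heq
    have h2 := congrArg (ω x₂) heq
    simp only [map_add, map_sub, map_smul, smul_eq_mul, hF.fst_perp, hF.snd_perp,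
      hω.self_eq_zero, h12, ← hγ, mul_zero, zero_add, add_zero, sub_zero, zero_sub, mul_neg,
      neg_neg] at h1 h2
    obtain rfl : a = a' := mul_right_cancel₀ hγ0 h2
    obtain rfl : t = t' := mul_left_cancel₀ (mul_ne_zero hα0 hγ0)
      (mul_left_cancel₀ hz.1 (mul_right_cancel₀ hγ0 h1))
    have h3 : s = s' := by
      simp only [sub_left_inj, add_left_inj] at heq
      exact smul_left_injective F hF.ne_zero heq
    rw [h3]

end IsFrame

end Multiplier

end SymplecticFour

namespace SymplecticFour

open LinearMap (BilinForm)

section MultiplierTop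

open Finset
open scoped Pointwise

theorem pow_dvd_card_of_le_orbit {F V : Type*} [Field F] [AddCommGroup V] [Module F V] {p a : ℕ}
    [Fact p.Prime] {Λ : Subgroup (V ≃ₗ[F] V)} (hΛ : IsPGroup p Λ) (X : Finset V)
    (hX : ∀ h ∈ Λ, ∀ x ∈ X, h x ∈ X)
    (horb : ∀ x ∈ X, ∃ S : Finset V, p ^ a ≤ #S ∧ ∀ y ∈ S, ∃ h ∈ Λ, y = h x) : p ^ a ∣ #X := by
  classical
  let Y : SubMulAction Λ V :=
    { carrier := X
      smul_mem' := fun h x hx => hX h h.2 x hx }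
  have : Finite Y := X.finite_toSet.to_subtype
  have hcard : Nat.card Y = #X := by
    change Nat.card (X : Set V) = _
    simp
  have hfin := Fintype.ofFinite (MulAction.orbitRel.Quotient Λ Y)
  rw [← hcard, Nat.card_congr (MulAction.selfEquivSigmaOrbits Λ Y), Nat.card_sigma]
  refine Finset.dvd_sum fun o _ => ?_
  obtain ⟨n, hn⟩ := hΛ.card_orbit o.out
  rw [hn]
  refine pow_dvd_pow p ?_
  rw [← Nat.pow_le_pow_iff_right (Fact.out : p.Prime).one_lt, ← hn]
  obtain ⟨S, hS, hS'⟩ := horb o.out.1 o.out.2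
  refine hS.trans ?_
  choose! g hg hgx using hS'
  have hfinO : Finite (MulAction.orbit Λ o.out) := inferInstance
  rw [← Nat.card_eq_finsetCard]
  refine Nat.card_le_card_of_injective
    (fun y : S => (⟨(⟨g y, hg y y.2⟩ : Λ) • o.out, ⟨_, rfl⟩⟩ : MulAction.orbit Λ o.out)) ?_
  intro y z hyz
  have := congrArg (fun t => ((t : Y) : V)) (Subtype.ext_iff.1 hyz)
  refine Subtype.ext ?_
  rw [hgx y y.2, hgx z z.2]
  exact this

variable {F V : Type*} [Field F] [AddCommGroup V] [Module F V]

/-- The elements of `H` which act trivially on the flag `0 ⊆ W ⊆ V`. -/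
def flagStabilizer (H : Subgroup (V ≃ₗ[F] V)) (W : Submodule F V) : Subgroup (V ≃ₗ[F] V) where
  carrier := {h | h ∈ H ∧ (∀ y ∈ W, h y = y) ∧ ∀ x, h x - x ∈ W}
  one_mem' := ⟨H.one_mem, fun _ _ => rfl, fun x => by simp⟩
  mul_mem' := by
    rintro g h ⟨hg, hg1, hg2⟩ ⟨hh, hh1, hh2⟩
    refine ⟨H.mul_mem hg hh, fun y hy => ?_, fun x => ?_⟩
    · rw [LinearEquiv.mul_apply, hh1 y hy, hg1 y hy]
    · rw [LinearEquiv.mul_apply, ← sub_add_sub_cancel _ (h x)]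
      exact W.add_mem (hg2 _) (hh2 _)
  inv_mem' := by
    rintro g ⟨hg, hg1, hg2⟩
    refine ⟨H.inv_mem hg, fun y hy => ?_, fun x => ?_⟩
    · have := g.symm_apply_apply y
      rwa [hg1 y hy] at this
    · have h1 := hg2 (g⁻¹ x)
      rw [show g (g⁻¹ x) = x from g.apply_symm_apply x] at h1
      rw [← neg_sub]
      exact W.neg_mem h1

theorem isPGroup_flagStabilizer [CharP F 3] (H : Subgroup (V ≃ₗ[F] V)) (W : Submodule F V) :
    IsPGroup 3 (flagStabilizer H W) := by
  rintro ⟨h, hh, h1, h2⟩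
  refine ⟨1, Subtype.ext (LinearEquiv.ext fun x => ?_)⟩
  have h3 : (3 : F) = 0 := CharP.ofNat_eq_zero F 3
  have e : h x = x + (h x - x) := by abel
  have e1 := h1 _ (h2 x)
  change h (h (h x)) = x
  set n := h x - x
  rw [e, map_add, e1, e, map_add, map_add, e1, e]
  have : x + n + n + n = x + (3 : F) • n := by module
  rw [this, h3, zero_smul, add_zero]

variable {ω : BilinForm F V} {H : Subgroup (V ≃ₗ[F] V)} {v : V} {u : V ≃ₗ[F] V}
variable [CharP F 3] [Fintype F] {x₁ x₂ : V} {c : F}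

namespace IsFrame

omit [CharP F 3] [Fintype F] in
theorem linearIndependent (hω : IsSymplecticFour ω) (hF : IsFrame ω H v x₁ x₂ c) :
    LinearIndependent F ![v, x₁] :=
  hω.linearIndependent_pair hF.ne_zero (fun h => hF.not_perp (hω.swap_eq_zero h)) hF.snd_perp

/-- Multipliers detect the points of the cone on the line spanned by `v` and `x₁`. -/
theorem mul_mem_of_mem_cone [Fintype V] (hω : IsSymplecticFour ω) (hH : Preserves ω H)
    (hF : IsFrame ω H v x₁ x₂ c) {μ : F} (hμ : x₁ + μ • v ∈ cone H v) :
    μ * (c * ω x₂ x₁) ∈ multiplierField hω H v := by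
  obtain ⟨d, hd, h, hh, e⟩ := exists_orbit_of_mem_cone hμ
  have e' : h v = d⁻¹ • (x₁ + μ • v) := by rw [e, inv_smul_smul₀ hd]
  have hv : ω (h v) v = 0 := by simp [e', hF.fst_perp, hω.self_eq_zero]
  have hne := mul_ne_zero hF.scalar_ne_zero hF.not_perp
  have h1 := hF.isDirection.mul_mem_multiplierField hω hH hh hF.isDirection hv
  have h2 := (multiplierField hω H v).div_mem h1 (hF.sq_mem hω hH)
  have h3 : (d⁻¹) ^ 2 ∈ multiplierField hω H v := by
    convert h2 using 1
    simp only [e', map_smul, map_add, LinearMap.smul_apply, hF.snd_perp, smul_eq_mul]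
    have := hF.scalar_ne_zero
    have := hF.not_perp
    field_simp
    ring
  have h4 : d ^ 2 ∈ multiplierField hω H v := by
    have := (multiplierField hω H v).inv_mem h3
    rwa [inv_pow, inv_inv] at this
  obtain ⟨g, hg, eg⟩ := hF.fst_mem
  rw [mem_multiplierField]
  intro α hα
  have hα' := mem_multiplierField.1 h3 α hα
  have t1 : HasTransvection ω H (x₁ + μ • v) (d⁻¹ ^ 2 * α) := by
    rw [e]
    apply HasTransvection.smul
    convert hα.conj hH hh using 1
    field_simp
  have t2 : HasTransvection ω H x₁ (d⁻¹ ^ 2 * α) := by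
    rw [eg]; exact hα'.conj hH hg
  have s := HasSiegel.of_transvections hω hF.fst_perp t1 t2
  have s' : IsDirection ω H v ((d⁻¹ ^ 2 * α * μ) • x₁) := ⟨by simp [hF.fst_perp], _, s⟩
  have t3 := hF.isDirection.transvection hω s'
  have t4 := mem_multiplierField.1 h4 _ t3
  convert t4 using 1
  simp only [map_smul, LinearMap.smul_apply, smul_eq_mul]
  field_simp

open scoped Classical in
omit [CharP F 3] in
theorem card_orbit_ge (hω : IsSymplecticFour ω) (hH : Preserves ω H)
    (hF : IsFrame ω H v x₁ x₂ c) {p : V} (hp : p ∉ Submodule.span F {v, x₁}) :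
    ∃ S : Finset V, Nat.card (multiplierField hω H v) ^ 2 ≤ #S ∧
      ∀ y ∈ S, ∃ h ∈ flagStabilizer H (Submodule.span F {v, x₁}), y = h p := by
  obtain ⟨α, hα0, hα⟩ := hF.exists_transvection
  set W := Submodule.span F {v, x₁} with hW
  set K := multiplierField hω H v with hK
  set γ := ω x₂ x₁
  have hγ0 : γ ≠ 0 := hF.not_perp
  have hvW : v ∈ W := Submodule.subset_span (by simp)
  have hxW : x₁ ∈ W := Submodule.subset_span (by simp)
  have hv1 := hω.swap_eq_zero hF.fst_perp
  have hli := LinearIndependent.pair_iff.1 (hF.linearIndependent hω)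
  have hfix : ∀ h : V ≃ₗ[F] V, h v = v → h x₁ = x₁ → ∀ y ∈ W, h y = y := by
    intro h h1 h2 y hy
    obtain ⟨a, b, rfl⟩ := Submodule.mem_span_pair.1 hy
    rw [map_add, map_smul, map_smul, h1, h2]
  have hT : ∀ κ : K, HasTransvection ω H v (κ * α) := fun κ => κ.2 _ hα
  have hR : ∀ κ : K, ∃ β, ∃ h ∈ flagStabilizer H W, ∀ x, h x = x + ω x v • (κ * α * (c * γ)) • x₁ +
      ω x ((κ * α * (c * γ)) • x₁) • v + (β * ω x v) • v := by
    intro κ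
    obtain ⟨-, β, h, hh, e⟩ := hF.isDirection_fst hω hH (hT κ)
    refine ⟨β, h, ⟨hh, hfix h ?_ ?_, fun x => ?_⟩, e⟩
    · simp [e, hω.self_eq_zero, hv1]
    · simp [e, hω.self_eq_zero, hF.fst_perp]
    · rw [e, add_assoc, add_assoc, add_sub_cancel_left]
      exact W.add_mem (W.smul_mem _ (W.smul_mem _ hxW))
        (W.add_mem (W.smul_mem _ hvW) (W.smul_mem _ hvW))
  choose β R hRW hRe using hR
  have hcard : ∀ f : K × K → V, Function.Injective f →
      (∀ z, ∃ h ∈ flagStabilizer H W, f z = h p) → ∃ S : Finset V, Nat.card K ^ 2 ≤ #S ∧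
      ∀ y ∈ S, ∃ h ∈ flagStabilizer H W, y = h p := by
    intro f hf hfz
    have := Fintype.ofFinite K
    refine ⟨univ.image f, ?_, fun y hy => ?_⟩
    · rw [card_image_of_injective _ hf, Finset.card_univ, Fintype.card_prod,
        ← Nat.card_eq_fintype_card, sq]
    · obtain ⟨z, -, rfl⟩ := mem_image.1 hy
      exact hfz z
  by_cases hd : ω p v = 0
  · have hp1 : ω p x₁ ≠ 0 := by
      intro h0
      obtain ⟨a, b, e⟩ := hω.mem_span_pair_of_orthogonal (hF.linearIndependent hω) hF.fst_perp hd h0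
      exact hp (hW ▸ Submodule.mem_span_pair.2 ⟨a, b, e.symm⟩)
    obtain ⟨g, hg, eg⟩ := hF.fst_mem
    have hT1 : ∀ κ : K, ∃ h ∈ flagStabilizer H W, ∀ x, h x = x + (κ * α * ω x x₁) • x₁ := by
      intro κ
      obtain ⟨h, hh, e⟩ := (hT κ).conj hH hg
      rw [← eg] at e
      refine ⟨h, ⟨hh, hfix h ?_ ?_, fun x => ?_⟩, e⟩
      · simp [e, hv1]
      · simp [e, hω.self_eq_zero]
      · rw [e, add_sub_cancel_left]
        exact W.smul_mem _ hxW
    choose T hTW hTe using hT1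
    refine hcard (fun z => (T z.2 * R z.1) p) ?_
      fun z => ⟨_, Subgroup.mul_mem _ (hTW _) (hRW _), rfl⟩
    rintro ⟨κ, κ'⟩ ⟨δ, δ'⟩ h
    simp only [LinearEquiv.mul_apply, hTe, hRe, hd, zero_smul, add_zero, mul_zero, map_add,
      map_smul, LinearMap.add_apply, LinearMap.smul_apply, hv1, smul_eq_mul] at h
    have h0 := hli ((κ - δ) * (α * (c * γ) * ω p x₁)) ((κ' - δ') * (α * ω p x₁)) (by
      rw [← sub_eq_zero] at h
      rw [← h]
      module)
    have hc := hF.scalar_ne_zero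
    simp only [mul_eq_zero, hα0, hc, hγ0, hp1, or_false, sub_eq_zero, SetLike.coe_eq_coe] at h0
    rw [h0.1, h0.2]
  · have hT1 : ∀ κ : K, ∃ h ∈ flagStabilizer H W, ∀ x, h x = x + (κ * α * ω x v) • v := by
      intro κ
      obtain ⟨h, hh, e⟩ := hT κ
      refine ⟨h, ⟨hh, hfix h ?_ ?_, fun x => ?_⟩, e⟩
      · simp [e, hω.self_eq_zero]
      · simp [e, hF.fst_perp]
      · rw [e, add_sub_cancel_left]
        exact W.smul_mem _ hvW
    choose T hTW hTe using hT1
    refine hcard (fun z => (T z.2 * R z.1) p) ?_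
      fun z => ⟨_, Subgroup.mul_mem _ (hTW _) (hRW _), rfl⟩
    rintro ⟨κ, κ'⟩ ⟨δ, δ'⟩ h
    simp only [LinearEquiv.mul_apply, hTe, hRe, map_add, mul_zero, add_zero,
      map_smul, LinearMap.add_apply, LinearMap.smul_apply, hω.self_eq_zero, hF.fst_perp,
      smul_eq_mul] at h
    have h0 := hli
      ((κ * α * (c * γ) * ω p x₁ + β κ * ω p v + κ' * α * ω p v) -
        (δ * α * (c * γ) * ω p x₁ + β δ * ω p v + δ' * α * ω p v))
      ((κ - δ) * (ω p v * (α * (c * γ)))) (by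
        rw [← sub_eq_zero] at h
        rw [← h]
        module)
    have hc := hF.scalar_ne_zero
    obtain ⟨h0, h1⟩ := h0
    simp only [mul_eq_zero, hα0, hc, hγ0, hd, or_false, sub_eq_zero, SetLike.coe_eq_coe] at h1
    subst h1
    have h2 : (κ' - δ' : F) * (α * ω p v) = 0 := by linear_combination h0
    simp only [mul_eq_zero, hα0, hd, or_false, sub_eq_zero, SetLike.coe_eq_coe] at h2
    rw [h2]

end IsFrame

end MultiplierTop

end SymplecticFour

namespace SymplecticFour

open LinearMap (BilinForm)

section MultiplierTop

open Finset

variable {F V : Type*} [Field F] [AddCommGroup V] [Module F V] [Fintype F] [Fintype V]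
variable {ω : BilinForm F V} {H : Subgroup (V ≃ₗ[F] V)} {v : V} {u : V ≃ₗ[F] V}

open scoped Classical in
theorem card_cone_filter_mem_span {x : V} (hli : LinearIndependent F ![v, x]) (hv : v ≠ 0) :
    #{y ∈ cone H v | y ∈ Submodule.span F {v, x}} =
      (Fintype.card F - 1) * (1 + #{μ : F | x + μ • v ∈ cone H v}) := by
  have hli' := LinearIndependent.pair_iff.1 hli
  set f : F × F → V := fun z => z.1 • (x + z.2 • v) with hf
  have e : {y ∈ cone H v | y ∈ Submodule.span F {v, x}} =
      ((univ.erase (0 : F)).image fun a => a • v) ∪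
      ((univ.erase (0 : F)) ×ˢ ({μ : F | x + μ • v ∈ cone H v} : Finset F)).image f := by
    ext y
    simp only [mem_filter, mem_union, mem_image, mem_erase, mem_univ, and_true, mem_product,
      true_and, Prod.exists, hf]
    constructor
    · rintro ⟨hy, hy'⟩
      obtain ⟨a, b, rfl⟩ := Submodule.mem_span_pair.1 hy'
      by_cases hb : b = 0
      · subst hb
        refine Or.inl ⟨a, ?_, by simp⟩
        rintro rfl
        exact zero_notMem_cone (by simpa using hy)
      · have e : a • v + b • x = b • (x + (b⁻¹ * a) • v) := by
          rw [smul_add, smul_smul, mul_inv_cancel_left₀ hb, add_comm]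
        refine Or.inr ⟨b, b⁻¹ * a, ⟨hb, ?_⟩, e.symm⟩
        have := smul_mem_cone hy (inv_ne_zero hb)
        rwa [e, inv_smul_smul₀ hb] at this
    · rintro (⟨a, ha, rfl⟩ | ⟨a, μ, ⟨ha, hμ⟩, rfl⟩)
      · exact ⟨smul_mem_cone (self_mem_cone hv) ha,
          Submodule.smul_mem _ _ (Submodule.subset_span (by simp))⟩
      · refine ⟨smul_mem_cone hμ ha, Submodule.mem_span_pair.2 ⟨a * μ, a, by module⟩⟩
  rw [e, card_union_of_disjoint, card_image_of_injective _ (smul_left_injective F hv),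
    card_image_of_injOn, card_product, card_erase_of_mem (mem_univ _), Finset.card_univ]
  · ring
  · rintro ⟨a, μ⟩ h1 ⟨b, ν⟩ h2 h
    simp only [coe_product, Set.mem_prod, mem_coe, mem_erase, mem_univ, and_true] at h1 h2
    have h0 := hli' (a * μ - b * ν) (a - b) (by
      simp only [hf] at h
      rw [← sub_eq_zero] at h
      rw [← h]
      module)
    obtain rfl : a = b := sub_eq_zero.1 h0.2
    have := h0.1
    rw [← mul_sub, mul_eq_zero, or_iff_right h1.1, sub_eq_zero] at this
    rw [this]
  · rw [disjoint_left]
    rintro y h1 h2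
    simp only [mem_image, mem_erase, mem_univ, and_true, mem_product, Prod.exists, hf] at h1 h2
    obtain ⟨a, -, rfl⟩ := h1
    obtain ⟨b, ν, ⟨hb, -⟩, h⟩ := h2
    have h0 := hli' (b * ν - a) b (by
      rw [← sub_eq_zero] at h
      rw [← h]
      module)
    exact hb h0.2

theorem eq_two_of_mul_sub_le {q k j : ℕ} (hk : 3 * k ≤ q) (h3 : 3 ≤ k) (hj : j % 3 = 2)
    (h : j * (q - k) ≤ 2 * (q + 1)) : j = 2 := by
  by_contra hne
  have h5 : 5 ≤ j := by omega
  have := (Nat.mul_le_mul_right (q - k) h5).trans h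
  omega

theorem mul_sub_le_of_card_le {q k j N : ℕ} (hq : 3 ≤ q)
    (hN : 2 * N = (q ^ 2 + 1) * (q - 1) * j)
    (h : N * (q * ((q - 1) * (q - k))) * (q + 1) ≤ (q ^ 4 - 1) * (q ^ 3 - q)) :
    j * (q - k) ≤ 2 * (q + 1) := by
  obtain ⟨n, rfl⟩ : ∃ n, q = n + 1 := ⟨q - 1, by omega⟩
  have e4 : (n + 1) ^ 4 - 1 = ((n + 1) ^ 2 + 1) * (n * (n + 2)) := by
    rw [Nat.sub_eq_iff_eq_add (Nat.one_le_pow _ _ (by omega))]; ring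
  have e3 : (n + 1) ^ 3 - (n + 1) = (n + 1) * (n * (n + 2)) := by
    rw [Nat.sub_eq_iff_eq_add (Nat.le_self_pow (by omega) _)]; ring
  rw [e4, e3] at h
  simp only [Nat.add_sub_cancel] at h hN ⊢
  set d := n + 1 - k
  have hpos : 0 < ((n + 1) ^ 2 + 1) * n * (n + 1) * n * (n + 2) := by
    have : 0 < n := by omega
    positivity
  refine Nat.le_of_mul_le_mul_left ?_ hpos
  calc _ = ((n + 1) ^ 2 + 1) * n * j * ((n + 1) * (n * d)) * (n + 1 + 1) := by ring
    _ = 2 * (N * ((n + 1) * (n * d)) * (n + 1 + 1)) := by rw [← hN]; ring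
    _ ≤ 2 * (((n + 1) ^ 2 + 1) * (n * (n + 2)) * ((n + 1) * (n * (n + 2)))) := by gcongr
    _ = _ := by ring

theorem RegularUnipotentData.multiplierField_eq_top [CharP F 3]
    (D : RegularUnipotentData ω H u v) {x₁ x₂ : V} {c : F} (hF : IsFrame ω H v x₁ x₂ c) :
    multiplierField D.symp H v = ⊤ := by
  classical
  have hω := D.symp
  have hH := D.preserves
  set K := multiplierField D.symp H v with hK
  by_contra hne
  have := Fintype.ofFinite K
  set q := Fintype.card F with hq
  set k := Nat.card K with hk
  have hq3 : 3 ≤ q := three_le_card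
  obtain ⟨a, -, ha⟩ : ∃ a : ℕ, 0 < a ∧ k = 3 ^ a := by
    obtain ⟨a, -, ha⟩ := FiniteField.card K 3
    exact ⟨a, a.pos, by rw [hk, Nat.card_eq_fintype_card, ha]⟩
  have hqk : q = k ^ Module.finrank K F := by
    rw [hq, hk, Nat.card_eq_fintype_card]; exact Module.card_eq_pow_finrank
  have hk1 : 1 < k := by rw [hk, Nat.card_eq_fintype_card]; exact Fintype.one_lt_card
  have hk3 : 3 ≤ k := by
    rcases Nat.eq_zero_or_pos a with h | h
    · simp [h] at ha; omega
    · rw [ha]; exact Nat.le_self_pow h.ne' 3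
  have hn0 : Module.finrank K F ≠ 0 := fun h => by rw [h] at hqk; simp at hqk; omega
  have hn1 : Module.finrank K F ≠ 1 := by
    intro h
    rw [h, pow_one] at hqk
    apply hne
    rw [eq_top_iff]
    intro x _
    have hbij := (Fintype.bijective_iff_injective_and_card (Subtype.val : K → F)).2
      ⟨Subtype.val_injective, by rw [← Nat.card_eq_fintype_card, ← hk, ← hqk]⟩
    obtain ⟨y, rfl⟩ := hbij.2 x
    exact y.2
  have hkq2 : k ^ 2 ∣ q := by rw [hqk]; exact pow_dvd_pow k (by omega)
  have hkq : 3 * k ≤ q := by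
    refine le_trans ?_ (Nat.le_of_dvd (by omega) hkq2)
    nlinarith
  obtain ⟨j, hj, hN⟩ := D.two_mul_card_cone
  rw [← hq] at hN
  have h1 := card_cone_mul_le hω hH (hF.card_isTangent_ge hω hH)
  obtain rfl := eq_two_of_mul_sub_le hkq hk3 hj (mul_sub_le_of_card_le hq3 hN h1)
  replace hN : #(cone H v) = (q ^ 2 + 1) * (q - 1) := by omega
  set W := Submodule.span F {v, x₁} with hW
  have hdvd : k ^ 2 ∣ #{y ∈ cone H v | y ∉ W} := by
    rw [ha, ← pow_mul]
    have : Fact (Nat.Prime 3) := ⟨Nat.prime_three⟩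
    refine pow_dvd_card_of_le_orbit (isPGroup_flagStabilizer H W) _ ?_ ?_
    · rintro h ⟨hh, h1, h2⟩ x hx
      rw [mem_filter] at hx ⊢
      refine ⟨apply_mem_cone hx.1 hh, fun hx' => hx.2 ?_⟩
      have := W.sub_mem hx' (h2 x)
      rwa [sub_sub_cancel] at this
    · intro x hx
      have := hF.card_orbit_ge hω hH (mem_filter.1 hx).2
      rwa [← hk, ha, ← pow_mul] at this
  have hsplit := card_filter_add_card_filter_not (s := cone H v) (fun y => y ∈ W)
  rw [card_cone_filter_mem_span (hF.linearIndependent hω) D.ne_zero, hN] at hsplit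
  set e := #{μ : F | x₁ + μ • v ∈ cone H v} with he
  have he1 : 0 < e := by
    rw [he, card_pos]
    obtain ⟨h, hh, e⟩ := hF.fst_mem
    refine ⟨0, mem_filter.2 ⟨mem_univ _, ?_⟩⟩
    rw [zero_smul, add_zero, e]
    exact apply_mem_cone (self_mem_cone D.ne_zero) hh
  have hek : e ≤ k := by
    rw [he, hk, Nat.card_eq_fintype_card, ← Fintype.card_subtype]
    refine Fintype.card_le_of_injective
      (fun μ => (⟨μ.1 * (c * ω x₂ x₁), hF.mul_mem_of_mem_cone hω hH μ.2⟩ : K)) ?_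
    intro μ ν h
    exact Subtype.ext (mul_right_cancel₀ (mul_ne_zero hF.scalar_ne_zero hF.not_perp)
      (Subtype.ext_iff.1 h))
  have hke : k ^ 2 ∣ e := by
    obtain ⟨m, hm⟩ := hdvd
    obtain ⟨l, hl⟩ := hkq2
    obtain ⟨n, hn⟩ : ∃ n, q = n + 1 := ⟨q - 1, by omega⟩
    have hcop : Nat.Coprime (k ^ 2) n := by
      have : Nat.Coprime (n + 1) n := by simp
      exact Nat.Coprime.coprime_dvd_left (hn ▸ ⟨l, hl⟩) this
    refine hcop.dvd_of_dvd_mul_left ?_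
    have h2 : n * e + k ^ 2 * m = q ^ 2 * n := by
      rw [hm] at hsplit
      have hsplit' : (q - 1) * (1 + e) + k ^ 2 * m = (q ^ 2 + 1) * (q - 1) := hsplit
      rw [show q - 1 = n by omega] at hsplit'
      linarith
    rw [← Nat.dvd_add_left (Dvd.intro m rfl), h2]
    exact Dvd.dvd.mul_right (Dvd.dvd.pow ⟨l, hl⟩ two_ne_zero) n
  have := (Nat.le_of_dvd he1 hke).trans hek
  nlinarith

end MultiplierTop

end SymplecticFour

namespace SymplecticFour

open LinearMap (BilinForm)

section Generation

variable {F V : Type*} [Field F] [AddCommGroup V] [Module F V]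
variable {ω : BilinForm F V} {H : Subgroup (V ≃ₗ[F] V)} {v : V} {u : V ≃ₗ[F] V}

theorem exists_ne_zero_and_ne_zero {U : Submodule F V} {x y : V} (hx : ∃ z ∈ U, ω x z ≠ 0)
    (hy : ∃ z ∈ U, ω y z ≠ 0) : ∃ z ∈ U, ω x z ≠ 0 ∧ ω y z ≠ 0 := by
  obtain ⟨a, ha, hxa⟩ := hx
  obtain ⟨b, hb, hyb⟩ := hy
  by_cases h1 : ω y a = 0
  · by_cases h2 : ω x b = 0
    · exact ⟨a + b, U.add_mem ha hb, by simpa [h2], by simpa [h1]⟩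
    · exact ⟨b, hb, h2, hyb⟩
  · exact ⟨a, ha, hxa, h1⟩

theorem exists_mem_apply_eq_of_ne_zero (hω : IsSymplecticFour ω)
    (hT : ∀ w α, HasTransvection ω H w α) {U : Submodule F V} {x y : V} (hxU : x ∈ U) (hyU : y ∈ U)
    (h : ω x y ≠ 0) : ∃ h ∈ H, h x = y ∧ ∀ z, (∀ w ∈ U, ω z w = 0) → h z = z := by
  obtain ⟨g, hg, e⟩ := hT (y - x) (ω x y)⁻¹
  refine ⟨g, hg, ?_, fun z hz => ?_⟩
  · rw [e, map_sub, hω.self_eq_zero, sub_zero, inv_mul_cancel₀ h, one_smul, add_sub_cancel]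
  · rw [e, hz _ (U.sub_mem hyU hxU), mul_zero, zero_smul, add_zero]

theorem exists_mem_apply_eq (hω : IsSymplecticFour ω)
    (hT : ∀ w α, HasTransvection ω H w α) {U : Submodule F V} {x y : V} (hxU : x ∈ U) (hyU : y ∈ U)
    (hx : ∃ z ∈ U, ω x z ≠ 0) (hy : ∃ z ∈ U, ω y z ≠ 0) :
    ∃ h ∈ H, h x = y ∧ ∀ z, (∀ w ∈ U, ω z w = 0) → h z = z := by
  obtain ⟨z, hz, hxz, hyz⟩ := exists_ne_zero_and_ne_zero hx hy
  obtain ⟨g, hg, h1, h2⟩ := exists_mem_apply_eq_of_ne_zero hω hT hxU hz hxz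
  obtain ⟨k, hk, h3, h4⟩ := exists_mem_apply_eq_of_ne_zero hω hT hz hyU
    (fun h => hyz (hω.swap_eq_zero h))
  exact ⟨k * g, H.mul_mem hk hg, by rw [LinearEquiv.mul_apply, h1, h3],
    fun w hw => by rw [LinearEquiv.mul_apply, h2 w hw, h4 w hw]⟩

/-- The symplectic group is generated by transvections. -/
theorem mem_of_forall_hasTransvection (hω : IsSymplecticFour ω) (hH : Preserves ω H)
    (hT : ∀ w α, HasTransvection ω H w α) (g : V ≃ₗ[F] V)
    (hg : ∀ x y, ω (g x) (g y) = ω x y) : g ∈ H := by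
  have hfin := hω.finiteDimensional
  have : Nontrivial V := Module.nontrivial_of_finrank_pos (R := F) (by rw [hω.finrank_eq]; norm_num)
  have reduce : ∀ h ∈ H, ∀ k : V ≃ₗ[F] V, h * k ∈ H → k ∈ H :=
    fun h hh k hk => (H.mul_mem_cancel_left hh).1 hk
  have iso : ∀ h ∈ H, ∀ k : V ≃ₗ[F] V, (∀ x y, ω (k x) (k y) = ω x y) →
      ∀ x y, ω ((h * k) x) ((h * k) y) = ω x y :=
    fun h hh k hk x y => by rw [LinearEquiv.mul_apply, LinearEquiv.mul_apply, hH h hh, hk]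
  obtain ⟨e, he⟩ := exists_ne (0 : V)
  obtain ⟨f, hef⟩ : ∃ f, ω e f = 1 := by
    obtain ⟨f, hf⟩ := hω.exists_ne_zero he
    exact ⟨(ω e f)⁻¹ • f, by simp [hf]⟩
  have hfe : ω f e = -1 := by rw [hω.swap, hef]
  set U : Submodule F V := LinearMap.ker (ω.flip e) ⊓ LinearMap.ker (ω.flip f) with hU
  have memU : ∀ x, x ∈ U ↔ ω x e = 0 ∧ ω x f = 0 := fun x => by
    simp [hU, LinearMap.mem_ker]
  have proj : ∀ y, ∃ z ∈ U, (∀ x ∈ U, ω x z = ω x y) ∧ ∃ a b : F, y = z + a • e + b • f := by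
    intro y
    refine ⟨y - ω y f • e + ω y e • f, (memU _).2 ⟨?_, ?_⟩, fun x hx => ?_, ω y f, -ω y e, ?_⟩
    · simp [hω.self_eq_zero, hfe]
    · simp [hω.self_eq_zero, hef]
    · simp [(memU x).1 hx]
    · module
  have nondeg : ∀ x ∈ U, x ≠ 0 → ∃ y ∈ U, ω x y ≠ 0 := by
    intro x hx hx0
    obtain ⟨y, hy⟩ := hω.exists_ne_zero hx0
    obtain ⟨z, hz, h, -⟩ := proj y
    exact ⟨z, hz, by rwa [h x hx]⟩
  obtain ⟨e', he'U, he'⟩ : ∃ e' ∈ U, e' ≠ 0 := by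
    by_contra! h0
    have : (⊤ : Submodule F V) ≤ Submodule.span F {e, f} := by
      intro y _
      obtain ⟨z, hz, -, a, b, e⟩ := proj y
      rw [h0 z hz, zero_add] at e
      exact Submodule.mem_span_pair.2 ⟨a, b, e.symm⟩
    have h1 := Submodule.finrank_mono this
    have h2 : Module.finrank F (Submodule.span F {e, f}) ≤ 2 := by
      classical
      have := finrank_span_finset_le_card (R := F) ({e, f} : Finset V)
      rw [Finset.coe_pair] at this
      exact this.trans Finset.card_le_two
    rw [finrank_top, hω.finrank_eq] at h1
    omega
  obtain ⟨f', hf'U, he'f'⟩ : ∃ f' ∈ U, ω e' f' = 1 := by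
    obtain ⟨y, hy, h⟩ := nondeg e' he'U he'
    exact ⟨(ω e' y)⁻¹ • y, U.smul_mem _ hy, by simp [h]⟩
  have hf'e' : ω f' e' = -1 := by rw [hω.swap, he'f']
  obtain ⟨he'e, he'f⟩ := (memU _).1 he'U
  obtain ⟨hf'e, hf'f⟩ := (memU _).1 hf'U
  have hefne : ω e f ≠ 0 := by rw [hef]; exact one_ne_zero
  have spanU : ∀ z, ω z e' = 0 → z ∈ U → ∃ a : F, z = a • e' := fun z h1 hz =>
    hω.mem_span_of_orthogonal he' (hω.swap_eq_zero he'e) hefne (hω.swap_eq_zero he'f) h1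
      ((memU z).1 hz).1 ((memU z).1 hz).2
  have perpU : ∀ z, (∀ w ∈ U, ω z w = 0) ↔ ∀ w ∈ U, ω w z = 0 := fun z =>
    ⟨fun h w hw => hω.swap_eq_zero (h w hw), fun h w hw => hω.swap_eq_zero (h w hw)⟩
  have heU := (perpU e).2 fun w hw => ((memU w).1 hw).1
  have hfU := (perpU f).2 fun w hw => ((memU w).1 hw).2
  -- an isometry fixing a symplectic basis is trivial
  have fix_basis : ∀ k : V ≃ₗ[F] V, (∀ x y, ω (k x) (k y) = ω x y) → k e = e → k f = f → k e' = e' →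
      k f' = f' → k ∈ H := by
    intro k hk h1 h2 h3 h4
    have : k = 1 := by
      refine LinearEquiv.ext fun x => ?_
      have key : ∀ y, k y = y → ω (k x - x) y = 0 := by
        intro y hy
        have := hk x y
        rw [hy] at this
        rw [map_sub, LinearMap.sub_apply, this, sub_self]
      obtain ⟨a, ha⟩ := spanU _ (key _ h3) ((memU _).2 ⟨key _ h1, key _ h2⟩)
      have h0 := key _ h4
      rw [ha, map_smul, LinearMap.smul_apply, he'f', smul_eq_mul, mul_one] at h0
      rw [h0, zero_smul, sub_eq_zero] at ha
      exact ha
    rw [this]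
    exact H.one_mem
  have fix_three : ∀ k : V ≃ₗ[F] V, (∀ x y, ω (k x) (k y) = ω x y) → k e = e → k f = f → k e' = e' →
      k ∈ H := by
    intro k hk h1 h2 h3
    have key : ∀ y, k y = y → ω (k f' - f') y = 0 := by
      intro y hy
      have := hk f' y
      rw [hy] at this
      rw [map_sub, LinearMap.sub_apply, this, sub_self]
    obtain ⟨a, ha⟩ := spanU _ (key _ h3) ((memU _).2 ⟨key _ h1, key _ h2⟩)
    obtain ⟨t, ht, et⟩ := hT e' a
    refine reduce t ht k (fix_basis _ (iso t ht k hk) ?_ ?_ ?_ ?_)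
    · rw [LinearEquiv.mul_apply, h1, et, heU _ he'U, mul_zero, zero_smul, add_zero]
    · rw [LinearEquiv.mul_apply, h2, et, hfU _ he'U, mul_zero, zero_smul, add_zero]
    · rw [LinearEquiv.mul_apply, h3, et, hω.self_eq_zero, mul_zero, zero_smul, add_zero]
    · rw [LinearEquiv.mul_apply, sub_eq_iff_eq_add.1 ha, map_add, map_smul, et, et,
        hω.self_eq_zero, hf'e']
      module
  have fix_pair : ∀ k : V ≃ₗ[F] V, (∀ x y, ω (k x) (k y) = ω x y) → k e = e → k f = f → k ∈ H := by
    intro k hk h1 h2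
    have hkU : k e' ∈ U := by
      refine (memU _).2 ⟨?_, ?_⟩
      · have := hk e' e
        rwa [h1, he'e] at this
      · have := hk e' f
        rwa [h2, he'f] at this
    obtain ⟨t, ht, et, et'⟩ := exists_mem_apply_eq hω hT hkU he'U
      (nondeg _ hkU (by simpa using he')) (nondeg _ he'U he')
    refine reduce t ht k (fix_three _ (iso t ht k hk) ?_ ?_ ?_)
    · rw [LinearEquiv.mul_apply, h1, et' _ heU]
    · rw [LinearEquiv.mul_apply, h2, et' _ hfU]
    · rw [LinearEquiv.mul_apply, et]
  have fix_vector : ∀ k : V ≃ₗ[F] V, (∀ x y, ω (k x) (k y) = ω x y) → k e = e → k ∈ H := by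
    intro k hk h1
    have hb : ω (f - k f) e = 0 := by
      have := hk f e
      rw [h1] at this
      rw [map_sub, LinearMap.sub_apply, this, sub_self]
    obtain ⟨t0, ht0, et0⟩ : HasSiegel ω H e (f - k f) 1 := by
      have := HasSiegel.of_transvections (c := 1) hω hb (hT _ 1) (hT _ 1)
      simpa using this
    have hkf : ω (k f) e = -1 := by rw [← hfe, ← hk f e, h1]
    obtain ⟨t, ht, et⟩ := hT e (ω f (f - k f) - 1)
    have he : (t * t0) e = e := by
      rw [LinearEquiv.mul_apply, et0, hω.self_eq_zero, hω.swap_eq_zero hb]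
      simp [et, hω.self_eq_zero]
    have hf : (t * t0) f = k f := by
      have : t0 f = k f + (ω f (f - k f) - 1) • e := by
        rw [et0, hfe]
        module
      rw [LinearEquiv.mul_apply, this, map_add, map_smul, et, et, hω.self_eq_zero, hkf]
      module
    have hs := H.inv_mem (H.mul_mem ht ht0)
    refine reduce _ hs k (fix_pair _ (iso _ hs k hk) ?_ ?_)
    · rw [LinearEquiv.mul_apply, h1]
      exact (LinearEquiv.symm_apply_eq _).2 he.symm
    · rw [LinearEquiv.mul_apply]
      exact (LinearEquiv.symm_apply_eq _).2 hf.symm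
  have htop : ∀ x : V, x ≠ 0 → ∃ z ∈ (⊤ : Submodule F V), ω x z ≠ 0 := fun x hx => by
    obtain ⟨y, hy⟩ := hω.exists_ne_zero hx
    exact ⟨y, trivial, hy⟩
  obtain ⟨t, ht, et, -⟩ := exists_mem_apply_eq hω hT (U := ⊤) (x := g e) (y := e) trivial trivial
    (htop _ (by simpa using he)) (htop _ he)
  exact reduce t ht g (fix_vector _ (iso t ht g hg) (by rw [LinearEquiv.mul_apply, et]))

end Generation

end SymplecticFour

namespace SymplecticFour

open LinearMap (BilinForm)

section Generation

variable {F V : Type*} [Field F] [AddCommGroup V] [Module F V] [Fintype F] [Fintype V]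
variable {ω : BilinForm F V} {H : Subgroup (V ≃ₗ[F] V)} {v : V} {u : V ≃ₗ[F] V}

namespace IsFrame

variable [CharP F 3] {x₁ x₂ : V} {c : F}

omit [Fintype V] [CharP F 3] in
theorem hasTransvection_of_eq_top (hω : IsSymplecticFour ω) (hF : IsFrame ω H v x₁ x₂ c)
    (htop : multiplierField hω H v = ⊤) (α : F) : HasTransvection ω H v α := by
  obtain ⟨β, hβ0, hβ⟩ := hF.exists_transvection
  have : α / β ∈ multiplierField hω H v := htop ▸ trivial
  have := mem_multiplierField.1 this β hβ
  rwa [div_mul_cancel₀ _ hβ0] at this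

omit [Fintype V] [CharP F 3] in
theorem hasSiegel_of_eq_top (hω : IsSymplecticFour ω) (hH : Preserves ω H)
    (hF : IsFrame ω H v x₁ x₂ c) (htop : multiplierField hω H v = ⊤) {b : V} (hb : ω b v = 0)
    (α : F) : HasSiegel ω H v b α := by
  have hT := hF.hasTransvection_of_eq_top hω htop
  have hc := hF.scalar_ne_zero
  have hγ := hF.not_perp
  have h12 : ω x₁ x₂ ≠ 0 := fun h => hγ (hω.swap_eq_zero h)
  have d1 : ∀ a : F, IsDirection ω H v (a • x₁) := by
    intro a
    have := hF.isDirection_fst hω hH (hT (a / (c * ω x₂ x₁)))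
    rwa [div_mul_cancel₀ _ (mul_ne_zero hc hγ)] at this
  have d2 : ∀ a : F, IsDirection ω H v (a • x₂) := by
    intro a
    have := hF.isDirection_snd hω hH (hT (a / (c * ω x₂ x₁ ^ 2))) (hT 1)
    rwa [mul_one, mul_assoc, div_mul_cancel₀ _ (mul_ne_zero hc (pow_ne_zero 2 hγ))] at this
  have d0 : ∀ a δ : F, HasSiegel ω H v (a • v) δ := fun a δ =>
    HasSiegel.of_transvection (hT _)
  obtain ⟨a, ha⟩ := hω.mem_span_of_orthogonal (z := b - (ω b x₂ / ω x₁ x₂) • x₁ -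
    (ω b x₁ / ω x₂ x₁) • x₂) hF.ne_zero hF.fst_perp h12 hF.snd_perp
    (by simp [hb, hF.fst_perp, hF.snd_perp])
    (by simp [hω.self_eq_zero, hγ]) (by simp [hω.self_eq_zero, h12])
  obtain ⟨-, β, hβ⟩ := (d1 (ω b x₂ / ω x₁ x₂)).add hω (d2 (ω b x₁ / ω x₂ x₁))
  have := hβ.add hω (by simp [hF.fst_perp, hF.snd_perp]) (by simp [hω.self_eq_zero])
    (d0 a (α - β - ω (a • v) ((ω b x₂ / ω x₁ x₂) • x₁ + (ω b x₁ / ω x₂ x₁) • x₂)))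
  convert this using 1
  · rw [← ha]; abel
  · ring

omit [CharP F 3] in
theorem mem_cone_of_not_perp (hω : IsSymplecticFour ω) (hH : Preserves ω H)
    (hF : IsFrame ω H v x₁ x₂ c) (htop : multiplierField hω H v = ⊤) {w : V} (hw : ω w v ≠ 0) :
    w ∈ cone H v := by
  obtain ⟨z, hz, hzv⟩ : ∃ z ∈ cone H v, ω z v ≠ 0 := by
    obtain ⟨h, hh, e⟩ := hF.fst_mem
    obtain ⟨g, hg, e'⟩ := hF.snd_mem
    refine ⟨(g⁻¹ * h) v, apply_mem_cone (self_mem_cone hF.ne_zero) (H.mul_mem (H.inv_mem hg) hh),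
      ?_⟩
    rw [← hH g hg, LinearEquiv.mul_apply, show g (g⁻¹ (h v)) = h v from g.apply_symm_apply _,
      ← e, ← e', hω.swap]
    exact neg_ne_zero.2 hF.not_perp
  set z' := (ω w v / ω z v) • z with hz'
  have hz'c : z' ∈ cone H v := smul_mem_cone hz (div_ne_zero hw hzv)
  have hz'v : ω z' v = ω w v := by simp [hz', hzv]
  set b := (ω w v)⁻¹ • (w - z') with hb
  have hbv : ω b v = 0 := by simp [hb, hz'v]
  obtain ⟨h, hh, e⟩ := hF.hasSiegel_of_eq_top hω hH htop hbv (-ω z' b / ω w v)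
  have : h z' = w := by
    rw [e, hz'v, hb, smul_inv_smul₀ hw, ← hb, div_mul_cancel₀ _ hw]
    module
  rw [← this]
  exact apply_mem_cone hz'c hh

end IsFrame

/-- A group of isometries of a symplectic space of dimension four in characteristic three
containing a regular unipotent element, and elements of order `r ^ f` for all prime powers `r ^ f`
dividing `(q ^ 2 + 1) / 2`, is the whole isometry group. -/
theorem RegularUnipotentData.mem_of_isometry [CharP F 3] (D : RegularUnipotentData ω H u v)
    (g : V ≃ₗ[F] V) (hg : ∀ x y, ω (g x) (g y) = ω x y) : g ∈ H := by
  have hω := D.symp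
  have hH := D.preserves
  obtain ⟨x₁, x₂, c, hF⟩ := D.exists_isFrame
  have htop := D.multiplierField_eq_top hF
  have hcone : ∀ w, w ≠ 0 → w ∈ cone H v := by
    intro w hw
    obtain ⟨z, -, hwz, hvz⟩ := exists_ne_zero_and_ne_zero (ω := ω) (U := ⊤) (x := w) (y := v)
      (by obtain ⟨y, hy⟩ := hω.exists_ne_zero hw; exact ⟨y, trivial, hy⟩)
      (by obtain ⟨y, hy⟩ := hω.exists_ne_zero D.ne_zero; exact ⟨y, trivial, hy⟩)
    have hz := hF.mem_cone_of_not_perp hω hH htop fun h => hvz (hω.swap_eq_zero h)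
    obtain ⟨a, ha, h, hh, rfl⟩ := exists_orbit_of_mem_cone hz
    rw [map_smul, smul_eq_mul] at hwz
    rw [← apply_mem_cone_iff (H.inv_mem hh)]
    refine hF.mem_cone_of_not_perp hω hH htop ?_
    rw [← hH h hh, show h (h⁻¹ w) = w from h.apply_symm_apply _]
    exact right_ne_zero_of_mul hwz
  refine mem_of_forall_hasTransvection hω hH (fun w α => ?_) g hg
  by_cases hw : w = 0
  · exact ⟨1, H.one_mem, fun x => by simp [hw]⟩
  obtain ⟨a, -, h, hh, rfl⟩ := exists_orbit_of_mem_cone (hcone w hw)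
  exact ((hF.hasTransvection_of_eq_top hω htop _).conj hH hh).smul

end Generation

end SymplecticFour

namespace SymplecticFour

open LinearMap (BilinForm)

section Unipotent

variable {F V : Type*} [Field F] [AddCommGroup V] [Module F V]

theorem exists_eq_sum_of_pow_ne_zero (h4 : Module.finrank F V = 4) {N : Module.End F V} {e : V}
    (h0 : N ^ 4 = 0) (he : (N ^ 3) e ≠ 0) (x : V) :
    ∃ a b c d : F, x = a • e + b • N e + c • (N ^ 2) e + d • (N ^ 3) e := by
  have hle : ∀ n, 4 ≤ n → (N ^ n) e = 0 := by
    intro n hn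
    rw [← Nat.sub_add_cancel hn, pow_add, h0, mul_zero]; rfl
  have happ : ∀ m n, (N ^ m) ((N ^ n) e) = (N ^ (m + n)) e := fun m n => by
    rw [pow_add, Module.End.mul_apply]
  have hli : LinearIndependent F fun i : Fin 4 => (N ^ (i : ℕ)) e := by
    rw [Fintype.linearIndependent_iff]
    intro g hg
    have key : ∀ m, ∑ i : Fin 4, g i • (N ^ (m + (i : ℕ))) e = 0 := by
      intro m
      have := congrArg (N ^ m) hg
      simpa [map_sum, happ] using this
    have k3 := key 3
    have k2 := key 2
    have k1 := key 1
    have k0 := key 0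
    simp only [Fin.sum_univ_four, Fin.val_zero, Fin.val_one, Fin.val_two,
      show ((3 : Fin 4) : ℕ) = 3 from rfl, hle _ (le_refl _), hle 5 (by norm_num),
      hle 6 (by norm_num), Nat.reduceAdd, smul_zero, add_zero, smul_eq_zero, he, or_false]
      at k3 k2 k1 k0
    simp only [k3, zero_smul, zero_add, smul_eq_zero, he, or_false] at k2 k1 k0
    simp only [k2, zero_smul, zero_add, smul_eq_zero, he, or_false] at k1 k0
    simp only [k1, zero_smul, zero_add, smul_eq_zero, he, or_false] at k0
    intro i
    fin_cases i <;> assumption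
  have := FiniteDimensional.of_finrank_pos (K := F) (V := V) (by rw [h4]; norm_num)
  have hsp := hli.span_eq_top_of_card_eq_finrank' (by rw [h4, Fintype.card_fin])
  have hx : x ∈ Submodule.span F (Set.range fun i : Fin 4 => (N ^ (i : ℕ)) e) := hsp ▸ trivial
  obtain ⟨g, rfl⟩ := (Submodule.mem_span_range_iff_exists_fun F).1 hx
  exact ⟨g 0, g 1, g 2, g 3, by simp [Fin.sum_univ_four]⟩

variable {ω : BilinForm F V} {H : Subgroup (V ≃ₗ[F] V)} {u : V ≃ₗ[F] V}

theorem exists_regularUnipotentData [Fintype F] [Fintype V] [CharP F 3] (hω : IsSymplecticFour ω)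
    (hH : Preserves ω H) (hu : u ∈ H) (hpow : ∃ n, u ^ 3 ^ n = 1) (h3 : u ^ 3 ≠ 1)
    (hord : ∀ r f : ℕ, r.Prime → r ^ f ∣ (Fintype.card F ^ 2 + 1) / 2 →
      ∃ t ∈ H, orderOf t = r ^ f) :
    ∃ v, RegularUnipotentData ω H u v := by
  have hfd := hω.finiteDimensional
  have : Nontrivial V := Module.nontrivial_of_finrank_pos (R := F) (by rw [hω.finrank_eq]; norm_num)
  have hchar : CharP (Module.End F V) 3 :=
    charP_of_injective_algebraMap (FaithfulSMul.algebraMap_injective F (Module.End F V)) 3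
  have hprime : Fact (Nat.Prime 3) := ⟨Nat.prime_three⟩
  set N : Module.End F V := (u : V →ₗ[F] V) - 1 with hN
  have huN : ∀ x, u x = x + N x := fun x => by simp [hN]
  have hcoe : ∀ n : ℕ, ((u ^ n : V ≃ₗ[F] V) : V →ₗ[F] V) = (u : Module.End F V) ^ n := by
    intro n
    ext x
    induction n generalizing x with
    | zero => rfl
    | succ n ih =>
      rw [pow_succ, pow_succ, Module.End.mul_apply, ← ih]
      rfl
  have hNpow : ∀ n, N ^ 3 ^ n = ((u ^ 3 ^ n : V ≃ₗ[F] V) : V →ₗ[F] V) - 1 := by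
    intro n
    rw [hN, sub_pow_char_pow_of_commute _ _ (Commute.one_right _), one_pow, hcoe]
  have hu3 : ∀ x, (u ^ 3) x = x + (N ^ 3) x := by
    intro x
    have := hNpow 1
    rw [pow_one] at this
    rw [this]
    simp
  have hN4 : N ^ 4 = 0 := by
    obtain ⟨n, hn⟩ := hpow
    have h := hNpow n
    rw [hn, show ((1 : V ≃ₗ[F] V) : V →ₗ[F] V) = 1 from rfl, sub_self] at h
    have := Module.End.ker_pow_le_ker_pow_finrank N (3 ^ n)
    rw [h, hω.finrank_eq] at this
    exact LinearMap.ext fun x => this (show (0 : V →ₗ[F] V) x = 0 from rfl)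
  obtain ⟨e, he⟩ : ∃ e, (N ^ 3) e ≠ 0 := by
    by_contra! h
    exact h3 (LinearEquiv.ext fun x => by rw [hu3, h, add_zero]; rfl)
  have happ : ∀ m x, N ((N ^ m) x) = (N ^ (m + 1)) x := fun m x => by
    rw [pow_succ', Module.End.mul_apply]
  have happ3 : ∀ m x, (N ^ 3) ((N ^ (m + 1)) x) = 0 := fun m x => by
    rw [← Module.End.mul_apply, ← pow_add, show 3 + (m + 1) = 4 + m by ring, pow_add, hN4, zero_mul]
    rfl
  have hspan := exists_eq_sum_of_pow_ne_zero hω.finrank_eq hN4 he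
  set v := (N ^ 3) e with hv
  have hNv : N v = 0 := by rw [hv, happ, hN4]; rfl
  have hcoef : ∀ x, ∃ l : F, (N ^ 3) x = l • v := by
    intro x
    obtain ⟨a, b, c, d, rfl⟩ := hspan x
    refine ⟨a, ?_⟩
    have h1 := happ3 0 e
    have h2 := happ3 1 e
    have h3 := happ3 2 e
    simp only [zero_add, pow_one, Nat.reduceAdd] at h1 h2 h3
    rw [map_add, map_add, map_add, map_smul, map_smul, map_smul, map_smul, h1, h2, hv, h3]
    simp
  have hform : ∀ x (l : F), (N ^ 3) x = l • v → ω x v = l * ω e v := by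
    intro x l hl
    have h := hH (u ^ 3) (H.pow_mem hu 3) x e
    rw [hu3, hu3, hl, ← hv] at h
    simp only [map_add, map_smul, LinearMap.add_apply, LinearMap.smul_apply, hω.self_eq_zero,
      smul_eq_mul] at h
    rw [hω.swap e v] at h
    linear_combination h
  have hev : ω e v ≠ 0 := by
    intro h0
    obtain ⟨y, hy⟩ := hω.exists_ne_zero he
    obtain ⟨l, hl⟩ := hcoef y
    have := hform y l hl
    rw [h0, mul_zero] at this
    exact hy (hω.swap_eq_zero this)
  refine ⟨v, ⟨hω, hH, he, ⟨(ω e v)⁻¹, inv_ne_zero hev, u ^ 3, H.pow_mem hu 3, fun x => ?_⟩, hu,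
    hpow, by rw [huN, hNv, add_zero], fun x hx => ?_, hord⟩⟩
  · obtain ⟨l, hl⟩ := hcoef x
    rw [hu3, hform x l hl, hl, mul_comm l, inv_mul_cancel_left₀ hev]
  · rw [huN, add_eq_left] at hx
    obtain ⟨a, b, c, d, rfl⟩ := hspan x
    have hNd : ∀ m, (N ^ (m + 4)) e = 0 := fun m => by rw [pow_add, hN4, mul_zero]; rfl
    have key : ∀ m : ℕ, a • (N ^ (m + 1)) e + b • (N ^ (m + 2)) e + c • (N ^ (m + 3)) e = 0 := by
      intro m
      have := congrArg (N ^ m) hx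
      rw [map_zero, ← Module.End.mul_apply, ← pow_succ] at this
      rw [map_add, map_add, map_add, map_smul, map_smul, map_smul, map_smul] at this
      rw [show N e = (N ^ 1) e by rw [pow_one], hv] at this
      simp only [← Module.End.mul_apply, ← pow_add] at this
      have h4 := hNd m
      rwa [show m + 1 + 1 = m + 2 by ring, show m + 1 + 2 = m + 3 by ring,
        show m + 1 + 3 = m + 4 by ring, h4, smul_zero, add_zero] at this
    have k2 := key 2
    have k1 := key 1
    have k0 := key 0
    simp only [Nat.reduceAdd, zero_add, hN4, hNd 1, LinearMap.zero_apply, smul_zero, add_zero,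
      ← hv, smul_eq_zero, he, or_false] at k2 k1 k0
    simp only [k2, zero_smul, zero_add, smul_eq_zero, he, or_false] at k1 k0
    simp only [k1, zero_smul, zero_add, smul_eq_zero, he, or_false] at k0
    exact ⟨d, by simp [k0, k1, k2]⟩

end Unipotent

end SymplecticFour

namespace SymplecticFour

open Matrix

section Center

variable {F : Type*} [Field F]

theorem mem_center_of_eq_one_or_neg_one {z : symplecticGroup (Fin 2) F}
    (hz : (z : Matrix (Fin 2 ⊕ Fin 2) (Fin 2 ⊕ Fin 2) F) = 1 ∨
      (z : Matrix (Fin 2 ⊕ Fin 2) (Fin 2 ⊕ Fin 2) F) = -1) :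
    z ∈ Subgroup.center (symplecticGroup (Fin 2) F) := by
  rw [Subgroup.mem_center_iff]
  intro g
  ext1
  rcases hz with hz | hz <;> simp [hz]

theorem upper_mem_symplecticGroup {B : Matrix (Fin 2) (Fin 2) F} (hB : Bᵀ = B) :
    fromBlocks 1 B 0 1 ∈ symplecticGroup (Fin 2) F := by
  rw [SymplecticGroup.fromBlocks_mem_iff]
  simp [hB]

theorem blockDiagonal_mem_symplecticGroup {P : Matrix (Fin 2) (Fin 2) F} (hP : Pᵀ * P = 1) :
    fromBlocks P 0 0 P ∈ symplecticGroup (Fin 2) F := by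
  rw [SymplecticGroup.fromBlocks_mem_iff]
  simp [hP]

theorem eq_one_or_neg_one_of_mem_center {z : symplecticGroup (Fin 2) F}
    (hz : z ∈ Subgroup.center (symplecticGroup (Fin 2) F)) :
    (z : Matrix (Fin 2 ⊕ Fin 2) (Fin 2 ⊕ Fin 2) F) = 1 ∨
      (z : Matrix (Fin 2 ⊕ Fin 2) (Fin 2 ⊕ Fin 2) F) = -1 := by
  rw [Subgroup.mem_center_iff] at hz
  have comm : ∀ g ∈ symplecticGroup (Fin 2) F,
      g * (z : Matrix (Fin 2 ⊕ Fin 2) (Fin 2 ⊕ Fin 2) F) = z * g := fun g hg =>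
    congrArg Subtype.val (hz ⟨g, hg⟩)
  obtain ⟨A, B, C, D, h⟩ : ∃ A B C D : Matrix (Fin 2) (Fin 2) F,
      (z : Matrix (Fin 2 ⊕ Fin 2) (Fin 2 ⊕ Fin 2) F) = fromBlocks A B C D :=
    ⟨_, _, _, _, (fromBlocks_toBlocks _).symm⟩
  have h1 := comm _ (upper_mem_symplecticGroup (B := 1) (by simp))
  have h2 := comm _ (upper_mem_symplecticGroup (B := !![1, 0; 0, 0])
    (by ext i j; fin_cases i <;> fin_cases j <;> rfl))
  have h3 := comm _ (SymplecticGroup.J_mem _ _)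
  have h4 := comm _ (blockDiagonal_mem_symplecticGroup (P := !![0, 1; 1, 0])
    (by ext i j; fin_cases i <;> fin_cases j <;> simp [Matrix.mul_apply, Fin.sum_univ_two]))
  have hs := SymplecticGroup.mem_iff'.1 z.2
  rw [h] at h1 h2 h3 h4 hs
  simp only [J, fromBlocks_multiply, fromBlocks_inj, fromBlocks_transpose, one_mul, zero_mul,
    add_zero, zero_add, mul_one, mul_zero, mul_neg, neg_mul] at h1 h2 h3 h4 hs
  obtain ⟨h1, h1', -, -⟩ := h1
  have hC : C = 0 := by simpa using h1
  subst hC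
  have hB : B = 0 := by simpa using h3.1.symm
  subst hB
  obtain rfl : D = A := by simpa using h1'
  have e2 := h2.2.1
  have e4 := h4.1
  have es := hs.2.1
  simp only [zero_add, add_zero, transpose_zero, mul_zero,
    neg_inj, ← Matrix.ext_iff, Fin.forall_fin_two, Matrix.mul_apply, Fin.sum_univ_two] at e2 e4 es
  simp at e2 e4 es
  obtain ⟨a01, a10⟩ := e2
  obtain ⟨⟨-, e3⟩, -⟩ := e4
  have hd : ∀ c : F, D 0 0 = c → D = c • (1 : Matrix (Fin 2) (Fin 2) F) := by
    rintro c rfl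
    ext i j
    fin_cases i <;> fin_cases j <;> simp [a01, ← a10, e3]
  rw [h]
  rcases mul_self_eq_one_iff.1 (show D 0 0 * D 0 0 = 1 by simpa [← a10] using es.1.1) with h0 | h0
  · left
    rw [hd _ h0, one_smul, fromBlocks_one]
  · right
    rw [hd _ h0, neg_one_smul, ← fromBlocks_one, fromBlocks_neg, neg_zero]

theorem sq_eq_one_of_mem_center {z : symplecticGroup (Fin 2) F}
    (hz : z ∈ Subgroup.center (symplecticGroup (Fin 2) F)) : z ^ 2 = 1 := by
  ext1
  rcases eq_one_or_neg_one_of_mem_center hz with h | h <;> simp [h]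

end Center

end SymplecticFour

namespace SymplecticFour

open Matrix

section Eigenvalues

theorem exists_forall_pow_eq_of_stable {Ω : Type*} [Field Ω] [DecidableEq Ω] {q E : ℕ} (hq : 2 ≤ q)
    (hinj : Function.Injective fun x : Ω => x ^ q) (hneg : (-1 : Ω) ^ q = -1)
    (h1 : q - 1 ∣ E) (h2 : q + 1 ∣ E) (h3 : q ^ 2 + 1 ∣ E) (h4 : q ^ 2 - 1 ∣ 2 * E)
    {R : Finset Ω} (hcard : R.card ≤ 4) (h0 : ∀ x ∈ R, x ≠ 0) (hpow : ∀ x ∈ R, x ^ q ∈ R)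
    (hinv : ∀ x ∈ R, x⁻¹ ∈ R) : ∃ ε : Ω, (ε = 1 ∨ ε = -1) ∧ ∀ x ∈ R, x ^ E = ε := by
  by_cases hall : ∀ x ∈ R, x ^ E = 1
  · exact ⟨1, Or.inl rfl, hall⟩
  push Not at hall
  obtain ⟨a, ha, haE⟩ := hall
  have ha0 := h0 a ha
  have ndvd : ∀ m, m ∣ E → a ^ m ≠ 1 := by
    rintro m ⟨n, rfl⟩ h
    rw [pow_mul, h, one_pow] at haE
    exact haE rfl
  have hab : a ^ q ≠ a := by
    intro h
    refine ndvd _ h1 (mul_right_cancel₀ ha0 ?_)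
    rw [← pow_succ, Nat.sub_add_cancel (by lia), h, one_mul]
  have had : a ^ q ≠ a⁻¹ := fun h => ndvd _ h2 (by rw [pow_succ, h, inv_mul_cancel₀ ha0])
  have hac : a⁻¹ ≠ a := by
    intro h
    rcases mul_self_eq_one_iff.1 (show a * a = 1 by rw [← inv_mul_cancel₀ ha0, h]) with h' | h'
    · exact hab (by rw [h', one_pow])
    · exact hab (by rw [h', hneg])
  have hsub : ({a, a ^ q, a⁻¹, a⁻¹ ^ q} : Finset Ω) ⊆ R := by
    intro x hx
    simp only [Finset.mem_insert, Finset.mem_singleton] at hx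
    rcases hx with rfl | rfl | rfl | rfl
    exacts [ha, hpow _ ha, hinv _ ha, hpow _ (hinv _ ha)]
  have hc4 : ({a, a ^ q, a⁻¹, a⁻¹ ^ q} : Finset Ω).card = 4 := by
    rw [Finset.card_insert_of_notMem, Finset.card_insert_of_notMem, Finset.card_pair]
    · intro h
      exact hab (inv_injective (by rw [← inv_pow, ← h]))
    · simp only [Finset.mem_insert, Finset.mem_singleton, not_or]
      exact ⟨had, fun h => hac (hinj h).symm⟩
    · simp only [Finset.mem_insert, Finset.mem_singleton, not_or]
      refine ⟨hab.symm, hac.symm, fun h => had ?_⟩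
      rw [inv_pow] at h
      rw [h, inv_inv, ← h]
  have hR := (Finset.eq_of_subset_of_card_le hsub (by rw [hc4]; exact hcard)).symm
  have haq : a ^ q ^ 2 = a := by
    have hm := hpow _ (hpow _ ha)
    rw [hR] at hm
    simp only [Finset.mem_insert, Finset.mem_singleton] at hm
    rcases hm with h | h | h | h
    · rw [sq, pow_mul, h]
    · exact absurd (hinj h) hab
    · refine absurd ?_ (ndvd _ h3)
      rw [pow_succ, sq, pow_mul, h, inv_mul_cancel₀ ha0]
    · exact absurd (hinj h) had
  have ha2 : a ^ (q ^ 2 - 1) = 1 := by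
    refine mul_right_cancel₀ ha0 ?_
    rw [← pow_succ, Nat.sub_add_cancel (Nat.one_le_pow _ _ (by lia)), haq, one_mul]
  have hε : a ^ E * a ^ E = 1 := by
    obtain ⟨n, hn⟩ := h4
    rw [← pow_add, ← two_mul, hn, pow_mul, ha2, one_pow]
  have hε' : a ^ E = -1 := (mul_self_eq_one_iff.1 hε).resolve_left haE
  refine ⟨-1, Or.inr rfl, fun x hx => ?_⟩
  rw [hR] at hx
  simp only [Finset.mem_insert, Finset.mem_singleton] at hx
  have hi : a⁻¹ ^ E = -1 := by rw [inv_pow, hε', inv_neg, inv_one]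
  rcases hx with rfl | rfl | rfl | rfl
  · exact hε'
  · rw [pow_right_comm, hε', hneg]
  · exact hi
  · rw [pow_right_comm, hi, hneg]

variable {F Ω : Type*} [Field F] [Field Ω]

theorem det_scalar_inv_sub_eq_zero {g : Matrix (Fin 2 ⊕ Fin 2) (Fin 2 ⊕ Fin 2) Ω}
    (hg : g ∈ symplecticGroup (Fin 2) Ω) {μ : Ω} (hμ : μ ≠ 0)
    (h : (scalar (Fin 2 ⊕ Fin 2) μ - g).det = 0) :
    (scalar (Fin 2 ⊕ Fin 2) μ⁻¹ - g).det = 0 := by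
  have key : (scalar (Fin 2 ⊕ Fin 2) μ⁻¹ - g) * (J (Fin 2) Ω * gᵀ) =
      (-μ⁻¹) • (J (Fin 2) Ω * (scalar (Fin 2 ⊕ Fin 2) μ - g)ᵀ) := by
    rw [SymplecticGroup.mem_iff] at hg
    rw [sub_mul, ← mul_assoc g, hg, transpose_sub, mul_sub]
    simp only [scalar_apply, ← smul_one_eq_diagonal, transpose_smul, transpose_one, smul_mul,
      Matrix.mul_smul, one_mul, mul_one, smul_sub, smul_smul]
    rw [neg_mul, inv_mul_cancel₀ hμ]
    module
  have := congrArg det key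
  rw [det_mul, det_smul, det_mul _ (scalar _ μ - g)ᵀ, det_transpose, h, mul_zero, mul_zero, det_mul,
    det_transpose] at this
  refine (mul_eq_zero.1 this).resolve_right ?_
  rw [SymplecticGroup.det_eq_one hg, mul_one]
  exact (isUnit_det_J _ _).ne_zero

open Polynomial in
theorem dvd_pow_of_forall_root [IsAlgClosed Ω] {p r : Polynomial Ω} (hp : p.Monic)
    (h : ∀ x ∈ p.roots, r.IsRoot x) : p ∣ r ^ p.natDegree := by
  have hs := IsAlgClosed.splits p
  rw [hs.natDegree_eq_card_roots]
  nth_rw 1 [hs.eq_prod_roots_of_monic hp]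
  refine (Multiset.prod_dvd_prod_of_dvd _ (fun _ => r) fun x hx => dvd_iff_isRoot.2 (h x hx)).trans
    (dvd_of_eq ?_)
  rw [Multiset.map_const', Multiset.prod_replicate]

theorem exists_pow_sub_pow_four_eq_zero [Fintype F] {E : ℕ} (h1 : Fintype.card F - 1 ∣ E)
    (h2 : Fintype.card F + 1 ∣ E) (h3 : Fintype.card F ^ 2 + 1 ∣ E)
    (h4 : Fintype.card F ^ 2 - 1 ∣ 2 * E) {g : Matrix (Fin 2 ⊕ Fin 2) (Fin 2 ⊕ Fin 2) F}
    (hg : g ∈ symplecticGroup (Fin 2) F) :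
    ∃ ε : Matrix (Fin 2 ⊕ Fin 2) (Fin 2 ⊕ Fin 2) F, (ε = 1 ∨ ε = -1) ∧ (g ^ E - ε) ^ 4 = 0 := by
  classical
  let Ω := AlgebraicClosure F
  let G := g.map (algebraMap F Ω)
  have hG : G ∈ symplecticGroup (Fin 2) Ω := SymplecticGroup.map_mem hg (algebraMap F Ω)
  have hmap : G.charpoly = g.charpoly.map (algebraMap F Ω) := g.charpoly_map _
  have hmon : G.charpoly.Monic := G.charpoly_monic
  have hdeg : G.charpoly.natDegree = 4 := by simp
  have hroot : ∀ x : Ω, x ∈ G.charpoly.roots.toFinset ↔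
      (scalar (Fin 2 ⊕ Fin 2) x - G).det = 0 := fun x => by
    rw [Multiset.mem_toFinset, Polynomial.mem_roots hmon.ne_zero, Polynomial.IsRoot,
      eval_charpoly]
  have haeval : ∀ x : Ω, (scalar (Fin 2 ⊕ Fin 2) x - G).det = 0 ↔
      Polynomial.aeval x g.charpoly = 0 := fun x => by
    rw [← eval_charpoly, hmap, Polynomial.eval_map_algebraMap]
  have h0 : ∀ x ∈ G.charpoly.roots.toFinset, x ≠ 0 := by
    rintro x hx rfl
    rw [hroot, map_zero, zero_sub, det_neg, SymplecticGroup.det_eq_one hG] at hx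
    simp at hx
  obtain ⟨ε, hε, hE⟩ := exists_forall_pow_eq_of_stable (Ω := Ω) Fintype.one_lt_card
    (FiniteField.frobeniusAlgHom F Ω).injective
    (by simpa using map_neg (FiniteField.frobeniusAlgHom F Ω) 1) h1 h2 h3 h4
    (R := G.charpoly.roots.toFinset)
    ((Multiset.toFinset_card_le _).trans ((Polynomial.card_roots' _).trans hdeg.le)) h0
    (fun x hx => by
      rw [hroot, haeval] at hx ⊢
      have := Polynomial.aeval_algHom_apply (FiniteField.frobeniusAlgHom F Ω) x g.charpoly
      rwa [hx, map_zero] at this)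
    (fun x hx => (hroot _).2 (det_scalar_inv_sub_eq_zero hG (h0 x hx) ((hroot x).1 hx)))
  have hdvd := dvd_pow_of_forall_root hmon (r := Polynomial.X ^ E - Polynomial.C ε)
    fun x hx => by simp [hE x (Multiset.mem_toFinset.2 hx)]
  rw [hdeg] at hdvd
  obtain ⟨s, hs⟩ := hdvd
  have hz := congrArg (Polynomial.aeval G) hs
  rw [map_mul, aeval_self_charpoly, zero_mul] at hz
  simp only [map_pow, map_sub, Polynomial.aeval_X, Polynomial.aeval_C] at hz
  have hinj : Function.Injective
      ((algebraMap F Ω).mapMatrix (m := Fin 2 ⊕ Fin 2)) :=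
    Matrix.map_injective (algebraMap F Ω).injective
  rcases hε with rfl | rfl
  · refine ⟨1, Or.inl rfl, hinj ?_⟩
    simp only [map_pow, map_sub, map_one, map_zero] at hz ⊢
    exact hz
  · refine ⟨-1, Or.inr rfl, hinj ?_⟩
    simp only [map_pow, map_sub, map_neg, map_one, map_zero] at hz ⊢
    exact hz

theorem exponent_quotient_center_dvd [Fintype F] {p s E : ℕ} [Fact p.Prime] [CharP F p]
    (h1 : Fintype.card F - 1 ∣ E) (h2 : Fintype.card F + 1 ∣ E) (h3 : Fintype.card F ^ 2 + 1 ∣ E)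
    (h4 : Fintype.card F ^ 2 - 1 ∣ 2 * E) (hs : 4 ≤ p ^ s) :
    Monoid.exponent (symplecticGroup (Fin 2) F ⧸ Subgroup.center (symplecticGroup (Fin 2) F)) ∣
      E * p ^ s := by
  rw [Monoid.exponent_dvd_iff_forall_pow_eq_one]
  intro x
  obtain ⟨g, rfl⟩ := QuotientGroup.mk_surjective x
  rw [← QuotientGroup.mk_pow, QuotientGroup.eq_one_iff]
  apply mem_center_of_eq_one_or_neg_one
  obtain ⟨ε, hε, h⟩ := exists_pow_sub_pow_four_eq_zero h1 h2 h3 h4 g.2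
  have hc : Commute ((g : Matrix (Fin 2 ⊕ Fin 2) (Fin 2 ⊕ Fin 2) F) ^ E) ε := by
    rcases hε with rfl | rfl
    exacts [Commute.one_right _, (Commute.one_right _).neg_right]
  have := pow_eq_zero_of_le hs h
  rw [sub_pow_char_pow_of_commute _ _ hc, sub_eq_zero, ← pow_mul] at this
  rw [SubmonoidClass.coe_pow, this]
  rcases hε with rfl | rfl
  · exact Or.inl (one_pow _)
  · exact neg_one_pow_eq_or _ _

end Eigenvalues

end SymplecticFour

namespace SymplecticFour

open Matrix

section QuadraticField

open Polynomial in
theorem exists_field_ringHom_matrix.{w} {F : Type w} [Field F] [Fintype F] {a b : F}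
    (hab : ∀ x : F, x ^ 2 - a * x - b ^ 2 ≠ 0) :
    ∃ (K : Type w) (_ : Field K) (_ : Fintype K) (ι : K →+* Matrix (Fin 2) (Fin 2) F),
      Fintype.card K = Fintype.card F ^ 2 ∧
        ∀ x, (ι x)ᵀ = ι x ∧ ι x * !![a, b; b, 0] = !![a, b; b, 0] * ι x := by
  let f : F[X] := X ^ 2 - C a * X - C (b ^ 2)
  have hdeg : f.natDegree = 2 := by
    simp only [f]
    compute_degree!
  have hf : Irreducible f := by
    rw [irreducible_iff_roots_eq_zero_of_degree_le_three (by lia) (by lia),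
      Multiset.eq_zero_iff_forall_notMem]
    intro x hx
    exact hab x (by simpa [f] using (mem_roots'.1 hx).2)
  have : Fact (Irreducible f) := ⟨hf⟩
  set S := !![a, b; b, 0] with hS
  have hfS : aeval S f = 0 := by
    simp only [f, map_sub, map_mul, map_pow, aeval_X, aeval_C, hS]
    ext i j
    fin_cases i <;> fin_cases j <;>
      simp [sq, Algebra.algebraMap_eq_smul_one]
    ring
  let ι : AdjoinRoot f →+* Matrix (Fin 2) (Fin 2) F :=
    Ideal.Quotient.lift (Ideal.span {f}) (aeval S).toRingHom fun x hx => by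
      obtain ⟨y, rfl⟩ := Ideal.mem_span_singleton'.1 hx
      simp [hfS]
  have hι : ∀ r : F[X], ι (AdjoinRoot.mk f r) = aeval S r := fun r => rfl
  have : Module.Finite F (AdjoinRoot f) := (AdjoinRoot.powerBasis hf.ne_zero).finite
  have : Finite (AdjoinRoot f) := Module.finite_of_finite F
  let inst : Fintype (AdjoinRoot f) := Fintype.ofFinite _
  refine ⟨AdjoinRoot f, inferInstance, inst, ι, ?_, fun x => ?_⟩
  · rw [← Nat.card_eq_fintype_card, Module.natCard_eq_pow_finrank (K := F),
      (AdjoinRoot.powerBasis hf.ne_zero).finrank, AdjoinRoot.powerBasis_dim, hdeg,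
      Nat.card_eq_fintype_card]
  · obtain ⟨r, rfl⟩ := AdjoinRoot.mk_surjective x
    rw [hι]
    constructor
    · have hSt : Sᵀ = S := by ext i j; fin_cases i <;> fin_cases j <;> rfl
      rw [aeval_eq_sum_range, transpose_sum]
      simp only [transpose_smul, transpose_pow, hSt]
    · have h := congrArg (aeval S) (mul_comm r X)
      simpa only [map_mul, aeval_X] using h

end QuadraticField

section Embedding

variable {F K : Type*} [Field F] [Field K]

/-- The homomorphism of `2 × 2` matrices over `K` into `4 × 4` matrices over `F` replacing each
entry by a `2 × 2` block. -/
def blockHom (ι : K →+* Matrix (Fin 2) (Fin 2) F) :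
    Matrix (Fin 2) (Fin 2) K →* Matrix (Fin 2 ⊕ Fin 2) (Fin 2 ⊕ Fin 2) F where
  toFun M := fromBlocks (ι (M 0 0)) (ι (M 0 1)) (ι (M 1 0)) (ι (M 1 1))
  map_one' := by simp
  map_mul' M N := by
    rw [fromBlocks_multiply]
    simp [Matrix.mul_apply, Fin.sum_univ_two]

theorem blockHom_injective (ι : K →+* Matrix (Fin 2) (Fin 2) F) :
    Function.Injective (blockHom ι) := by
  intro M N h
  obtain ⟨h1, h2, h3, h4⟩ := fromBlocks_inj.1 h
  ext i j
  fin_cases i <;> fin_cases j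
  exacts [ι.injective h1, ι.injective h2, ι.injective h3, ι.injective h4]

theorem blockHom_mem {ι : K →+* Matrix (Fin 2) (Fin 2) F} (hι : ∀ x, (ι x)ᵀ = ι x)
    {M : Matrix (Fin 2) (Fin 2) K} (hM : M.det = 1) : blockHom ι M ∈ symplecticGroup (Fin 2) F := by
  rw [det_fin_two] at hM
  refine SymplecticGroup.fromBlocks_mem_iff.2 ⟨?_, ?_, ?_⟩
  all_goals simp only [hι, ← map_mul, ← map_sub]
  · rw [mul_comm]
  · rw [mul_comm]
  · rw [← map_one ι, ← hM]
    congr 1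
    ring

/-- The symplectic matrices which commute with the block diagonal matrix with blocks
`!![a, b; b, 0]`, or conjugate it to its conjugate root `a - !![a, b; b, 0]`. -/
def semilinearSubgroup (a b : F) : Subgroup (symplecticGroup (Fin 2) F) where
  carrier := {g | (g : Matrix (Fin 2 ⊕ Fin 2) (Fin 2 ⊕ Fin 2) F) *
      fromBlocks !![a, b; b, 0] 0 0 !![a, b; b, 0] =
        fromBlocks !![a, b; b, 0] 0 0 !![a, b; b, 0] * g ∨
      (g : Matrix (Fin 2 ⊕ Fin 2) (Fin 2 ⊕ Fin 2) F) *
      fromBlocks !![a, b; b, 0] 0 0 !![a, b; b, 0] =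
        (a • 1 - fromBlocks !![a, b; b, 0] 0 0 !![a, b; b, 0]) * g}
  one_mem' := Or.inl (by simp)
  mul_mem' {g h} hg hh := by
    simp only [Set.mem_ofPred_eq, Submonoid.coe_mul] at hg hh ⊢
    set D := fromBlocks !![a, b; b, 0] 0 0 !![a, b; b, 0]
    generalize (g : Matrix (Fin 2 ⊕ Fin 2) (Fin 2 ⊕ Fin 2) F) = g at *
    generalize (h : Matrix (Fin 2 ⊕ Fin 2) (Fin 2 ⊕ Fin 2) F) = h at *
    have hg' : g * (a • 1 - D) = a • g - g * D := by simp [mul_sub]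
    have hd : ∀ g, (a • 1 - D) * g = a • g - D * g := fun g => by simp [sub_mul]
    rcases hh with hh | hh <;> rcases hg with hg | hg <;> rw [mul_assoc, hh, ← mul_assoc]
    · exact Or.inl (by rw [hg, mul_assoc])
    · exact Or.inr (by rw [hg, mul_assoc])
    · exact Or.inr (by rw [hg', hg, ← hd, mul_assoc])
    · exact Or.inl (by rw [hg', hg, hd, sub_sub_cancel, mul_assoc])
  inv_mem' {g} hg := by
    simp only [Set.mem_ofPred_eq] at hg ⊢
    set D := fromBlocks !![a, b; b, 0] 0 0 !![a, b; b, 0]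
    have h1 : (g : Matrix (Fin 2 ⊕ Fin 2) (Fin 2 ⊕ Fin 2) F) *
        (g⁻¹ : symplecticGroup (Fin 2) F) = 1 :=
      congrArg Subtype.val (mul_inv_cancel g)
    have h2 : ((g⁻¹ : symplecticGroup (Fin 2) F) :
        Matrix (Fin 2 ⊕ Fin 2) (Fin 2 ⊕ Fin 2) F) * g = 1 :=
      congrArg Subtype.val (inv_mul_cancel g)
    generalize ((g⁻¹ : symplecticGroup (Fin 2) F) :
      Matrix (Fin 2 ⊕ Fin 2) (Fin 2 ⊕ Fin 2) F) = k at *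
    generalize (g : Matrix (Fin 2 ⊕ Fin 2) (Fin 2 ⊕ Fin 2) F) = g at *
    have key : ∀ X, g * D = X * g → D * k = k * X := fun X hX => by
      rw [← one_mul (D * k), ← h2, mul_assoc, ← mul_assoc g, hX, mul_assoc, h1, mul_one]
    rcases hg with hg | hg
    · exact Or.inl (key _ hg).symm
    · refine Or.inr ?_
      rw [sub_mul, key _ hg]
      simp [mul_sub]

theorem center_le_semilinearSubgroup (a b : F) :
    Subgroup.center (symplecticGroup (Fin 2) F) ≤ semilinearSubgroup a b := by
  intro z hz
  rcases eq_one_or_neg_one_of_mem_center hz with h | h <;> exact Or.inl (by simp [h])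

theorem semilinearSubgroup_ne_top {a b : F} (ha : a ≠ 0) (hb : b ≠ 0) :
    semilinearSubgroup a b ≠ ⊤ := by
  intro h
  have hm : (⟨fromBlocks 1 !![1, 0; 0, 0] 0 1, upper_mem_symplecticGroup
    (by ext i j; fin_cases i <;> fin_cases j <;> rfl)⟩ : symplecticGroup (Fin 2) F) ∈
      semilinearSubgroup a b := h ▸ Subgroup.mem_top _
  rcases hm with hm | hm
  · have := congrFun (congrFun hm (Sum.inl 0)) (Sum.inr 1)
    simp [Matrix.mul_apply] at this
    exact hb this
  · have := congrFun (congrFun hm (Sum.inl 0)) (Sum.inl 0)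
    rw [sub_mul] at this
    simp [Matrix.mul_apply] at this
    exact ha this

theorem map_semilinearSubgroup_ne_top {a b : F} (ha : a ≠ 0) (hb : b ≠ 0) :
    (semilinearSubgroup a b).map
      (QuotientGroup.mk' (Subgroup.center (symplecticGroup (Fin 2) F))) ≠ ⊤ := by
  intro h
  apply semilinearSubgroup_ne_top ha hb
  rw [← Subgroup.comap_map_eq_self
    (f := QuotientGroup.mk' (Subgroup.center (symplecticGroup (Fin 2) F)))
    (H := semilinearSubgroup a b), h, Subgroup.comap_top]
  rw [QuotientGroup.ker_mk']
  exact center_le_semilinearSubgroup a b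

theorem blockHom_mem_semilinearSubgroup {a b : F} {ι : K →+* Matrix (Fin 2) (Fin 2) F}
    (hι : ∀ x, (ι x)ᵀ = ι x) (hc : ∀ x, ι x * !![a, b; b, 0] = !![a, b; b, 0] * ι x)
    {M : Matrix (Fin 2) (Fin 2) K} (hM : M.det = 1) :
    ⟨blockHom ι M, blockHom_mem hι hM⟩ ∈ semilinearSubgroup a b := by
  left
  simp only [blockHom, MonoidHom.coe_mk, OneHom.coe_mk, fromBlocks_multiply, hc, mul_zero, zero_mul,
    add_zero, zero_add]

end Embedding

end SymplecticFour

namespace SymplecticFour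

open Matrix

section SpecialLinear

variable {K : Type*} [Field K]

theorem dvd_of_upper_pow_eq_one {p k : ℕ} [CharP K p]
    (h : (!![1, 1; 0, 1] : Matrix (Fin 2) (Fin 2) K) ^ k = 1) : p ∣ k := by
  have hpow : ∀ n : ℕ, (!![1, 1; 0, 1] : Matrix (Fin 2) (Fin 2) K) ^ n = !![1, (n : K); 0, 1] := by
    intro n
    induction n with
    | zero => simp [one_fin_two]
    | succ n ih => simp [pow_succ, ih, add_comm]
  rw [hpow] at h
  rw [← CharP.cast_eq_zero_iff K]
  simpa using congrFun (congrFun h 0) 1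

theorem card_sub_one_dvd_of_forall_pow_eq_one [Fintype K] {k : ℕ}
    (h : ∀ M : Matrix (Fin 2) (Fin 2) K, M.det = 1 → M ^ k = 1) : Fintype.card K - 1 ∣ k := by
  classical
  rw [← Fintype.card_units, ← Nat.card_eq_fintype_card, ← IsCyclic.exponent_eq_card]
  rw [Monoid.exponent_dvd_iff_forall_pow_eq_one]
  intro x
  have := h (diagonal ![(x : K), (x : K)⁻¹]) (by simp)
  rw [diagonal_pow] at this
  ext1
  simpa using congrFun (congrFun this 0) 0

theorem exists_algebraMap_eq_of_pow_card_eq [Fintype K] {L : Type*} [Field L] [Algebra K L] {x : L}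
    (hx : x ^ Fintype.card K = x) : ∃ y, algebraMap K L y = x := by
  classical
  let p : Polynomial L := Polynomial.X ^ Fintype.card K - Polynomial.X
  have hp : p ≠ 0 := FiniteField.X_pow_card_sub_X_ne_zero L Fintype.one_lt_card
  have hsub : Finset.univ.image (algebraMap K L) ⊆ p.roots.toFinset := by
    intro y hy
    obtain ⟨z, -, rfl⟩ := Finset.mem_image.1 hy
    rw [Multiset.mem_toFinset, Polynomial.mem_roots hp]
    simp [p, ← map_pow, FiniteField.pow_card]
  have heq := Finset.eq_of_subset_of_card_le hsub (by
    rw [Finset.card_image_of_injective _ (algebraMap K L).injective, Finset.card_univ,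
      ← FiniteField.X_pow_card_sub_X_natDegree_eq L (Fintype.one_lt_card (α := K))]
    exact (Multiset.toFinset_card_le _).trans (Polynomial.card_roots' _))
  have hx' : x ∈ p.roots.toFinset := by
    rw [Multiset.mem_toFinset, Polynomial.mem_roots hp]
    simp [p, hx]
  rw [← heq] at hx'
  obtain ⟨y, -, hy⟩ := Finset.mem_image.1 hx'
  exact ⟨y, hy⟩

theorem dvd_of_isPrimitiveRoot_of_forall_pow_eq_one [Fintype K] {L : Type*} [Field L] [Algebra K L]
    {ζ : L} (hζ : IsPrimitiveRoot ζ (Fintype.card K + 1)) {k : ℕ}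
    (h : ∀ M : Matrix (Fin 2) (Fin 2) K, M.det = 1 → M ^ k = 1) : Fintype.card K + 1 ∣ k := by
  have h0 : ζ ≠ 0 := hζ.ne_zero (Nat.succ_ne_zero _)
  have hinv : ζ ^ Fintype.card K = ζ⁻¹ := by
    refine mul_right_cancel₀ h0 ?_
    rw [← pow_succ, hζ.pow_eq_one, inv_mul_cancel₀ h0]
  have hadd := map_add (FiniteField.frobeniusAlgHom K L) ζ ζ⁻¹
  simp only [FiniteField.coe_frobeniusAlgHom, inv_pow, hinv, inv_inv] at hadd
  obtain ⟨c, hc⟩ := exists_algebraMap_eq_of_pow_card_eq (K := K) (hadd.trans (add_comm _ _))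
  have hM := h !![0, -1; 1, c] (by simp [det_fin_two])
  have key : ∀ n : ℕ, ![1, ζ] ᵥ* ((!![0, -1; 1, c] : Matrix (Fin 2) (Fin 2) K).map
      (algebraMap K L)) ^ n = ζ ^ n • ![1, ζ] := by
    intro n
    induction n with
    | zero => simp
    | succ n ih =>
      rw [pow_succ, ← vecMul_vecMul, ih, smul_vecMul, pow_succ, mul_smul]
      congr 1
      ext i
      fin_cases i
      · simp [vecMul, dotProduct, Fin.sum_univ_two]
      · simp [vecMul, dotProduct, Fin.sum_univ_two, hc, mul_add, mul_inv_cancel₀ h0]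
  have hk := key k
  rw [← RingHom.mapMatrix_apply, ← map_pow, hM, map_one, vecMul_one] at hk
  refine (hζ.pow_eq_one_iff_dvd k).1 ?_
  simpa using (congrFun hk 0).symm

theorem card_add_one_dvd_of_forall_pow_eq_one [Fintype K] {k : ℕ}
    (h : ∀ M : Matrix (Fin 2) (Fin 2) K, M.det = 1 → M ^ k = 1) : Fintype.card K + 1 ∣ k := by
  have : NeZero ((Fintype.card K + 1 : ℕ) : AlgebraicClosure K) := ⟨by
    rw [Nat.cast_add, ← map_natCast (algebraMap K (AlgebraicClosure K)),
      FiniteField.cast_card_eq_zero]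
    simp⟩
  obtain ⟨ζ, hζ⟩ :=
    HasEnoughRootsOfUnity.exists_primitiveRoot (AlgebraicClosure K) (Fintype.card K + 1)
  exact dvd_of_isPrimitiveRoot_of_forall_pow_eq_one hζ h

end SpecialLinear

end SymplecticFour

namespace SymplecticFour

open Matrix

section Exponent

variable {F : Type*} [Field F]

theorem pow_mem_center_of_exponent_map {H : Subgroup (symplecticGroup (Fin 2) F)}
    {g : symplecticGroup (Fin 2) F} (hg : g ∈ H) :
    g ^ Monoid.exponent (H.map (QuotientGroup.mk' (Subgroup.center (symplecticGroup (Fin 2) F)))) ∈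
      Subgroup.center (symplecticGroup (Fin 2) F) := by
  rw [← QuotientGroup.eq_one_iff, QuotientGroup.mk_pow]
  exact congrArg Subtype.val (Monoid.pow_exponent_eq_one
    (⟨_, Subgroup.mem_map_of_mem _ hg⟩ : H.map (QuotientGroup.mk' _)))

theorem exponent_subgroup_dvd {G : Type*} [Group G] (H : Subgroup G) :
    Monoid.exponent H ∣ Monoid.exponent G :=
  Monoid.exponent_dvd_of_monoidHom H.subtype H.subtype_injective

variable [Fintype F]

theorem exists_quadratic_of_ringChar_ne_two (hF : ringChar F ≠ 2) :
    ∃ a b : F, a ≠ 0 ∧ b ≠ 0 ∧ ∀ x : F, x ^ 2 - a * x - b ^ 2 ≠ 0 := by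
  have h2 : (2 : F) ≠ 0 := Ring.two_ne_zero hF
  obtain ⟨z, hz⟩ := FiniteField.exists_nonsquare hF
  obtain ⟨x, y, hxy⟩ := FiniteField.exists_root_sum_quadratic
    (f := (Polynomial.X ^ 2 : Polynomial F)) (g := Polynomial.X ^ 2 - Polynomial.C z)
    (Polynomial.degree_X_pow 2) (Polynomial.degree_X_pow_sub_C (by decide) _)
    (FiniteField.odd_card_of_char_ne_two hF)
  have hxyz : x ^ 2 + y ^ 2 = z := by
    simp at hxy
    linear_combination hxy
  refine ⟨x, y / 2, ?_, div_ne_zero ?_ h2, fun t ht => hz ⟨2 * t - x, ?_⟩⟩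
  · rintro rfl
    exact hz ⟨y, by rw [← hxyz]; ring⟩
  · rintro rfl
    exact hz ⟨x, by rw [← hxyz]; ring⟩
  · field_simp at ht
    linear_combination -ht - hxyz

theorem exists_quadratic_of_charP_two [CharP F 2] :
    ∃ b : F, b ≠ 0 ∧ ∀ x : F, x ^ 2 - 1 * x - b ^ 2 ≠ 0 := by
  have hinj : ¬ Function.Injective fun x : F => x ^ 2 - x := fun h =>
    zero_ne_one (h (a₁ := (0 : F)) (a₂ := 1) (by simp))
  rw [Finite.injective_iff_surjective] at hinj
  simp only [Function.Surjective, not_forall, not_exists] at hinj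
  obtain ⟨c, hc⟩ := hinj
  obtain ⟨b, rfl⟩ := FiniteField.isSquare_of_char_two (ringChar.eq F 2 : ringChar F = 2) c
  refine ⟨b, ?_, fun x hx => hc x (by linear_combination hx)⟩
  rintro rfl
  exact hc 0 (by simp)

theorem dvd_of_forall_pow_mem_center {p k : ℕ} [CharP F p] {a b : F}
    (hab : ∀ x : F, x ^ 2 - a * x - b ^ 2 ≠ 0)
    (h : ∀ g ∈ semilinearSubgroup a b, g ^ k ∈ Subgroup.center (symplecticGroup (Fin 2) F)) :
    Fintype.card F ^ 2 - 1 ∣ k * 2 ∧ Fintype.card F ^ 2 + 1 ∣ k * 2 ∧ p ∣ k * 2 := by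
  obtain ⟨K, _, _, ι, hK, hι⟩ := exists_field_ringHom_matrix hab
  have hCM : CharP (Matrix (Fin 2) (Fin 2) F) p := inferInstance
  have : CharP K p := ι.charP ι.injective p
  have key : ∀ M : Matrix (Fin 2) (Fin 2) K, M.det = 1 → M ^ (k * 2) = 1 := fun M hM => by
    have h1 := sq_eq_one_of_mem_center
      (h _ (blockHom_mem_semilinearSubgroup (fun x => (hι x).1) (fun x => (hι x).2) hM))
    rw [← pow_mul] at h1
    apply blockHom_injective ι
    rw [map_pow, map_one]
    exact congrArg Subtype.val h1
  rw [← hK]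
  exact ⟨card_sub_one_dvd_of_forall_pow_eq_one key, card_add_one_dvd_of_forall_pow_eq_one key,
    dvd_of_upper_pow_eq_one (K := K) (key _ (by simp [det_fin_two]))⟩

omit [Fintype F] in
theorem four_dvd_of_forall_pow_mem_center [CharP F 2] {k : ℕ} {b : F}
    (h : ∀ g ∈ semilinearSubgroup 1 b, g ^ k ∈ Subgroup.center (symplecticGroup (Fin 2) F)) :
    4 ∣ k := by
  have h2 : (2 : F) = 0 := CharTwo.two_eq_zero
  set S := !![1, b; b, 0] with hS
  set P : Matrix (Fin 2) (Fin 2) F := !![0, 1; 1, 0] with hP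
  have hSt : Sᵀ = S := by ext i j; fin_cases i <;> fin_cases j <;> rfl
  have hPt : Pᵀ = P := by ext i j; fin_cases i <;> fin_cases j <;> rfl
  have hPP : P * P = 1 := by ext i j; fin_cases i <;> fin_cases j <;> simp [hP, Matrix.mul_apply]
  have hPS : P * S = (1 - S) * P := by
    ext i j
    fin_cases i <;> fin_cases j <;>
      simp [hP, hS, Matrix.mul_apply, sub_mul, CharTwo.neg_eq]
  have hmem : fromBlocks P (P * S) 0 P ∈ symplecticGroup (Fin 2) F := by
    rw [SymplecticGroup.fromBlocks_mem_iff]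
    simp only [hPt, hSt, hPP, transpose_mul, transpose_zero, mul_zero, zero_mul, sub_zero, true_and,
      and_true]
    rw [mul_assoc, hPP, ← mul_assoc, hPP, mul_one, one_mul]
  set g : symplecticGroup (Fin 2) F := ⟨_, hmem⟩ with hg
  have hsq : (g : Matrix (Fin 2 ⊕ Fin 2) (Fin 2 ⊕ Fin 2) F) ^ 2 = fromBlocks 1 1 0 1 := by
    rw [hg, sq, fromBlocks_multiply, hPP, ← mul_assoc, hPP, hPS, mul_assoc (1 - S) P P, hPP]
    simp
  have hone : (-1 : Matrix (Fin 2 ⊕ Fin 2) (Fin 2 ⊕ Fin 2) F) = 1 := CharTwo.neg_eq 1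
  have hord : orderOf (g : Matrix (Fin 2 ⊕ Fin 2) (Fin 2 ⊕ Fin 2) F) = 4 := by
    refine (orderOf_eq_prime_pow (p := 2) (n := 1) ?_ ?_).trans (by norm_num)
    · rw [pow_one, hsq, ← fromBlocks_one, fromBlocks_inj]
      simp
    · rw [show 2 ^ (1 + 1) = 2 * 2 by rfl, pow_mul, hsq, sq, fromBlocks_multiply]
      simp [← fromBlocks_one, CharTwo.add_self_eq_zero]
  have hgk := eq_one_or_neg_one_of_mem_center (h g (Or.inr ?_))
  · rw [hone, or_self, SubmonoidClass.coe_pow] at hgk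
    rw [← hord]
    exact orderOf_dvd_of_pow_eq_one hgk
  · rw [← hS, hg, one_smul, ← fromBlocks_one, sub_eq_add_neg, fromBlocks_neg, fromBlocks_add,
      ← sub_eq_add_neg, fromBlocks_multiply,
      fromBlocks_multiply]
    simp [hPS, mul_assoc]

theorem exists_exponent_eq_of_charP_two [CharP F 2] :
    ∃ H : Subgroup (symplecticGroup (Fin 2) F ⧸ Subgroup.center (symplecticGroup (Fin 2) F)),
      H ≠ ⊤ ∧ Monoid.exponent H = Monoid.exponent
        (symplecticGroup (Fin 2) F ⧸ Subgroup.center (symplecticGroup (Fin 2) F)) := by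
  obtain ⟨b, hb, hab⟩ := exists_quadratic_of_charP_two (F := F)
  refine ⟨_, map_semilinearSubgroup_ne_top one_ne_zero hb,
    Nat.dvd_antisymm (exponent_subgroup_dvd _) ?_⟩
  have hpow := fun g hg => pow_mem_center_of_exponent_map (H := semilinearSubgroup (1 : F) b)
    (g := g) hg
  obtain ⟨h1, h2, -⟩ := dvd_of_forall_pow_mem_center (p := 2) hab hpow
  have h4 := four_dvd_of_forall_pow_mem_center hpow
  generalize Monoid.exponent (Subgroup.map
    (QuotientGroup.mk' (Subgroup.center (symplecticGroup (Fin 2) F)))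
      (semilinearSubgroup 1 b)) = k at *
  have heven : 2 ∣ Fintype.card F := by
    rw [← CharP.cast_eq_zero_iff F 2, FiniteField.cast_card_eq_zero]
  have hq1 : 1 < Fintype.card F := Fintype.one_lt_card
  generalize hq : Fintype.card F = q at *
  have : Fact (Nat.Prime 2) := ⟨Nat.prime_two⟩
  obtain ⟨m, hm⟩ : ∃ m, q ^ 2 = 2 * m + 2 := by
    obtain ⟨n, rfl⟩ := heven
    exact ⟨2 * n ^ 2 - 1, by have := Nat.one_le_pow 2 n (by lia); ring_nf; lia⟩
  have hE : (q - 1) * (q + 1) = q ^ 2 - 1 := by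
    rw [mul_comm, ← Nat.sq_sub_sq, one_pow]
  have c1 : Nat.Coprime (q ^ 2 - 1) 2 := by
    rw [hm, show 2 * m + 2 - 1 = 1 + 2 * m by lia]; simp
  have c2 : Nat.Coprime (q ^ 2 + 1) 2 := by
    rw [hm, show 2 * m + 2 + 1 = 1 + 2 * (m + 1) by ring]; simp
  have c3 : Nat.Coprime (q ^ 2 - 1) (q ^ 2 + 1) := by
    rw [show q ^ 2 + 1 = 2 + 1 * (q ^ 2 - 1) by lia]
    simpa using c1
  refine (exponent_quotient_center_dvd (E := (q ^ 2 - 1) * (q ^ 2 + 1)) (p := 2) (s := 2)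
    ?_ ?_ ?_ ?_ le_rfl).trans ?_
  · rw [hq]; exact (Dvd.intro _ hE).mul_right _
  · rw [hq]; exact (Dvd.intro_left _ hE).mul_right _
  · rw [hq]; exact Dvd.intro_left _ rfl
  · rw [hq]; exact (Dvd.intro _ rfl).mul_left _
  · exact ((Nat.Coprime.mul_left c1 c2).pow_right 2).mul_dvd_of_dvd_of_dvd
      (c3.mul_dvd_of_dvd_of_dvd (c1.dvd_of_dvd_mul_right h1) (c2.dvd_of_dvd_mul_right h2)) h4

theorem exists_exponent_eq_of_five_le {p : ℕ} [Fact p.Prime] [CharP F p] (hp : 5 ≤ p) :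
    ∃ H : Subgroup (symplecticGroup (Fin 2) F ⧸ Subgroup.center (symplecticGroup (Fin 2) F)),
      H ≠ ⊤ ∧ Monoid.exponent H = Monoid.exponent
        (symplecticGroup (Fin 2) F ⧸ Subgroup.center (symplecticGroup (Fin 2) F)) := by
  have hpp : p.Prime := Fact.out
  have hF : ringChar F ≠ 2 := by rw [ringChar.eq F p]; lia
  obtain ⟨a, b, ha, hb, hab⟩ := exists_quadratic_of_ringChar_ne_two hF
  refine ⟨_, map_semilinearSubgroup_ne_top ha hb,
    Nat.dvd_antisymm (exponent_subgroup_dvd _) ?_⟩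
  obtain ⟨h1, h2, h3⟩ := dvd_of_forall_pow_mem_center (p := p) hab
    fun g hg => pow_mem_center_of_exponent_map (H := semilinearSubgroup a b) (g := g) hg
  generalize Monoid.exponent (Subgroup.map
    (QuotientGroup.mk' (Subgroup.center (symplecticGroup (Fin 2) F)))
      (semilinearSubgroup a b)) = k at *
  have hp3 : p ∣ k := by
    refine Nat.Coprime.dvd_of_dvd_mul_right ?_ h3
    rw [Nat.coprime_primes hpp Nat.prime_two]
    lia
  have hpq : p ∣ Fintype.card F := by
    rw [← CharP.cast_eq_zero_iff F p, FiniteField.cast_card_eq_zero]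
  obtain ⟨n, hn⟩ := Nat.odd_iff.2 (FiniteField.odd_card_of_char_ne_two hF)
  obtain ⟨m, hm⟩ := (Nat.even_mul_succ_self n).two_dvd
  rw [hn] at h1 h2 hpq
  have e1 : (2 * n + 1) ^ 2 = 8 * m + 1 := by linear_combination 4 * hm
  have e2 : (8 * m + 1 : ℕ) - 1 = 8 * m := rfl
  rw [e1, e2] at h1
  rw [e1] at h2
  have h1' : 4 * m ∣ k := Nat.dvd_of_mul_dvd_mul_right two_pos (by convert! h1 using 1; ring)
  have h2' : 4 * m + 1 ∣ k := Nat.dvd_of_mul_dvd_mul_right two_pos (by convert! h2 using 1; ring)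
  have hcop : Nat.Coprime (4 * m * (4 * m + 1)) p := by
    refine ((Nat.Prime.coprime_iff_not_dvd hpp).2 fun hd => hpp.one_lt.ne' ?_).symm
    have hq2 : p ∣ (8 * m + 1) ^ 2 := e1 ▸ (hpq.pow (by decide : 2 ≠ 0)).pow (by decide : 2 ≠ 0)
    refine Nat.dvd_one.1 ((Nat.dvd_add_right (hd.mul_left 4)).1 ?_)
    convert! hq2 using 1
    ring
  refine (exponent_quotient_center_dvd (E := 4 * m * (4 * m + 1)) (p := p) (s := 1) ?_ ?_ ?_ ?_
    (by lia)).trans ?_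
  · rw [hn]
    refine Dvd.dvd.mul_right ⟨n + 1, ?_⟩ _
    rw [Nat.add_sub_cancel]
    linear_combination 2 * hm.symm
  · rw [hn]
    exact Dvd.dvd.mul_right ⟨n, by linear_combination 2 * hm.symm⟩ _
  · rw [hn, e1]
    exact ⟨2 * m, by ring⟩
  · rw [hn, e1, e2]
    exact ⟨4 * m + 1, by ring⟩
  · rw [pow_one]
    exact hcop.mul_dvd_of_dvd_of_dvd (Nat.Coprime.mul_dvd_of_dvd_of_dvd (by simp) h1' h2') hp3

end Exponent

end SymplecticFour

namespace SymplecticFour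

open Matrix
open LinearMap (BilinForm)

section Standard

variable {F : Type*} [Field F]

/-- The standard symplectic form on `F ^ 4`. -/
noncomputable def standardForm (F : Type*) [Field F] : BilinForm F (Fin 2 ⊕ Fin 2 → F) :=
  Matrix.toBilin' (J (Fin 2) F)

theorem isSymplecticFour_standardForm : IsSymplecticFour (standardForm F) where
  alt x := by
    rw [standardForm, Matrix.toBilin'_apply']
    simp [J, dotProduct, mulVec, Fintype.sum_sum_type, Fin.sum_univ_two]
    ring
  nondegenerate :=
    LinearMap.BilinForm.nondegenerate_toBilin'_of_det_ne_zero' _ (isUnit_det_J _ _).ne_zero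
  finrank_eq := by simp

/-- The action of the symplectic group on column vectors. -/
def toLinearEquivHom (F : Type*) [Field F] :
    symplecticGroup (Fin 2) F →* ((Fin 2 ⊕ Fin 2 → F) ≃ₗ[F] (Fin 2 ⊕ Fin 2 → F)) where
  toFun g := LinearEquiv.ofLinearMap (mulVecLin (g : Matrix (Fin 2 ⊕ Fin 2) (Fin 2 ⊕ Fin 2) F))
    (mulVecLin ((g⁻¹ : symplecticGroup (Fin 2) F) : Matrix (Fin 2 ⊕ Fin 2) (Fin 2 ⊕ Fin 2) F))
    (by rw [← mulVecLin_mul, ← Submonoid.coe_mul, mul_inv_cancel, Submonoid.coe_one, mulVecLin_one])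
    (by rw [← mulVecLin_mul, ← Submonoid.coe_mul, inv_mul_cancel, Submonoid.coe_one, mulVecLin_one])
  map_one' := by ext1 x; simp
  map_mul' g h := by ext1 x; simp [LinearEquiv.mul_apply]

theorem toLinearEquivHom_apply (g : symplecticGroup (Fin 2) F) (x : Fin 2 ⊕ Fin 2 → F) :
    toLinearEquivHom F g x = (g : Matrix (Fin 2 ⊕ Fin 2) (Fin 2 ⊕ Fin 2) F) *ᵥ x := rfl

theorem toLinearEquivHom_injective : Function.Injective (toLinearEquivHom F) := by
  intro g h hgh
  ext1
  refine mulVec_injective (funext fun x => ?_)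
  exact LinearEquiv.congr_fun hgh x

theorem standardForm_toLinearEquivHom (g : symplecticGroup (Fin 2) F) (x y : Fin 2 ⊕ Fin 2 → F) :
    standardForm F (toLinearEquivHom F g x) (toLinearEquivHom F g y) = standardForm F x y := by
  have hg := SymplecticGroup.mem_iff'.1 g.2
  simp only [standardForm, Matrix.toBilin'_apply', toLinearEquivHom_apply]
  nth_rw 2 [← hg]
  rw [mulVec_mulVec, dotProduct_mulVec, vecMul_mulVec, ← dotProduct_mulVec, mul_assoc]

variable [Fintype F] [CharP F 3]

theorem eq_top_of_forall_exists_orderOf_eq {H : Subgroup (symplecticGroup (Fin 2) F)}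
    {u : symplecticGroup (Fin 2) F} (hu : u ∈ H) (hpow : ∃ n, u ^ 3 ^ n = 1) (h3 : u ^ 3 ≠ 1)
    (hord : ∀ r f : ℕ, r.Prime → r ^ f ∣ (Fintype.card F ^ 2 + 1) / 2 →
      ∃ t ∈ H, orderOf t = r ^ f) : H = ⊤ := by
  rw [Subgroup.eq_top_iff']
  intro g
  obtain ⟨n, hn⟩ := hpow
  obtain ⟨v, hv⟩ := exists_regularUnipotentData (H := H.map (toLinearEquivHom F))
    (u := toLinearEquivHom F u) isSymplecticFour_standardForm
    (by
      rintro _ ⟨h, -, rfl⟩ x y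
      exact standardForm_toLinearEquivHom h x y)
    (Subgroup.mem_map_of_mem _ hu) ⟨n, by rw [← map_pow, hn, map_one]⟩
    (fun h => h3 (toLinearEquivHom_injective (by rw [map_pow, h, map_one])))
    (fun r f hr hf => by
      obtain ⟨t, ht, hto⟩ := hord r f hr hf
      exact ⟨_, Subgroup.mem_map_of_mem _ ht,
        (orderOf_injective _ toLinearEquivHom_injective t).trans hto⟩)
  obtain ⟨h, hh, hhg⟩ := hv.mem_of_isometry _ (standardForm_toLinearEquivHom g)
  exact toLinearEquivHom_injective hhg ▸ hh

omit [Fintype F] in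
theorem exists_orderOf_eq_nine : ∃ u : symplecticGroup (Fin 2) F, orderOf u = 9 := by
  have h3 : (3 : F) = 0 := CharP.ofNat_eq_zero F 3
  have hmem : fromBlocks !![1, 1; 0, 1] !![0, 1; 0, 1] 0 !![1, 0; -1, 1] ∈
      symplecticGroup (Fin 2) F := by
    rw [SymplecticGroup.fromBlocks_mem_iff]
    refine ⟨by simp, ?_, ?_⟩ <;>
    · ext i j
      fin_cases i <;> fin_cases j <;> simp [Matrix.mul_apply, Fin.sum_univ_two]
  have hcube : (fromBlocks !![1, 1; 0, 1] !![0, 1; 0, 1] 0 !![1, 0; -1, 1] :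
      Matrix (Fin 2 ⊕ Fin 2) (Fin 2 ⊕ Fin 2) F) ^ 3 = fromBlocks 1 !![-1, 0; 0, 0] 0 1 := by
    rw [pow_succ, sq, fromBlocks_multiply, fromBlocks_multiply, fromBlocks_inj]
    refine ⟨?_, ?_, by simp, ?_⟩ <;>
    · ext i j
      fin_cases i <;> fin_cases j <;> simp <;> grind
  refine ⟨⟨_, hmem⟩, (orderOf_eq_prime_pow (p := 3) (n := 1) ?_ ?_).trans (by norm_num)⟩
  · intro h
    have h := congrArg Subtype.val h
    rw [pow_one, SubmonoidClass.coe_pow, hcube] at h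
    simpa using congrFun (congrFun h (Sum.inl 0)) (Sum.inr 0)
  · ext1
    rw [SubmonoidClass.coe_pow, show 3 ^ (1 + 1) = 3 * 3 by rfl, pow_mul, hcube, pow_succ, sq,
      fromBlocks_multiply, fromBlocks_multiply]
    refine (fromBlocks_inj.2 ⟨by simp, ?_, by simp, by simp⟩).trans fromBlocks_one
    ext i j
    fin_cases i <;> fin_cases j <;> simp
    grind

omit [CharP F 3] in
theorem exists_mem_orderOf_eq_pow_factorization
    {H : Subgroup (symplecticGroup (Fin 2) F ⧸ Subgroup.center (symplecticGroup (Fin 2) F))}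
    {r : ℕ} (hr : r.Prime) (h2 : r ≠ 2) :
    ∃ t ∈ H.comap (QuotientGroup.mk' _), orderOf t = r ^ (Monoid.exponent H).factorization r := by
  have : Finite (symplecticGroup (Fin 2) F) := Subtype.finite
  obtain ⟨⟨x, hx⟩, hxo⟩ := hr.exists_orderOf_eq_pow_factorization_exponent H
  obtain ⟨g, rfl⟩ := QuotientGroup.mk_surjective x
  rw [Subgroup.orderOf_mk] at hxo
  have hc : Nat.Coprime (r ^ (Monoid.exponent H).factorization r) 2 :=
    ((Nat.coprime_primes hr Nat.prime_two).2 h2).pow_left _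
  refine ⟨g ^ 2, Subgroup.pow_mem _ hx 2, Nat.dvd_antisymm ?_ (hc.dvd_of_dvd_mul_left ?_)⟩
  · rw [orderOf_dvd_iff_pow_eq_one, pow_right_comm]
    apply sq_eq_one_of_mem_center
    rw [← QuotientGroup.eq_one_iff, QuotientGroup.mk_pow, ← hxo, pow_orderOf_eq_one]
  · rw [← hxo, orderOf_dvd_iff_pow_eq_one, ← QuotientGroup.mk_pow, pow_mul, pow_orderOf_eq_one]
    rfl

theorem eq_top_of_exponent_eq
    {H : Subgroup (symplecticGroup (Fin 2) F ⧸ Subgroup.center (symplecticGroup (Fin 2) F))}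
    (hH : Monoid.exponent H = Monoid.exponent
      (symplecticGroup (Fin 2) F ⧸ Subgroup.center (symplecticGroup (Fin 2) F))) : H = ⊤ := by
  have hfin : Finite (symplecticGroup (Fin 2) F) := Subtype.finite
  have hE0 : Monoid.exponent H ≠ 0 := Monoid.exponent_ne_zero_of_finite
  have hpow : ∀ g : symplecticGroup (Fin 2) F,
      g ^ Monoid.exponent H ∈ Subgroup.center (symplecticGroup (Fin 2) F) := fun g => by
    rw [hH, ← QuotientGroup.eq_one_iff, QuotientGroup.mk_pow, Monoid.pow_exponent_eq_one]
  obtain ⟨a, b, -, -, hab⟩ := exists_quadratic_of_ringChar_ne_two (F := F)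
    (by rw [ringChar.eq F 3]; decide)
  obtain ⟨-, hm, -⟩ := dvd_of_forall_pow_mem_center (p := 3) hab fun g _ => hpow g
  obtain ⟨w, hw⟩ := exists_orderOf_eq_nine (F := F)
  have h9 : 3 ^ 2 ∣ Monoid.exponent H := by
    refine Nat.Coprime.dvd_of_dvd_mul_right (by decide : Nat.Coprime 9 2) ?_
    rw [show 3 ^ 2 = 9 by rfl, ← hw, orderOf_dvd_iff_pow_eq_one, pow_mul]
    exact sq_eq_one_of_mem_center (hpow w)
  have h9' := (Nat.prime_three.pow_dvd_iff_le_factorization hE0).1 h9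
  obtain ⟨u, hu, huo⟩ := exists_mem_orderOf_eq_pow_factorization (H := H) Nat.prime_three
    (by decide)
  have htop := eq_top_of_forall_exists_orderOf_eq hu ⟨_, huo ▸ pow_orderOf_eq_one u⟩
    (fun h => by
      have := orderOf_dvd_of_pow_eq_one h
      rw [huo, ← pow_one 3] at this
      have := (Nat.pow_dvd_pow_iff_le_right (by decide : 1 < 3)).1 this
      lia)
    (fun r f hr hf => by
      obtain ⟨hq, -⟩ := card_mod_four (F := F)
      generalize Fintype.card F ^ 2 = Q at *
      have hmE : (Q + 1) / 2 ∣ Monoid.exponent H := by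
        refine Nat.dvd_of_mul_dvd_mul_right two_pos ?_
        rwa [Nat.div_mul_cancel (by lia)]
      rcases eq_or_ne r 2 with rfl | h2
      · have hf0 : f = 0 := by
          by_contra hf0
          have := (dvd_pow_self 2 hf0).trans hf
          lia
        exact ⟨1, Subgroup.one_mem _, by rw [hf0, orderOf_one, pow_zero]⟩
      · obtain ⟨t, ht, hto⟩ := exists_mem_orderOf_eq_pow_factorization (H := H) hr h2
        have hle := (hr.pow_dvd_iff_le_factorization hE0).1 (hf.trans hmE)
        refine ⟨t ^ r ^ ((Monoid.exponent H).factorization r - f), Subgroup.pow_mem _ ht _, ?_⟩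
        rw [orderOf_pow_of_dvd (pow_ne_zero _ hr.ne_zero) (hto ▸ pow_dvd_pow r (Nat.sub_le _ _)),
          hto, Nat.pow_div (Nat.sub_le _ _) hr.pos, Nat.sub_sub_self hle])
  rw [Subgroup.eq_top_iff']
  intro x
  obtain ⟨g, rfl⟩ := QuotientGroup.mk_surjective x
  exact (Subgroup.eq_top_iff' _).1 htop g

end Standard

end SymplecticFour

/-- Let `q = p^k` be a prime power and `G = PSp_4(F_q) = Sp_4(F_q)/Z(Sp_4(F_q))`.
Then `G` contains a proper subgroup with the same exponent as `G` iff `p ≠ 3`. -/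
theorem psp4_exists_proper_subgroup_same_exponent_iff (p k q : ℕ) (hp : p.Prime)
    (hk : 1 ≤ k) (hq : q = p ^ k)
    (F : Type) [Field F] [Fintype F] (hF : Fintype.card F = q) :
    (∃ H : Subgroup
        ((Matrix.symplecticGroup (Fin 2) F) ⧸
          Subgroup.center (Matrix.symplecticGroup (Fin 2) F)),
      H ≠ ⊤ ∧
        Monoid.exponent H =
          Monoid.exponent
            ((Matrix.symplecticGroup (Fin 2) F) ⧸
              Subgroup.center (Matrix.symplecticGroup (Fin 2) F))) ↔ p ≠ 3 := by
  have : Fact p.Prime := ⟨hp⟩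
  have hchar : CharP F p := charP_of_card_eq_prime_pow (hF.trans hq)
  constructor
  · rintro ⟨H, hne, hexp⟩ rfl
    exact hne (SymplecticFour.eq_top_of_exponent_eq hexp)
  · intro h3
    rcases eq_or_ne p 2 with rfl | h2
    · exact SymplecticFour.exists_exponent_eq_of_charP_two
    · have h4 : p ≠ 4 := by
        rintro rfl
        exact absurd hp (by decide)
      exact SymplecticFour.exists_exponent_eq_of_five_le (p := p) (by have := hp.two_le; lia)
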